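/- Let g : G → M_{m×k}(ℂ) be a rational matrix function, i.e., there exist a matrix polynomial P(s,p) with m×k complex matrix coefficients and a scalar complex polynomial q(s,p) with q(s,p) ≠ 0 for all (s,p) ∈ G, such that g(s,p) = P(s,p)/q(s,p) on G. Suppose ‖g(s,p)‖ ≤ 1 for all (s,p) ∈ G. Then there exist a finite-dimensional complex Hilbert space H and operators α₁, α₂ ∈ B(H), β : ℂᵏ → H, γ : H → ℂᵐ, δ : ℂᵏ → ℂᵐ such that M̃ = [[α₁, 0, β], [0, α₂, 0], [γ, 0, δ]] : H ⊕ H ⊕ ℂᵏ → H ⊕ H ⊕ ℂᵐ is a contraction, and for every (s,p) ∈ G the operator I − (s/2)(α₁ + α₂) + p·α₁α₂ is invertible and g(s,p) = δ + (1/2)·γ·(sI − 2p·α₂)·(I − (s/2)(α₁ + α₂) + p·α₁α₂)⁻¹·β. -/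

import Mathlib

noncomputable section

open ContinuousLinearMap MvPolynomial

/-- The open bidisk `𝔻² = {(z,ζ) : |z| < 1, |ζ| < 1}`. -/
def bidisk : Set (ℂ × ℂ) := {w : ℂ × ℂ | ‖w.1‖ < 1 ∧ ‖w.2‖ < 1}

/-- The symmetrized bidisk `𝔾`, the image of the bidisk under `(z,ζ) ↦ (z+ζ, zζ)`. -/
def symBidisk : Set (ℂ × ℂ) := (fun w : ℂ × ℂ => (w.1 + w.2, w.1 * w.2)) '' bidisk

/-- A rectangular complex matrix viewed as a continuous linear map between the corresponding
Euclidean (Hilbert) spaces; its operator norm is the usual operator norm of the matrix. -/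
def matCLM {m k : ℕ} (M : Matrix (Fin m) (Fin k) ℂ) :
    EuclideanSpace ℂ (Fin k) →L[ℂ] EuclideanSpace ℂ (Fin m) :=
  LinearMap.toContinuousLinearMap (Matrix.toEuclideanLin M)

section Defs

variable {H U Y : Type*}
  [NormedAddCommGroup H] [NormedSpace ℂ H]
  [NormedAddCommGroup U] [NormedSpace ℂ U]
  [NormedAddCommGroup Y] [NormedSpace ℂ Y]

/-- The colligation `M̃ = [[α₁,0,β],[0,α₂,0],[γ,0,δ]] : H ⊕ H ⊕ U → H ⊕ H ⊕ Y` is a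
contraction (with respect to the Hilbert space direct sum norms). -/
def GColligationContractive (α₁ α₂ : H →L[ℂ] H) (β : U →L[ℂ] H) (γ : H →L[ℂ] Y)
    (δ : U →L[ℂ] Y) : Prop :=
  ∀ (h₁ h₂ : H) (u : U),
    ‖α₁ h₁ + β u‖ ^ 2 + ‖α₂ h₂‖ ^ 2 + ‖γ h₁ + δ u‖ ^ 2 ≤ ‖h₁‖ ^ 2 + ‖h₂‖ ^ 2 + ‖u‖ ^ 2

/-- The transfer function `δ + ½ γ (sI - 2p α₂)(I - (s/2)(α₁+α₂) + p α₁α₂)⁻¹ β` associated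
with a colligation on the symmetrized bidisk. -/
def gTransfer (α₁ α₂ : H →L[ℂ] H) (β : U →L[ℂ] H) (γ : H →L[ℂ] Y) (δ : U →L[ℂ] Y)
    (s p : ℂ) : U →L[ℂ] Y :=
  δ + (2 : ℂ)⁻¹ •
    (γ ∘L ((s • (1 : H →L[ℂ] H) - (2 * p) • α₂) *
        Ring.inverse ((1 : H →L[ℂ] H) - (s / 2) • (α₁ + α₂) + p • (α₁ * α₂))) ∘L β)

end Defs

lemma lurking {I : Type*} {E F G : Type*} [NormedAddCommGroup E] [InnerProductSpace ℂ E]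
    [FiniteDimensional ℂ E] [NormedAddCommGroup F] [InnerProductSpace ℂ F]
    [FiniteDimensional ℂ F] [NormedAddCommGroup G] [InnerProductSpace ℂ G]
    (a : I → E) (b : I → F) (r : I → G)
    (h : ∀ i j, inner ℂ (a i) (a j) = inner ℂ (b i) (b j) + inner ℂ (r i) (r j)) :
    ∃ T : E →L[ℂ] F, (∀ x, ‖T x‖ ≤ ‖x‖) ∧ ∀ i, T (a i) = b i := by
  classical
  set A := Finsupp.linearCombination ℂ a
  set B := Finsupp.linearCombination ℂ b
  have key : ∀ l : I →₀ ℂ, ‖B l‖ ≤ ‖A l‖ := by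
    intro l
    have h1 : inner ℂ (A l) (A l) = inner ℂ (B l) (B l) +
        inner ℂ (Finsupp.linearCombination ℂ r l) (Finsupp.linearCombination ℂ r l) := by
      simp only [A, B, Finsupp.linearCombination_apply, Finsupp.sum, sum_inner, inner_sum,
        inner_smul_left, inner_smul_right, h, mul_add, Finset.sum_add_distrib]
    rw [inner_self_eq_norm_sq_to_K, inner_self_eq_norm_sq_to_K, inner_self_eq_norm_sq_to_K] at h1
    have h2 : ‖A l‖^2 = ‖B l‖^2 + ‖Finsupp.linearCombination ℂ r l‖^2 := by exact_mod_cast h1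
    exact le_of_sq_le_sq (by nlinarith [sq_nonneg ‖Finsupp.linearCombination ℂ r l‖]) (norm_nonneg _)
  have hker : LinearMap.ker A ≤ LinearMap.ker B := by
    intro l hl
    rw [LinearMap.mem_ker] at *
    have := key l
    rw [hl, norm_zero] at this
    exact norm_le_zero_iff.1 this
  let T0 : LinearMap.range A →ₗ[ℂ] F :=
    ((LinearMap.ker A).liftQ B hker) ∘ₗ (LinearMap.quotKerEquivRange A).symm.toLinearMap
  have hT0 : ∀ l, T0 ⟨A l, l, rfl⟩ = B l := by
    intro l
    have : (LinearMap.quotKerEquivRange A).symm ⟨A l, l, rfl⟩ = Submodule.Quotient.mk l := by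
      rw [LinearEquiv.symm_apply_eq]; rfl
    simp only [T0, LinearMap.comp_apply, LinearEquiv.coe_coe, this]
    rfl
  let T := LinearMap.toContinuousLinearMap
    (T0 ∘ₗ ((LinearMap.range A).orthogonalProjectionOnto).toLinearMap)
  refine ⟨T, ?_, ?_⟩
  · intro x
    obtain ⟨l, hl⟩ := ((LinearMap.range A).orthogonalProjectionOnto x).2
    have h1 : T x = B l := by
      rw [← hT0]
      simp only [T, LinearMap.coe_toContinuousLinearMap', LinearMap.comp_apply]
      congr 1
      exact Subtype.ext hl.symm
    rw [h1]
    refine (key l).trans ?_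
    rw [hl]
    exact (LinearMap.range A).norm_orthogonalProjectionOnto_apply_le x
  · intro i
    have h1 : a i = A (Finsupp.single i 1) := by simp [A]
    have h2 : b i = B (Finsupp.single i 1) := by simp [B]
    rw [h1, h2, ← hT0]
    simp only [T, LinearMap.coe_toContinuousLinearMap', LinearMap.comp_apply]
    congr 1
    exact Submodule.orthogonalProjectionOnto_mem_subspace_eq_self (K := LinearMap.range A) ⟨_, _, rfl⟩

lemma isUnit_aux {H : Type*} [NormedAddCommGroup H] [InnerProductSpace ℂ H]
    [FiniteDimensional ℂ H] (α τ : H →L[ℂ] H) (hα : ∀ x, ‖α x‖ ≤ ‖x‖) (hτ : ∀ x, ‖τ x‖ ≤ ‖x‖)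
    (z₁ z₂ : ℂ) (h₁ : ‖z₁‖ < 1) (h₂ : ‖z₂‖ < 1) :
    IsUnit ((1 : H →L[ℂ] H) - ((z₁ + z₂) / 2) • (α + τ) + (z₁ * z₂) • (α * τ)) := by
  have : CompleteSpace H := FiniteDimensional.complete ℂ H
  rw [ContinuousLinearMap.isUnit_iff_bijective]
  set D := ((1 : H →L[ℂ] H) - ((z₁ + z₂) / 2) • (α + τ) + (z₁ * z₂) • (α * τ)) with hD
  have hinj : Function.Injective D := by
    rw [injective_iff_map_eq_zero]
    intro h hh
    set h' := τ h with hh'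
    have e1 : h - ((z₁+z₂)/2) • h' = α (((z₁+z₂)/2) • h - (z₁*z₂) • h') := by
      rw [← sub_eq_zero, ← hh, hD]
      simp only [add_apply, sub_apply, one_apply_eq_self, smul_apply, mul_apply_eq_comp, map_sub, map_smul, ← hh']
      module
    have n1 : ‖h - ((z₁+z₂)/2) • h'‖ ≤ ‖((z₁+z₂)/2) • h - (z₁*z₂) • h'‖ := e1 ▸ hα _
    have n2 : ‖h'‖ ≤ ‖h‖ := hτ h
    set u := h - z₁ • h' with hu
    set v := h - z₂ • h' with hv
    have a1 : u + v = (2:ℂ) • (h - ((z₁+z₂)/2) • h') := by rw [hu, hv]; module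
    have a2 : z₂ • u + z₁ • v = (2:ℂ) • (((z₁+z₂)/2) • h - (z₁*z₂) • h') := by rw [hu, hv]; module
    have a3 : u - v = (z₂ - z₁) • h' := by rw [hu, hv]; module
    have a4 : z₂ • u - z₁ • v = (z₂ - z₁) • h := by rw [hu, hv]; module
    have b1 : ‖u+v‖ ≤ ‖z₂ • u + z₁ • v‖ := by
      rw [a1, a2, norm_smul, norm_smul]; gcongr
    have b2 : ‖u-v‖ ≤ ‖z₂ • u - z₁ • v‖ := by
      rw [a3, a4, norm_smul, norm_smul]; gcongr
    have p1 := parallelogram_law_with_norm ℂ u v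
    have p2 := parallelogram_law_with_norm ℂ (z₂ • u) (z₁ • v)
    rw [norm_smul, norm_smul] at p2
    have m1 := mul_self_le_mul_self (norm_nonneg _) b1
    have m2 := mul_self_le_mul_self (norm_nonneg _) b2
    have q1 : ‖z₁‖^2 < 1 := by nlinarith [norm_nonneg z₁]
    have q2 : ‖z₂‖^2 < 1 := by nlinarith [norm_nonneg z₂]
    have hu0 : (1 - ‖z₂‖^2) * ‖u‖^2 ≤ 0 := by
      have := mul_nonneg (sub_nonneg.2 q1.le) (sq_nonneg ‖v‖)
      linarith
    have hu1 : u = 0 := by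
      rw [← norm_eq_zero]
      by_contra hne
      have : 0 < ‖u‖^2 := by positivity
      have := mul_pos (sub_pos.2 q2) this
      linarith
    have hh1 : h = z₁ • h' := by rw [← sub_eq_zero, ← hu]; exact hu1
    have hn : ‖h‖ = ‖z₁‖ * ‖h'‖ := by rw [← norm_smul, ← hh1]
    have h0 : ‖h'‖ = 0 := by
      by_contra hne
      have h3 : 0 < ‖h'‖ := lt_of_le_of_ne (norm_nonneg _) (Ne.symm hne)
      have := mul_lt_mul_of_pos_right h₁ h3
      linarith
    rw [← norm_eq_zero, hn, h0, mul_zero]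
  exact ⟨hinj, (LinearMap.injective_iff_surjective (f := D.toLinearMap)).1 hinj⟩

lemma inner_toLp_mulVec {ι κ : Type*} [Fintype ι] [Fintype κ] (M N : Matrix ι κ ℂ) (u v : κ → ℂ) :
    inner ℂ (WithLp.toLp 2 (Matrix.mulVec M u)) (WithLp.toLp 2 (Matrix.mulVec N v)) =
      dotProduct (star u) (Matrix.mulVec (M.conjTranspose * N) v) := by
  rw [EuclideanSpace.inner_toLp_toLp, Matrix.star_mulVec, dotProduct_comm, ← Matrix.mulVec_mulVec,
    ← Matrix.dotProduct_mulVec]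

open Matrix in
theorem realize (m k : ℕ) (f : ℂ × ℂ → Matrix (Fin m) (Fin k) ℂ) {ι₁ ι₂ ι₃ : Type}
    [Fintype ι₁] [Fintype ι₂] [Fintype ι₃]
    (A₁ : ℂ × ℂ → Matrix ι₁ (Fin k) ℂ) (A₂ : ℂ × ℂ → Matrix ι₂ (Fin k) ℂ)
    (Q : ℂ × ℂ → Matrix ι₃ (Fin k) ℂ) (hsym : ∀ z ∈ bidisk, f z.swap = f z)
    (hker : ∀ z ∈ bidisk, ∀ w ∈ bidisk, 1 - (f w)ᴴ * f z =
      (1 - star w.1 * z.1) • ((A₁ w)ᴴ * A₁ z) + (1 - star w.2 * z.2) • ((A₂ w)ᴴ * A₂ z)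
        + (Q w)ᴴ * Q z) :
    ∃ (H : Type) (_ : NormedAddCommGroup H) (_ : InnerProductSpace ℂ H)
      (_ : FiniteDimensional ℂ H) (α₁ α₂ : H →L[ℂ] H)
      (β : EuclideanSpace ℂ (Fin k) →L[ℂ] H) (γ : H →L[ℂ] EuclideanSpace ℂ (Fin m))
      (δ : EuclideanSpace ℂ (Fin k) →L[ℂ] EuclideanSpace ℂ (Fin m)),
      GColligationContractive α₁ α₂ β γ δ ∧
        ∀ z ∈ bidisk,
          IsUnit ((1 : H →L[ℂ] H) - ((z.1 + z.2) / 2) • (α₁ + α₂) + (z.1 * z.2) • (α₁ * α₂)) ∧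
            matCLM (f z) = gTransfer α₁ α₂ β γ δ (z.1 + z.2) (z.1 * z.2) := by
  classical
  have hswap : ∀ z ∈ bidisk, z.swap ∈ bidisk := fun z hz => ⟨hz.2, hz.1⟩
  set a : ℂ × ℂ → Matrix (ι₁ ⊕ ι₂) (Fin k) ℂ := fun z => fromRows (A₁ z) (A₂ z.swap) with ha
  set b : ℂ × ℂ → Matrix (ι₁ ⊕ ι₂) (Fin k) ℂ := fun z => fromRows (A₁ z.swap) (A₂ z) with hb
  have i1 : ∀ z ∈ bidisk, ∀ w ∈ bidisk, (2:ℂ) • (1 - (f w)ᴴ * f z) =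
      (1 - star w.1 * z.1) • ((a w)ᴴ * a z) + (1 - star w.2 * z.2) • ((b w)ᴴ * b z)
        + (Q w)ᴴ * Q z + (Q w.swap)ᴴ * Q z.swap := by
    intro z hz w hw
    have e1 := hker z hz w hw
    have e2 := hker _ (hswap z hz) _ (hswap w hw)
    rw [hsym z hz, hsym w hw] at e2
    simp only [ha, hb, conjTranspose_fromRows_eq_fromCols_conjTranspose, fromCols_mul_fromRows]
    simp only [Prod.fst_swap, Prod.snd_swap] at e2
    rw [two_smul]
    nth_rewrite 1 [e1]
    rw [e2]
    module
  have i2 : ∀ z ∈ bidisk, ∀ w ∈ bidisk, (2:ℂ) • (1 - (f w)ᴴ * f z) =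
      (1 - star w.1 * z.2) • ((a w)ᴴ * b z) + (1 - star w.2 * z.1) • ((b w)ᴴ * a z)
        + (Q w)ᴴ * Q z.swap + (Q w.swap)ᴴ * Q z := by
    intro z hz w hw
    have e1 := hker _ (hswap z hz) w hw
    have e2 := hker _ hz _ (hswap w hw)
    rw [hsym z hz] at e1
    rw [hsym w hw] at e2
    simp only [ha, hb, conjTranspose_fromRows_eq_fromCols_conjTranspose, fromCols_mul_fromRows]
    simp only [Prod.fst_swap, Prod.snd_swap] at e1 e2
    rw [two_smul]
    nth_rewrite 1 [e1]
    rw [e2]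
    module
  have even : ∀ z ∈ bidisk, ∀ w ∈ bidisk,
      (4:ℂ) • (1 : Matrix (Fin k) (Fin k) ℂ) + (w.1 • a w + w.2 • b w)ᴴ * (z.1 • a z + z.2 • b z) =
       (4:ℂ) • ((f w)ᴴ * f z) + (a w + b w)ᴴ * (a z + b z) +
         (Q w + Q w.swap)ᴴ * (Q z + Q z.swap) := by
    intro z hz w hw
    have e1 := i1 z hz w hw
    have e2 := i2 z hz w hw
    simp only [conjTranspose_add, conjTranspose_smul, Matrix.add_mul, Matrix.mul_add, Matrix.smul_mul, Matrix.mul_smul]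
    linear_combination (norm := module) e1 + e2
  have odd : ∀ z ∈ bidisk, ∀ w ∈ bidisk,
      (w.1 • a w - w.2 • b w)ᴴ * (z.1 • a z - z.2 • b z) =
       (a w - b w)ᴴ * (a z - b z) + (Q w - Q w.swap)ᴴ * (Q z - Q z.swap) := by
    intro z hz w hw
    have e1 := i1 z hz w hw
    have e2 := i2 z hz w hw
    simp only [conjTranspose_sub, conjTranspose_smul, Matrix.sub_mul, Matrix.mul_sub, Matrix.smul_mul, Matrix.mul_smul]
    linear_combination (norm := module) e1 - e2
  let H := EuclideanSpace ℂ (ι₁ ⊕ ι₂)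
  let U := EuclideanSpace ℂ (Fin k)
  let Y := EuclideanSpace ℂ (Fin m)
  let I := bidisk × (Fin k → ℂ)
  obtain ⟨τ, hτ, hτe⟩ := lurking (I := I) (E := H) (F := H) (G := EuclideanSpace ℂ ι₃)
    (fun i => WithLp.toLp 2 ((i.1.1.1 • a i.1.1 - i.1.1.2 • b i.1.1) *ᵥ i.2))
    (fun i => WithLp.toLp 2 ((a i.1.1 - b i.1.1) *ᵥ i.2))
    (fun i => WithLp.toLp 2 ((Q i.1.1 - Q i.1.1.swap) *ᵥ i.2)) (by
      rintro ⟨⟨w, hw⟩, u⟩ ⟨⟨z, hz⟩, v⟩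
      dsimp only
      rw [inner_toLp_mulVec, inner_toLp_mulVec, inner_toLp_mulVec, odd z hz w hw, add_mulVec, dotProduct_add])
  obtain ⟨M, hM, hMe⟩ := lurking (I := I) (E := WithLp 2 (H × U)) (F := WithLp 2 (H × Y))
    (G := EuclideanSpace ℂ ι₃)
    (fun i => WithLp.toLp 2 (WithLp.toLp 2 ((i.1.1.1 • a i.1.1 + i.1.1.2 • b i.1.1) *ᵥ i.2),
      WithLp.toLp 2 (((2:ℂ) • (1 : Matrix (Fin k) (Fin k) ℂ)) *ᵥ i.2)))
    (fun i => WithLp.toLp 2 (WithLp.toLp 2 ((a i.1.1 + b i.1.1) *ᵥ i.2),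
      WithLp.toLp 2 (((2:ℂ) • f i.1.1) *ᵥ i.2)))
    (fun i => WithLp.toLp 2 ((Q i.1.1 + Q i.1.1.swap) *ᵥ i.2)) (by
      rintro ⟨⟨w, hw⟩, u⟩ ⟨⟨z, hz⟩, v⟩
      simp only [WithLp.prod_inner_apply]
      rw [inner_toLp_mulVec, inner_toLp_mulVec, inner_toLp_mulVec, inner_toLp_mulVec,
       inner_toLp_mulVec,
       ← dotProduct_add, ← dotProduct_add, ← dotProduct_add, ← add_mulVec, ← add_mulVec, ← add_mulVec]
      congr 2
      have := even z hz w hw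
      simp only [conjTranspose_smul, Matrix.smul_mul, Matrix.mul_smul, conjTranspose_one, one_mul, smul_smul]
      rw [show (2 * star (2:ℂ)) = 4 by simp; norm_num]
      rw [add_comm, this]
      abel)
  let L : (H × U) →L[ℂ] WithLp 2 (H × U) := (WithLp.prodContinuousLinearEquiv 2 ℂ H U).symm
  let L' : WithLp 2 (H × Y) →L[ℂ] (H × Y) := (WithLp.prodContinuousLinearEquiv 2 ℂ H Y)
  let N := L' ∘L M ∘L L
  have hN : ∀ x : H × U, ‖(N x).1‖^2 + ‖(N x).2‖^2 ≤ ‖x.1‖^2 + ‖x.2‖^2 := by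
    intro x
    have h1 := hM (L x)
    have h2 := pow_le_pow_left₀ (norm_nonneg _) h1 2
    rw [WithLp.prod_norm_sq_eq_of_L2, WithLp.prod_norm_sq_eq_of_L2] at h2
    exact h2
  have hNe : ∀ z ∈ bidisk, ∀ u : Fin k → ℂ, N (WithLp.toLp 2 ((z.1 • a z + z.2 • b z) *ᵥ u),
      WithLp.toLp 2 (((2:ℂ) • (1 : Matrix (Fin k) (Fin k) ℂ)) *ᵥ u)) =
      (WithLp.toLp 2 ((a z + b z) *ᵥ u),  WithLp.toLp 2 (((2:ℂ) • f z) *ᵥ u)) := by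
    intro z hz u
    have := hMe (⟨z, hz⟩, u)
    exact congrArg (WithLp.ofLp) this
  let α₁ : H →L[ℂ] H := (ContinuousLinearMap.fst ℂ H Y) ∘L N ∘L (ContinuousLinearMap.inl ℂ H U)
  let β : U →L[ℂ] H := (ContinuousLinearMap.fst ℂ H Y) ∘L N ∘L (ContinuousLinearMap.inr ℂ H U)
  let γ : H →L[ℂ] Y := (ContinuousLinearMap.snd ℂ H Y) ∘L N ∘L (ContinuousLinearMap.inl ℂ H U)
  let δ : U →L[ℂ] Y := (ContinuousLinearMap.snd ℂ H Y) ∘L N ∘L (ContinuousLinearMap.inr ℂ H U)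
  have hsplit : ∀ h u, N (h, u) = (α₁ h + β u, γ h + δ u) := by
    intro h u
    have : ((h, u) : H × U) = (h, 0) + (0, u) := by simp
    rw [this, map_add]
    rfl
  have hα : ∀ x, ‖α₁ x‖ ≤ ‖x‖ := by
    intro x
    have := hN (x, 0)
    rw [hsplit] at this
    simp only [map_zero, add_zero, norm_zero] at this
    exact le_of_sq_le_sq (by nlinarith [sq_nonneg ‖γ x‖]) (norm_nonneg _)
  refine ⟨H, inferInstance, inferInstance, inferInstance, α₁, τ, β, γ, δ, ?_, ?_⟩
  · intro h₁ h₂ u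
    have e1 := hN (h₁, u)
    rw [hsplit] at e1
    have e2 := pow_le_pow_left₀ (norm_nonneg _) (hτ h₂) 2
    dsimp only at e1
    linarith
  · intro z hz
    have hun := isUnit_aux α₁ τ hα hτ z.1 z.2 hz.1 hz.2
    refine ⟨hun, ?_⟩
    have hun2 : IsUnit ((1 : H →L[ℂ] H) - ((z.1 + z.2) / 2) • ((0 : H →L[ℂ] H) + τ)
       + (z.1 * z.2) • ((0 : H →L[ℂ] H) * τ)) :=
      isUnit_aux 0 τ (by simp) hτ z.1 z.2 hz.1 hz.2
    set D := ((1 : H →L[ℂ] H) - ((z.1 + z.2) / 2) • (α₁ + τ) + (z.1 * z.2) • (α₁ * τ)) with hD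
    ext1 u
    set c : H := WithLp.toLp 2 ((a z + b z) *ᵥ u.ofLp) with hc
    set e : H := WithLp.toLp 2 ((a z - b z) *ᵥ u.ofLp) with he
    set φ : H := WithLp.toLp 2 ((z.1 • a z + z.2 • b z) *ᵥ u.ofLp) with hφ
    set ψ : H := WithLp.toLp 2 ((z.1 • a z - z.2 • b z) *ᵥ u.ofLp) with hψ
    have k1 : τ ψ = e := hτe (⟨z, hz⟩, u)
    have k2 := hNe z hz u
    rw [hsplit, Prod.mk.injEq] at k2
    have k0 : (WithLp.toLp 2 (((2:ℂ) • (1 : Matrix (Fin k) (Fin k) ℂ)) *ᵥ u.ofLp)) = (2:ℂ) • u := by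
      rw [smul_mulVec, one_mulVec]; rfl
    have k0' : (WithLp.toLp 2 (((2:ℂ) • f z) *ᵥ u.ofLp)) = (2:ℂ) • matCLM (f z) u := by
      rw [smul_mulVec]; rfl
    rw [k0, k0'] at k2
    obtain ⟨k2, k3⟩ := k2
    rw [← hφ, ← hc] at k2
    rw [← hφ] at k3
    have hφ' : φ = (2:ℂ)⁻¹ • ((z.1+z.2) • c + (z.1 - z.2) • e) := by
      simp only [hφ, hc, he, add_mulVec, sub_mulVec, smul_mulVec, WithLp.toLp_add, WithLp.toLp_sub,
        WithLp.toLp_smul]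
      module
    have hψ' : ψ = (2:ℂ)⁻¹ • ((z.1-z.2) • c + (z.1 + z.2) • e) := by
      simp only [hψ, hc, he, add_mulVec, sub_mulVec, smul_mulVec, WithLp.toLp_add, WithLp.toLp_sub,
        WithLp.toLp_smul]
      module
    rw [ContinuousLinearMap.isUnit_iff_bijective] at hun2
    obtain ⟨x, hx⟩ := hun2.2 c
    have hx' : c = x - ((z.1+z.2)/2) • τ x := by
      rw [← hx]; simp
    have k4 : φ = (2:ℂ)⁻¹ • ((z.1+z.2) • x - (2*(z.1*z.2)) • τ x) := by
      apply hun2.1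
      rw [hψ'] at k1
      simp only [map_smul, map_add] at k1
      simp only [zero_mul, smul_zero, add_zero, zero_add, _root_.sub_apply, one_apply_eq_self, _root_.smul_apply, map_smul,
        map_sub]
      rw [hφ']
      simp only [map_smul, map_add]
      have k5 : e = (2:ℂ)⁻¹ • ((z.1-z.2) • τ c + (z.1 + z.2) • τ e) := k1.symm
      have k6 : τ c = τ x - ((z.1+z.2)/2) • τ (τ x) := by rw [hx']; simp
      rw [k6] at k5 ⊢
      rw [hx']
      linear_combination (norm := module) ((z.1 - z.2)/2) • k5
    have k7 : D x = (2:ℂ) • β u := by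
      rw [map_smul] at k2
      have : (2:ℂ) • β u = c - α₁ φ := by rw [← k2]; simp
      rw [this, hx', k4, hD]
      simp only [_root_.add_apply, _root_.sub_apply, one_apply_eq_self, _root_.smul_apply, mul_apply_eq_comp, map_sub, map_smul]
      module
    have k8 : Ring.inverse D ((2:ℂ) • β u) = x := by
      rw [← k7, ← mul_apply_eq_comp, Ring.inverse_mul_cancel _ hun, one_apply_eq_self]
    have k9 : Ring.inverse D (β u) = (2:ℂ)⁻¹ • x := by
      rw [← k8, map_smul, smul_smul]; norm_num
    have : gTransfer α₁ τ β γ δ (z.1 + z.2) (z.1 * z.2) u = δ u + (2:ℂ)⁻¹ •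
       γ ((z.1+z.2) • (Ring.inverse D (β u)) - (2*(z.1*z.2)) • τ (Ring.inverse D (β u))) := rfl
    rw [this, k9]
    rw [k4, map_smul] at k3
    simp only [map_smul, map_sub] at k3 ⊢
    linear_combination (norm := module) (-(2:ℂ)⁻¹) • k3

/-- Conjugation of coefficients. -/
instance polyStarRing {R : Type*} [CommRing R] [StarRing R] : StarRing (Polynomial R) where
  star p := p.map (starRingEnd R)
  star_involutive p := by
    change (p.map (starRingEnd R)).map (starRingEnd R) = p
    rw [Polynomial.map_map]
    have : (starRingEnd R).comp (starRingEnd R) = RingHom.id R := by ext; simp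
    rw [this, Polynomial.map_id]
  star_mul p q := by
    change (p * q).map (starRingEnd R) = q.map (starRingEnd R) * p.map (starRingEnd R)
    rw [Polynomial.map_mul, mul_comm]
  star_add p q := by
    change (p + q).map (starRingEnd R) = _
    rw [Polynomial.map_add]

section StarPoly
variable {R : Type*} [CommRing R] [StarRing R]

lemma star_poly (p : Polynomial R) : star p = p.map (starRingEnd R) := rfl

@[simp] lemma coeff_star_poly (p : Polynomial R) (n : ℕ) : (star p).coeff n = star (p.coeff n) := by
  rw [star_poly, Polynomial.coeff_map]; rfl

@[simp] lemma star_poly_C (a : R) : star (Polynomial.C a) = Polynomial.C (star a) := by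
  rw [star_poly, Polynomial.map_C]; rfl

@[simp] lemma star_poly_X : star (Polynomial.X : Polynomial R) = Polynomial.X := by
  rw [star_poly, Polynomial.map_X]

lemma starRingEnd_inj : Function.Injective (starRingEnd R) := star_injective

@[simp] lemma natDegree_star_poly (p : Polynomial R) : (star p).natDegree = p.natDegree :=
  Polynomial.natDegree_map_eq_of_injective starRingEnd_inj p

@[simp] lemma degree_star_poly (p : Polynomial R) : (star p).degree = p.degree :=
  Polynomial.degree_map_eq_of_injective starRingEnd_inj p

lemma eval_star_poly (p : Polynomial R) (x : R) : (star p).eval x = star (p.eval (star x)) := by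
  have h := Polynomial.eval_map_apply (p := p) (starRingEnd R) (star x)
  simp only [starRingEnd_apply, star_star] at h
  exact h

end StarPoly

/-- The standard hermitian form is anisotropic. -/
def Aniso (R : Type*) [CommRing R] [StarRing R] : Prop :=
  ∀ (ι : Type) [Fintype ι] (c : ι → R), ∑ i, star (c i) * c i = 0 → c = 0

lemma aniso_complex : Aniso ℂ := by
  intro ι _ c h
  have h1 : ∑ i, (Complex.normSq (c i)) = 0 := by
    have : ((∑ i, (Complex.normSq (c i)) : ℝ) : ℂ) = 0 := by
      rw [← h]; push_cast
      refine Finset.sum_congr rfl fun i _ => ?_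
      rw [Complex.normSq_eq_conj_mul_self]; rfl
    exact_mod_cast this
  rw [Finset.sum_eq_zero_iff_of_nonneg (fun i _ => Complex.normSq_nonneg _)] at h1
  funext i
  exact Complex.normSq_eq_zero.1 (h1 i (Finset.mem_univ _))

lemma Aniso.poly {R : Type*} [CommRing R] [StarRing R] (h : Aniso R) : Aniso (Polynomial R) := by
  intro ι _ c hc
  by_contra hne
  let d := Finset.univ.sup (fun i => (c i).natDegree)
  have hd : ∀ i, (c i).natDegree ≤ d := fun i =>
    Finset.le_sup (f := fun i => (c i).natDegree) (Finset.mem_univ i)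
  have h0 : (fun i => (c i).coeff d) = 0 := by
    apply h
    have := congrArg (fun p => Polynomial.coeff p (d + d)) hc
    simp only [Polynomial.finsetSum_coeff, Polynomial.coeff_zero] at this
    rw [← this]
    refine Finset.sum_congr rfl fun i _ => ?_
    rw [Polynomial.coeff_mul_add_eq_of_natDegree_le (by rw [natDegree_star_poly]; exact hd i) (hd i)]
    simp
  obtain ⟨i0, hi0⟩ := Function.ne_iff.1 hne
  obtain ⟨i, _, hi⟩ := Finset.exists_mem_eq_sup Finset.univ ⟨i0, Finset.mem_univ i0⟩
    (fun i => (c i).natDegree)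
  have hci : c i = 0 := by
    rw [← Polynomial.leadingCoeff_eq_zero, Polynomial.leadingCoeff, ← hi]
    exact congrFun h0 i
  have hd0 : d = 0 := by
    change Finset.univ.sup (fun i => (c i).natDegree) = 0
    rw [hi, hci]; simp
  apply hi0
  have h1 := hd i0
  rw [hd0] at h1
  have h2 := Polynomial.eq_C_of_natDegree_le_zero h1
  have h3 := congrFun h0 i0
  simp only [hd0] at h3
  rw [h2, h3]; simp

/-- conjugation on the fraction field -/
def fracConj (R : Type*) [CommRing R] [IsDomain R] [StarRing R] :
    FractionRing R →+* FractionRing R :=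
  IsFractionRing.lift (A := R) (K := FractionRing R)
    (g := (algebraMap R (FractionRing R)).comp (starRingEnd R))
    ((IsFractionRing.injective R (FractionRing R)).comp starRingEnd_inj)

lemma fracConj_algebraMap (R : Type*) [CommRing R] [IsDomain R] [StarRing R] (x : R) :
    fracConj R (algebraMap R _ x) = algebraMap R _ (star x) := by
  unfold fracConj
  rw [IsFractionRing.lift_algebraMap]; rfl

instance fracStarRing {R : Type*} [CommRing R] [IsDomain R] [StarRing R] :
    StarRing (FractionRing R) where
  star x := fracConj R x
  star_involutive x := by
    obtain ⟨a, b, hb, rfl⟩ := IsFractionRing.div_surjective (A := R) x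
    change fracConj R (fracConj R _) = _
    simp [map_div₀, fracConj_algebraMap]
  star_mul p q := by
    change fracConj R _ = fracConj R _ * fracConj R _
    rw [map_mul, mul_comm]
  star_add p q := by
    change fracConj R _ = fracConj R _ + fracConj R _
    rw [map_add]

@[simp] lemma star_frac_algebraMap {R : Type*} [CommRing R] [IsDomain R] [StarRing R] (x : R) :
    star (algebraMap R (FractionRing R) x) = algebraMap R _ (star x) := fracConj_algebraMap R x

/-- common denominators -/
lemma frac_common_denom {R : Type*} [CommRing R] [IsDomain R] {ι : Type*} [Finite ι]
    (c : ι → FractionRing R) : ∃ (b : R) (d : ι → R), b ≠ 0 ∧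
      ∀ i, algebraMap R (FractionRing R) b * c i = algebraMap R _ (d i) := by
  obtain ⟨b, hb⟩ := IsLocalization.exist_integer_multiples_of_finite (nonZeroDivisors R) c
  choose d hd using hb
  refine ⟨b, d, nonZeroDivisors.ne_zero b.2, fun i => ?_⟩
  rw [hd i, Algebra.smul_def]

lemma Aniso.frac {R : Type*} [CommRing R] [IsDomain R] [StarRing R] (h : Aniso R) :
    Aniso (FractionRing R) := by
  intro ι _ c hc
  obtain ⟨b, d, hb, hd⟩ := frac_common_denom c
  have hb' : algebraMap R (FractionRing R) b ≠ 0 := by simpa using hb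
  have : d = 0 := by
    apply h
    apply IsFractionRing.injective R (FractionRing R)
    rw [map_sum, map_zero]
    have : ∀ i, algebraMap R (FractionRing R) (star (d i) * d i) =
       (algebraMap R _ (star b) * algebraMap R _ b) * (star (c i) * c i) := by
      intro i
      rw [map_mul, ← star_frac_algebraMap, ← hd, star_mul, star_frac_algebraMap]; ring
    simp only [this]
    rw [← Finset.mul_sum, hc, mul_zero]
  funext i
  have h1 := hd i
  rw [this] at h1
  simpa [hb] using h1

section CP
variable (k : Type) [Field k]

local notation "Rk" => Polynomial k
local notation "Kk" => FractionRing (Polynomial k)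
local notation "ιk" => algebraMap (Polynomial k) (FractionRing (Polynomial k))

/-- strictly proper fractions -/
def SP : Submodule k (FractionRing (Polynomial k)) where
  carrier := {f | ∃ u w : Polynomial k, w ≠ 0 ∧ u.degree < w.degree ∧ f * ιk w = ιk u}
  zero_mem' := ⟨0, 1, one_ne_zero, by simp, by simp⟩
  add_mem' := by
    rintro f g ⟨u, w, hw, hd, he⟩ ⟨u', w', hw', hd', he'⟩
    refine ⟨u * w' + u' * w, w * w', mul_ne_zero hw hw', ?_, ?_⟩
    · refine lt_of_le_of_lt (Polynomial.degree_add_le _ _) (max_lt ?_ ?_)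
      · rw [Polynomial.degree_mul, Polynomial.degree_mul]
        exact WithBot.add_lt_add_right (by simpa using hw') hd
      · rw [Polynomial.degree_mul, Polynomial.degree_mul, add_comm]
        exact WithBot.add_lt_add_left (by simpa using hw) hd'
    · rw [map_add, map_mul, map_mul, map_mul, ← he, ← he']; ring
  smul_mem' := by
    rintro c f ⟨u, w, hw, hd, he⟩
    refine ⟨Polynomial.C c * u, w, hw, ?_, ?_⟩
    · refine lt_of_le_of_lt ?_ hd
      rw [← Polynomial.smul_eq_C_mul]; exact Polynomial.degree_smul_le _ _
    · rw [map_mul, ← he, ← Polynomial.algebraMap_eq, ← IsScalarTower.algebraMap_apply, Algebra.smul_def]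
      ring

variable {k}

lemma mem_SP {f : Kk} : f ∈ SP k ↔ ∃ u w : Polynomial k, w ≠ 0 ∧ u.degree < w.degree ∧ f * ιk w = ιk u :=
  Iff.rfl

lemma SP_mul {f g : Kk} (hf : f ∈ SP k) (hg : g ∈ SP k) : f * g ∈ SP k := by
  obtain ⟨u, w, hw, hd, he⟩ := hf
  obtain ⟨u', w', hw', hd', he'⟩ := hg
  refine ⟨u * u', w * w', mul_ne_zero hw hw', ?_, ?_⟩
  · rw [Polynomial.degree_mul, Polynomial.degree_mul]
    exact lt_of_le_of_lt (by gcongr) (WithBot.add_lt_add_right (by simpa using hw') hd)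
  · rw [map_mul, map_mul, ← he, ← he']; ring

lemma SP_star [StarRing k] {f : Kk} (hf : f ∈ SP k) : star f ∈ SP k := by
  obtain ⟨u, w, hw, hd, he⟩ := hf
  refine ⟨star u, star w, by simpa using hw, by simpa using hd, ?_⟩
  rw [← star_frac_algebraMap, ← star_frac_algebraMap, ← he, star_mul, mul_comm]

lemma SP_poly {u : Polynomial k} (h : ιk u ∈ SP k) : u = 0 := by
  obtain ⟨u', w, hw, hd, he⟩ := h
  rw [← map_mul] at he
  have := IsFractionRing.injective _ _ he
  by_contra hu
  rw [← this, Polynomial.degree_mul] at hd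
  rw [Polynomial.degree_eq_natDegree hu, Polynomial.degree_eq_natDegree hw] at hd
  norm_cast at hd
  omega

lemma exists_pp (f : Kk) : ∃ u : Polynomial k, f - ιk u ∈ SP k := by
  obtain ⟨a, b, hb, rfl⟩ := IsFractionRing.div_surjective (A := Polynomial k) f
  have hb0 : b ≠ 0 := nonZeroDivisors.ne_zero hb
  have hb' : ιk b ≠ 0 := by simpa using hb0
  refine ⟨a / b, a % b, b, hb0, EuclideanDomain.mod_lt a hb0, ?_⟩
  rw [sub_mul, div_mul_cancel₀ _ hb', ← map_mul, ← map_sub]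
  congr 1
  linear_combination -(EuclideanDomain.div_add_mod a b)

/-- polynomial part -/
def pp : Kk →ₗ[k] Rk where
  toFun f := (exists_pp f).choose
  map_add' f g := by
    have h1 := (exists_pp f).choose_spec
    have h2 := (exists_pp g).choose_spec
    have h3 := (exists_pp (f + g)).choose_spec
    rw [← sub_eq_zero]
    apply SP_poly
    have := (SP k).sub_mem ((SP k).add_mem h1 h2) h3
    convert this using 1
    rw [map_sub, map_add]; ring
  map_smul' c f := by
    have h1 := (exists_pp f).choose_spec
    have h3 := (exists_pp (c • f)).choose_spec
    rw [← sub_eq_zero]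
    apply SP_poly
    have := (SP k).sub_mem ((SP k).smul_mem c h1) h3
    convert this using 1
    simp only [RingHom.id_apply]
    rw [map_sub, Algebra.smul_def c ((exists_pp f).choose), map_mul,
      ← IsScalarTower.algebraMap_apply, smul_sub, Algebra.smul_def c (ιk _)]
    ring

lemma pp_spec (f : Kk) : f - ιk (pp f) ∈ SP k := (exists_pp f).choose_spec

lemma pp_eq {f : Kk} {u : Polynomial k} (h : f - ιk u ∈ SP k) : pp f = u := by
  rw [← sub_eq_zero]
  apply SP_poly
  convert (SP k).sub_mem h (pp_spec f) using 1
  rw [map_sub]; ring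

lemma pp_poly (u : Polynomial k) : pp (ιk u) = u := pp_eq (by simp)

lemma pp_SP {f : Kk} (h : f ∈ SP k) : pp f = 0 := pp_eq (by simpa using h)

/-- residue at infinity -/
def resK : Kk →ₗ[k] k :=
  (Polynomial.lcoeff k 0) ∘ₗ pp ∘ₗ (LinearMap.mulLeft k (ιk Polynomial.X))

lemma resK_poly (u : Polynomial k) : resK (ιk u) = 0 := by
  simp only [resK, LinearMap.comp_apply, LinearMap.mulLeft_apply, ← map_mul, pp_poly]
  simp

lemma resK_nondeg {f : Kk} (h : ∀ j : ℕ, resK (ιk (Polynomial.X ^ j) * f) = 0) :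
    ∃ u, ιk u = f := by
  by_contra hne
  push Not at hne
  obtain ⟨u, w, hw, hd, he⟩ := pp_spec f
  have hu : u ≠ 0 := by
    rintro rfl
    have hw' : ιk w ≠ 0 := by simpa using hw
    rw [map_zero, mul_eq_zero, or_iff_left hw', sub_eq_zero] at he
    exact hne _ he.symm
  have hd2 : u.natDegree < w.natDegree := Polynomial.natDegree_lt_natDegree hu hd
  set j := w.natDegree - u.natDegree - 1 with hj
  have hjj : u.natDegree + (j + 1) = w.natDegree := by omega
  set c : k := u.leadingCoeff / w.leadingCoeff with hc
  have hlw : w.leadingCoeff ≠ 0 := by simpa using hw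
  have hlu : u.leadingCoeff ≠ 0 := by simpa using hu
  have key : pp (ιk (Polynomial.X ^ (j+1)) * (f - ιk (pp f))) = Polynomial.C c := by
    apply pp_eq
    refine ⟨Polynomial.X ^ (j+1) * u - Polynomial.C c * w, w, hw, ?_, ?_⟩
    · have h1 : (Polynomial.X ^ (j+1) * u).degree = w.degree := by
        rw [Polynomial.degree_mul, Polynomial.degree_X_pow, Polynomial.degree_eq_natDegree hu,
          Polynomial.degree_eq_natDegree hw, ← hjj]
        push_cast; ring
      rw [← h1]
      apply Polynomial.degree_sub_lt
      · rw [h1, Polynomial.degree_C_mul (div_ne_zero hlu hlw)]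
      · simp [hu]
      · simp [hc]; field_simp
    · rw [sub_mul, mul_assoc, he]; simp
  have h1 := h j
  simp only [resK, LinearMap.comp_apply, LinearMap.mulLeft_apply] at h1
  have h2 : ιk Polynomial.X * (ιk (Polynomial.X ^ j) * f) =
      ιk (Polynomial.X ^ (j+1)) * (f - ιk (pp f)) + ιk (Polynomial.X ^ (j+1) * pp f) := by
    simp only [map_mul, map_pow]; ring
  rw [h2, map_add, key, pp_poly] at h1
  simp [pow_succ, mul_assoc] at h1
  rw [hc] at h1
  exact (div_ne_zero hlu hlw) h1

end CP

section CP
open Matrix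
variable {k : Type} [Field k] [StarRing k]

local notation "Rk" => Polynomial k
local notation "Kk" => FractionRing (Polynomial k)
local notation "ιk" => algebraMap (Polynomial k) (FractionRing (Polynomial k))

/-- being a polynomial -/
def IsP (f : Kk) : Prop := ∃ u, ιk u = f

lemma IsP.add {f g : Kk} (hf : IsP f) (hg : IsP g) : IsP (f + g) := by
  obtain ⟨u, rfl⟩ := hf; obtain ⟨v, rfl⟩ := hg; exact ⟨u + v, map_add _ _ _⟩
lemma IsP.mul {f g : Kk} (hf : IsP f) (hg : IsP g) : IsP (f * g) := by
  obtain ⟨u, rfl⟩ := hf; obtain ⟨v, rfl⟩ := hg; exact ⟨u * v, map_mul _ _ _⟩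
lemma IsP.star {f : Kk} (hf : IsP f) : IsP (star f) := by
  obtain ⟨u, rfl⟩ := hf; exact ⟨Star.star u, (star_frac_algebraMap u).symm⟩
lemma IsP.sum {α : Type*} {s : Finset α} {f : α → Kk} (hf : ∀ i ∈ s, IsP (f i)) : IsP (∑ i ∈ s, f i) :=
  Finset.sum_induction f IsP (fun _ _ => IsP.add) ⟨0, map_zero _⟩ hf
lemma IsP.smul {f : Kk} (c : k) (hf : IsP f) : IsP (c • f) := by
  obtain ⟨u, rfl⟩ := hf
  refine ⟨Polynomial.C c * u, ?_⟩
  rw [map_mul, ← Polynomial.algebraMap_eq, ← IsScalarTower.algebraMap_apply, Algebra.smul_def]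
lemma IsP.eq_zero {f : Kk} (hf : IsP f) (h : f ∈ SP k) : f = 0 := by
  obtain ⟨u, rfl⟩ := hf
  rw [SP_poly h, map_zero]
lemma isP_poly (u : Rk) : IsP (ιk u) := ⟨u, rfl⟩

lemma star_smul_Kk (c : k) (f : Kk) : star (c • f) = star c • star f := by
  rw [Algebra.smul_def, Algebra.smul_def, star_mul, mul_comm, IsScalarTower.algebraMap_apply k Rk Kk,
    star_frac_algebraMap, Polynomial.algebraMap_eq, star_poly_C, ← Polynomial.algebraMap_eq,
    ← IsScalarTower.algebraMap_apply k Rk Kk]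

variable {ι n : Type} [Fintype ι] [Fintype n]

/-- the map `v ↦ B v` on polynomial vectors -/
def Bl (B : Matrix ι n Kk) : (n → Rk) →ₗ[k] (ι → Kk) :=
  (B.mulVecLin.restrictScalars k) ∘ₗ ((IsScalarTower.toAlgHom k Rk Kk).toLinearMap.compLeft n)

lemma Bl_apply (B : Matrix ι n Kk) (v : n → Rk) : Bl B v = B *ᵥ (fun j => ιk (v j)) := rfl

lemma polyvec_smul (c : k) (l : ι → Rk) : (fun i => ιk ((c • l) i)) = c • fun i => ιk (l i) := by
  funext i
  exact (IsScalarTower.toAlgHom k Rk Kk).toLinearMap.map_smul c (l i)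

/-- pairing -/
def pairK (B : Matrix ι n Kk) (l : ι → Rk) : (n → Rk) →ₗ[k] Kk :=
  (LinearMap.restrictScalars k (Fintype.linearCombination Kk (M := Kk) (fun i => star (ιk (l i))))) ∘ₗ Bl B

lemma pairK_apply (B : Matrix ι n Kk) (l : ι → Rk) (v : n → Rk) :
    pairK B l v = star (fun i => ιk (l i)) ⬝ᵥ Bl B v := by
  simp only [pairK, LinearMap.comp_apply, LinearMap.coe_restrictScalars, Fintype.linearCombination_apply,
    dotProduct, smul_eq_mul, Pi.star_apply]
  exact Finset.sum_congr rfl fun i _ => mul_comm _ _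

lemma pairK_add (B : Matrix ι n Kk) (l l' : ι → Rk) : pairK B (l + l') = pairK B l + pairK B l' := by
  ext1 v
  simp only [pairK_apply, LinearMap.add_apply, ← add_dotProduct, ← star_add]
  congr 2; funext i; simp

lemma pairK_smul (B : Matrix ι n Kk) (c : k) (l : ι → Rk) :
    pairK B (c • l) = star c • pairK B l := by
  ext1 v
  simp only [pairK_apply, LinearMap.smul_apply, polyvec_smul, ← smul_dotProduct]
  congr 1
  funext i
  simp [star_smul_Kk]

set_option maxHeartbeats 1000000 in
theorem CP_surj (hk : Aniso k) [DecidableEq ι] [DecidableEq n] (B : Matrix ι n Kk) (p : Rk) (hp : p ≠ 0)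
    (Q : Matrix ι n Rk) (hB : ∀ i j, ιk p * B i j = ιk (Q i j))
    (hinte : ∀ v v', IsP (star (Bl B v) ⬝ᵥ Bl B v')) (l : ι → Rk) :
    ∃ v : n → Rk, ∀ w, IsP (pairK B (l - fun i => pp (Bl B v i)) w) := by
  classical
  let T : (n → Rk) →ₗ[k] (ι → Rk) := (pp.compLeft ι) ∘ₗ Bl B
  have hT : ∀ v, T v = fun i => pp (Bl B v i) := fun v => rfl
  let V0 : Submodule k (n → Rk) :=
    { carrier := {v | ∀ i, IsP (Bl B v i)}
      zero_mem' := fun i => ⟨0, by simp⟩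
      add_mem' := fun {a b} ha hb i => by
        rw [map_add]; exact (ha i).add (hb i)
      smul_mem' := fun c v hv i => by
        rw [map_smul]; exact (hv i).smul c }
  let C : Submodule k (ι → Rk) :=
    { carrier := {l | ∀ v, IsP (pairK B l v)}
      zero_mem' := fun i => ⟨0, by
        have := LinearMap.congr_fun (pairK_smul B 0 (0 : ι → Rk)) i
        rw [smul_zero, star_zero, zero_smul] at this
        rw [this, map_zero]; rfl⟩
      add_mem' := fun {a b} ha hb i => by
        rw [pairK_add]; exact (ha i).add (hb i)
      smul_mem' := fun c v hv i => by
        rw [pairK_smul]; exact (hv i).smul _ }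
  have memV0 : ∀ v, v ∈ V0 ↔ ∀ i, IsP (Bl B v i) := fun _ => Iff.rfl
  have memC : ∀ l, l ∈ C ↔ ∀ v, IsP (pairK B l v) := fun _ => Iff.rfl
  have hTV0 : ∀ v, v ∈ V0 → (fun i => ιk (T v i)) = Bl B v := by
    intro v hv
    funext i
    obtain ⟨u, hu⟩ := hv i
    change ιk (pp (Bl B v i)) = _
    rw [← hu, pp_poly]
  -- kernel of T mod C
  have hker : ∀ v, T v ∈ C ↔ v ∈ V0 := by
    intro v
    constructor
    · intro h
      have hsp : ∀ i, Bl B v i - ιk (T v i) ∈ SP k := fun i => pp_spec _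
      set x : ι → Kk := fun i => Bl B v i - ιk (T v i) with hx
      have hxx : star x ⬝ᵥ x = 0 := by
        apply IsP.eq_zero
        · have e1 : star x ⬝ᵥ x = star (Bl B v) ⬝ᵥ Bl B v + (-1) * (pairK B (T v) v)
              + (-1) * star (pairK B (T v) v) +
               star (fun i => ιk (T v i)) ⬝ᵥ (fun i => ιk (T v i)) := by
            have e2 : x = Bl B v - fun i => ιk (T v i) := rfl
            rw [e2, pairK_apply, star_sub, sub_dotProduct, dotProduct_sub, dotProduct_sub]
            have e3 : star (Bl B v) ⬝ᵥ (fun i => ιk (T v i)) =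
              star (star (fun i => ιk (T v i)) ⬝ᵥ Bl B v) := by
              simp only [dotProduct, star_sum, star_mul, Pi.star_apply, star_star]
            rw [e3]; ring
          rw [e1]
          refine (((hinte v v).add (IsP.mul ⟨-1, by simp⟩ (h v))).add
            (IsP.mul ⟨-1, by simp⟩ (h v).star)).add ?_
          exact IsP.sum fun i _ => ((isP_poly _).star.mul (isP_poly _))
        · exact (SP k).sum_mem fun i _ => SP_mul (SP_star (hsp i)) (hsp i)
      have hx0 : x = 0 := (hk.poly.frac) ι x hxx
      intro i
      have := congrFun hx0 i
      simp only [hx, Pi.zero_apply, sub_eq_zero] at this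
      exact ⟨_, this.symm⟩
    · intro hv w
      rw [pairK_apply, hTV0 v hv]
      exact hinte v w
  -- finiteness
  have hfin : Module.Finite k ((n → Rk) ⧸ V0) := by
    have hpV : ∀ v : n → Rk, (fun j => p * v j) ∈ V0 := by
      intro v i
      rw [Bl_apply]
      refine IsP.sum fun j _ => ?_
      refine ⟨Q i j * v j, ?_⟩
      change _ = B i j * ιk (p * v j)
      rw [map_mul, map_mul, ← hB]; ring
    have : Module.Finite k (Polynomial.degreeLT k p.natDegree) :=
      Module.Finite.equiv (Polynomial.degreeLTEquiv k p.natDegree).symm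
    let S : (n → Polynomial.degreeLT k p.natDegree) →ₗ[k] (n → Rk) ⧸ V0 :=
      V0.mkQ ∘ₗ ((Polynomial.degreeLT k p.natDegree).subtype.compLeft n)
    apply Module.Finite.of_surjective S
    intro x
    obtain ⟨v, rfl⟩ := V0.mkQ_surjective x
    refine ⟨fun j => ⟨v j % p, ?_⟩, ?_⟩
    · rw [Polynomial.mem_degreeLT, ← Polynomial.degree_eq_natDegree hp]
      exact EuclideanDomain.mod_lt _ hp
    · symm
      change Submodule.Quotient.mk v = Submodule.Quotient.mk (fun j => v j % p)
      rw [Submodule.Quotient.eq]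
      have e : v - (fun j => v j % p) = fun j => p * (v j / p) := by
        funext j
        have := EuclideanDomain.div_add_mod (v j) p
        change v j - v j % p = p * (v j / p)
        linear_combination -this
      rw [e]
      exact hpV (fun j => v j / p)
  let T2 : ((n → Rk) ⧸ V0) →ₗ[k] ((ι → Rk) ⧸ C) := V0.liftQ (C.mkQ ∘ₗ T) (by
    intro v hv
    rw [LinearMap.mem_ker, LinearMap.comp_apply, Submodule.mkQ_apply, Submodule.Quotient.mk_eq_zero]
    exact (hker v).2 hv)
  have hT2 : Function.Injective T2 := by
    rw [← LinearMap.ker_eq_bot]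
    apply Submodule.ker_liftQ_eq_bot
    intro v hv
    rw [LinearMap.mem_ker, LinearMap.comp_apply, Submodule.mkQ_apply, Submodule.Quotient.mk_eq_zero] at hv
    exact (hker v).1 hv
  let f : (ι → Rk) →ₛₗ[starRingEnd k] (((n → Rk) ⧸ V0) →ₗ[k] k) :=
    { toFun := fun l => V0.liftQ (resK ∘ₗ pairK B l) (by
        intro v hv
        rw [LinearMap.mem_ker, LinearMap.comp_apply]
        have : IsP (pairK B l v) := by
          rw [pairK_apply]
          exact IsP.sum fun i _ => (isP_poly _).star.mul (hv i)
        obtain ⟨u, hu⟩ := this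
        rw [← hu, resK_poly])
      map_add' := by
        intro l l'
        refine Submodule.linearMap_qext _ (LinearMap.ext fun v => ?_)
        change resK (pairK B (l + l') v) = resK (pairK B l v) + resK (pairK B l' v)
        rw [pairK_add, LinearMap.add_apply, map_add]
      map_smul' := by
        intro c l
        refine Submodule.linearMap_qext _ (LinearMap.ext fun v => ?_)
        change resK (pairK B (c • l) v) = star c • resK (pairK B l v)
        rw [pairK_smul, LinearMap.smul_apply, map_smul] }
  have hf : ∀ l, f l = 0 ↔ l ∈ C := by
    intro l
    constructor
    · intro h v
      apply resK_nondeg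
      intro j
      have h1 : ιk (Polynomial.X ^ j) * pairK B l v = pairK B l (fun i => Polynomial.X ^ j * v i) := by
        rw [pairK_apply, pairK_apply, ← smul_eq_mul, ← dotProduct_smul, Bl_apply, Bl_apply, ← mulVec_smul]
        congr 2
        funext i
        simp
      rw [h1]
      have := LinearMap.congr_fun h (Submodule.Quotient.mk (fun i => Polynomial.X ^ j * v i))
      exact this
    · intro h
      refine Submodule.linearMap_qext _ (LinearMap.ext fun v => ?_)
      obtain ⟨u, hu⟩ := h v
      change resK (pairK B l v) = 0
      rw [← hu, resK_poly]
  let j : ((ι → Rk) ⧸ C) →ₛₗ[starRingEnd k] (((n → Rk) ⧸ V0) →ₗ[k] k) := C.liftQ f (fun l hl => (hf l).2 hl)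
  have hj : Function.Injective j := by
    rw [← LinearMap.ker_eq_bot]
    exact Submodule.ker_liftQ_eq_bot _ _ _ (fun l hl => (hf l).1 hl)
  have hrank : Module.rank k ((ι → Rk) ⧸ C) ≤ Module.rank k (((n → Rk) ⧸ V0) →ₗ[k] k) := by
    refine rank_le_of_injective_injective (starRingEnd k) j.toAddMonoidHom (by simp) hj ?_
    intro r m
    change j _ = r • j m
    rw [map_smulₛₗ]; simp
  have hfin2 : Module.Finite k ((ι → Rk) ⧸ C) :=
    Module.rank_lt_aleph0_iff.1 (hrank.trans_lt (Module.rank_lt_aleph0 k _))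
  have hfr : Module.finrank k ((ι → Rk) ⧸ C) ≤ Module.finrank k ((n → Rk) ⧸ V0) := by
    have h1 := Module.finrank_le_finrank_of_rank_le_rank (Cardinal.lift_le.2 hrank)
      (Module.rank_lt_aleph0 k _)
    rwa [Subspace.dual_finrank_eq] at h1
  have hfr2 := LinearMap.finrank_le_finrank_of_injective hT2
  have hsurj : Function.Surjective T2 :=
    (LinearMap.injective_iff_surjective_of_finrank_eq_finrank (le_antisymm hfr2 hfr)).1 hT2
  obtain ⟨x, hx⟩ := hsurj (C.mkQ l)
  obtain ⟨v, rfl⟩ := V0.mkQ_surjective x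
  refine ⟨v, ?_⟩
  have h3 : C.mkQ l = C.mkQ (T v) := hx.symm
  rw [Submodule.mkQ_apply, Submodule.mkQ_apply, Submodule.Quotient.eq] at h3
  exact h3

set_option maxHeartbeats 1000000 in
theorem CP (hk : Aniso k) [DecidableEq ι] [DecidableEq n] (Q : Matrix ι n Rk) (p : Rk) (hp : p ≠ 0)
    (F : Matrix n n Rk) (h : Qᴴ * Q = (star p * p) • F) :
    ∃ Q' : Matrix ι n Rk, Q'ᴴ * Q' = F := by
  classical
  have hp' : ιk p ≠ 0 := by simpa using hp
  have hps : star (ιk p) ≠ 0 := by simpa using hp'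
  obtain ⟨B, hBdef⟩ : ∃ B : Matrix ι n Kk, ∀ i j, B i j = ιk (Q i j) / ιk p := ⟨Matrix.of fun i j => _, fun _ _ => rfl⟩
  have hB : ∀ i j, ιk p * B i j = ιk (Q i j) := fun i j => by
    simp only [hBdef]; field_simp
  have hBB : Bᴴ * B = F.map ιk := by
    ext a b
    have h1 := congrFun (congrFun h a) b
    have h2 := congrArg ιk h1
    simp only [mul_apply, conjTranspose_apply, map_sum, map_mul, Matrix.smul_apply, smul_eq_mul,
      ← star_frac_algebraMap] at h2
    simp only [mul_apply, conjTranspose_apply, map_apply, hBdef, star_div₀]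
    rw [← mul_right_inj' (mul_ne_zero hps hp'), ← h2, Finset.mul_sum]
    refine Finset.sum_congr rfl fun i _ => ?_
    field_simp
  have hinte : ∀ v v', IsP (star (Bl B v) ⬝ᵥ Bl B v') := by
    intro v v'
    have : star (Bl B v) ⬝ᵥ Bl B v' = star (fun j => ιk (v j)) ⬝ᵥ ((F.map ιk) *ᵥ (fun j => ιk (v' j))) := by
      rw [Bl_apply, Bl_apply, star_mulVec, ← hBB, ← mulVec_mulVec, dotProduct_mulVec, dotProduct_mulVec]
      rw [dotProduct_mulVec]
    rw [this]
    exact IsP.sum fun i _ => (isP_poly _).star.mul (IsP.sum fun j _ => (isP_poly _).mul (isP_poly _))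
  choose v hv using fun i : ι => CP_surj hk B p hp Q hB hinte (Pi.single i 1)
  set c : ι → ι → Rk := fun i => Pi.single i 1 - fun j => pp (Bl B (v i) j) with hc
  obtain ⟨m, hm⟩ : ∃ m : Matrix ι ι Kk, ∀ j i, m j i = ιk (c i j) + Bl B (v i) j := ⟨Matrix.of fun j i => _, fun _ _ => rfl⟩
  have hms : ∀ j i, m j i - (1 : Matrix ι ι Kk) j i ∈ SP k := by
    intro j i
    have : m j i - (1 : Matrix ι ι Kk) j i = Bl B (v i) j - ιk (pp (Bl B (v i) j)) := by
      simp only [hm, hc, Pi.sub_apply, map_sub, one_apply, Pi.single_apply]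
      split_ifs <;> simp <;> ring
    rw [this]; exact pp_spec _
  have hmB : ∀ w i, IsP (star (fun j => m j i) ⬝ᵥ Bl B w) := by
    intro w i
    have : star (fun j => m j i) ⬝ᵥ Bl B w = pairK B (c i) w + star (Bl B (v i)) ⬝ᵥ Bl B w := by
      rw [pairK_apply, ← add_dotProduct, ← star_add]; congr 2; funext j; exact hm j i
    rw [this]
    exact (hv i w).add (hinte _ _)
  have hmm : mᴴ * m = 1 := by
    ext a b
    rw [← sub_eq_zero]
    apply IsP.eq_zero
    · have : (mᴴ * m) a b = star (fun j => m j a) ⬝ᵥ Bl B (v b) + star (star (fun j => ιk (c b j)) ⬝ᵥ Bl B (v a))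
          + star (fun j => ιk (c a j)) ⬝ᵥ (fun j => ιk (c b j)) := by
        simp only [mul_apply, conjTranspose_apply, dotProduct, star_sum, star_mul, Pi.star_apply, star_star,
          ← Finset.sum_add_distrib]
        refine Finset.sum_congr rfl fun j _ => ?_
        simp only [hm, star_add]; ring
      rw [this, sub_eq_add_neg]
      refine IsP.add (((hmB _ _).add ?_).add (IsP.sum fun i _ => ((isP_poly _).star.mul (isP_poly _)))) ?_
      · rw [← pairK_apply]; exact (hv b _).star
      · rw [one_apply]; split_ifs
        · exact ⟨-1, by simp⟩
        · exact ⟨0, by simp⟩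
    · have : (mᴴ * m) a b - (1 : Matrix ι ι Kk) a b = ((m - 1)ᴴ * (m - 1) : Matrix ι ι Kk) a b + (m - 1 : Matrix ι ι Kk) a b + star ((m - 1 : Matrix ι ι Kk) b a) := by
        have : mᴴ * m = (m - 1)ᴴ * (m - 1) + (m - 1) + (m - 1)ᴴ + 1 := by
          rw [conjTranspose_sub, conjTranspose_one]; noncomm_ring
        rw [this]
        simp only [Matrix.add_apply, conjTranspose_apply]; ring
      rw [this]
      refine (SP k).add_mem ((SP k).add_mem ?_ (hms _ _)) (SP_star (hms _ _))
      exact (SP k).sum_mem fun i _ => SP_mul (SP_star (hms _ _)) (hms _ _)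
  have hmm' : m * mᴴ = 1 := mul_eq_one_comm.1 hmm
  have hIP : ∀ i j, IsP ((mᴴ * B) i j) := by
    intro i j
    have := hmB (Pi.single j 1) i
    convert this using 1
    simp only [mul_apply, dotProduct, conjTranspose_apply, Pi.star_apply, Bl_apply]
    refine Finset.sum_congr rfl fun l _ => ?_
    congr 1
    simp [mulVec, dotProduct, Pi.single_apply]
  choose Q'' hQ'' using hIP
  obtain ⟨Q', hQ'⟩ : ∃ Q' : Matrix ι n Rk, ∀ i j, ιk (Q' i j) = (mᴴ * B) i j := ⟨Matrix.of Q'', hQ''⟩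
  refine ⟨Q', ?_⟩
  have hQm : Matrix.map (Q' : Matrix ι n Rk) ιk = mᴴ * B := by ext i j; exact hQ' i j
  have : (Matrix.map ((Q' : Matrix ι n Rk)ᴴ * Q') ιk) = F.map ιk := by
    rw [← hBB, Matrix.map_mul, conjTranspose_map (f := ιk), hQm]
    · rw [conjTranspose_mul, conjTranspose_conjTranspose, Matrix.mul_assoc, ← Matrix.mul_assoc m, hmm',
        Matrix.one_mul]
    · intro x; exact (star_frac_algebraMap x).symm
  exact Matrix.map_injective (IsFractionRing.injective Rk Kk) this

end CP

namespace Polynomial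
open Polynomial IntermediateField

/-- every element of `R(I)` is a square -/
lemma rcf_sq {R E : Type} [Field R] [CharZero R] [Field E] [Algebra R E]
    (hsr : ¬ IsSumSq (-1 : R)) (hsq : ∀ a : R, IsSquare a ∨ IsSquare (-a)) (I : E) (hI : I ^ 2 = -1)
    (a b : R) : ∃ u v : R, (algebraMap R E u + algebraMap R E v * I) ^ 2 = algebraMap R E a + algebraMap R E b * I := by
  suffices h : ∃ u v : R, u ^ 2 - v ^ 2 = a ∧ 2 * u * v = b by
    obtain ⟨u, v, rfl, rfl⟩ := h
    refine ⟨u, v, ?_⟩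
    simp only [map_sub, map_mul, map_pow, map_ofNat]
    linear_combination (algebraMap R E v) ^ 2 * hI
  by_cases hb : b = 0
  · rcases hsq a with ⟨u, hu⟩ | ⟨u, hu⟩
    · exact ⟨u, 0, by rw [hu]; ring, by rw [hb]; ring⟩
    · exact ⟨0, u, by linear_combination hu, by rw [hb]; ring⟩
  obtain ⟨c, hc⟩ : IsSquare (a ^ 2 + b ^ 2) := by
    rcases hsq (a ^ 2 + b ^ 2) with h | ⟨c, hc⟩
    · exact h
    · exfalso
      apply hsr
      have : (-1 : R) = (a / b) * (a / b) + (c / b) * (c / b) := by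
        field_simp; linear_combination hc
      rw [this]
      exact (IsSumSq.mul_self _).add (IsSumSq.mul_self _)
  rcases hsq ((c + a) / 2) with ⟨u, hu⟩ | ⟨s, hs⟩
  · have hu0 : u ≠ 0 := by
      rintro rfl
      have : c = -a := by linear_combination 2 * hu
      apply hb
      have : b ^ 2 = 0 := by rw [this] at hc; linear_combination hc
      simpa using this
    refine ⟨u, b / (2 * u), ?_, by field_simp⟩
    have h1 : c = 2 * u ^ 2 - a := by linear_combination 2 * hu
    rw [h1] at hc
    field_simp
    linear_combination -hc
  · have hu0 : s ≠ 0 := by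
      rintro rfl
      have : c = -a := by linear_combination -2 * hs
      apply hb
      have : b ^ 2 = 0 := by rw [this] at hc; linear_combination hc
      simpa using this
    refine ⟨b / (2 * s), s, ?_, by field_simp⟩
    have h1 : c = - 2 * s ^ 2 - a := by linear_combination -2 * hs
    rw [h1] at hc
    field_simp
    linear_combination hc

/-- fundamental theorem of algebra for real closed fields -/
theorem rcf_fta {R : Type} [Field R] [CharZero R]
    (hsr : ¬ IsSumSq (-1 : R)) (hsq : ∀ a : R, IsSquare a ∨ IsSquare (-a))
    (hodd : ∀ p : R[X], Odd p.natDegree → ∃ r, p.IsRoot r) (p : R[X]) (hp : Irreducible p) :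
    p.natDegree ≤ 2 := by
  classical
  set q : R[X] := p * (X ^ 2 + 1) with hq
  have hX1 : (X ^ 2 + 1 : R[X]) ≠ 0 := by
    have : (X ^ 2 + 1 : R[X]).Monic := by monicity!
    exact this.ne_zero
  have hq0 : q ≠ 0 := mul_ne_zero hp.ne_zero hX1
  let E := q.SplittingField
  have hsplit : (q.map (algebraMap R E)).Splits := Polynomial.SplittingField.splits q
  haveI : IsSplittingField R E q := inferInstance
  haveI : FiniteDimensional R E := inferInstance
  haveI : CharZero E := charZero_of_injective_algebraMap (algebraMap R E).injective
  haveI : IsGalois R E := by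
    have : Normal R E := Normal.of_isSplittingField q
    exact { }
  -- roots
  have hroot : ∀ f : R[X], f.natDegree ≠ 0 → f ∣ q → ∃ x : E, aeval x f = 0 := by
    intro f hf hfq
    have hs : (f.map (algebraMap R E)).Splits :=
      hsplit.of_dvd (Polynomial.map_ne_zero hq0) (Polynomial.map_dvd _ hfq)
    obtain ⟨x, hx⟩ := hs.exists_eval_eq_zero (by
      rw [Polynomial.degree_map]
      exact fun h => hf (natDegree_eq_zero_iff_degree_le_zero.2 h.le))
    exact ⟨x, by rwa [eval_map_algebraMap] at hx⟩
  obtain ⟨x, hx⟩ := hroot p hp.natDegree_pos.ne' (dvd_mul_right _ _)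
  obtain ⟨I, hI⟩ := hroot (X ^ 2 + 1) (by
    have : (X ^ 2 + 1 : R[X]).natDegree = 2 := by compute_degree!
    omega) (dvd_mul_left _ _)
  have hI2 : I ^ 2 = -1 := by
    simp only [map_add, map_pow, aeval_X, map_one] at hI
    linear_combination hI
  -- odd degree subextensions trivial
  have hoddext : ∀ L : IntermediateField R E, Odd (Module.finrank R L) → Module.finrank R L = 1 := by
    intro L hL
    obtain ⟨α, hα⟩ := Field.exists_primitive_element R L
    have h1 : (minpoly R α).natDegree = Module.finrank R L := by
      rw [← IntermediateField.adjoin.finrank (Algebra.IsIntegral.isIntegral α), hα,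
        IntermediateField.finrank_top']
    obtain ⟨r, hr⟩ := hodd (minpoly R α) (h1 ▸ hL)
    have h2 := Polynomial.degree_eq_one_of_irreducible_of_root
      (minpoly.irreducible (Algebra.IsIntegral.isIntegral α)) hr
    rw [← h1]
    exact natDegree_eq_of_degree_eq_some h2
  haveI : Fact (Nat.Prime 2) := ⟨Nat.prime_two⟩
  let S : Sylow 2 (E ≃ₐ[R] E) := default
  have hSi : ¬ 2 ∣ (S : Subgroup (E ≃ₐ[R] E)).index := S.not_dvd_index
  have hfix : Module.finrank R (IntermediateField.fixedField (S : Subgroup (E ≃ₐ[R] E))) =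
      (S : Subgroup (E ≃ₐ[R] E)).index := by
    have h1 := Module.finrank_mul_finrank R (IntermediateField.fixedField (S : Subgroup (E ≃ₐ[R] E))) E
    have h2 := IntermediateField.finrank_fixedField_eq_card (S : Subgroup (E ≃ₐ[R] E))
    have h3 := (S : Subgroup (E ≃ₐ[R] E)).card_mul_index
    have h4 := IsGalois.card_aut_eq_finrank R E
    have h5 : 0 < Nat.card (S : Subgroup (E ≃ₐ[R] E)) := Nat.card_pos
    rw [h2] at h1
    rw [← h4, ← h3] at h1
    exact Nat.eq_of_mul_eq_mul_left h5 (by rw [mul_comm]; exact h1)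
  have hS1 : (S : Subgroup (E ≃ₐ[R] E)).index = 1 := by
    rw [← hfix]
    apply hoddext
    rw [hfix, ← Nat.not_even_iff_odd, even_iff_two_dvd]
    exact hSi
  obtain ⟨n, hn⟩ := S.isPGroup'.exists_card_eq
  have hcard : Nat.card (E ≃ₐ[R] E) = 2 ^ n := by
    rw [← (S : Subgroup (E ≃ₐ[R] E)).card_mul_index, hS1, mul_one]; exact hn
  have hE : Module.finrank R E = 2 ^ n := by rw [← IsGalois.card_aut_eq_finrank R E, hcard]
  suffices hn1 : n ≤ 1 by
    have h1 : (minpoly R x).natDegree ≤ Module.finrank R E := minpoly.natDegree_le x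
    have h2 : p.natDegree ≤ (minpoly R x).natDegree := by
      rw [← minpoly.eq_of_irreducible hp hx]
      exact natDegree_le_of_dvd (dvd_mul_right _ _) (mul_ne_zero hp.ne_zero (by simpa using hp.ne_zero))
    have h3 : 2 ^ n ≤ 2 ^ 1 := Nat.pow_le_pow_right (by norm_num) hn1
    omega
  by_contra hn2
  push Not at hn2
  -- the field M = R(I)
  have hIR : ∀ r : R, algebraMap R E r ≠ I := by
    intro r hr
    apply hsr
    have : algebraMap R E (r * r) = algebraMap R E (-1) := by
      rw [map_mul, hr, map_neg, map_one, ← hI2, sq]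
    rw [← (algebraMap R E).injective this]
    exact IsSumSq.mul_self _
  have hMel : ∀ z : R⟮I⟯, ∃ a b : R, (z : E) = algebraMap R E a + algebraMap R E b * I := by
    intro z
    have hz : (z : E) ∈ (R⟮I⟯).toSubalgebra := z.2
    rw [IntermediateField.adjoin_simple_toSubalgebra_of_isAlgebraic (Algebra.IsAlgebraic.isAlgebraic I),
      Algebra.adjoin_singleton_eq_range_aeval] at hz
    obtain ⟨f, hf⟩ := hz
    have hf : aeval I f = (z : E) := hf
    have hm : (X ^ 2 + 1 : R[X]).Monic := by monicity!
    have h1 := Polynomial.modByMonic_add_div f (X ^ 2 + 1 : R[X])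
    have hlt : (f %ₘ (X ^ 2 + 1 : R[X])).degree < 2 := by
      have := degree_modByMonic_lt f hm
      have h2 : (X ^ 2 + 1 : R[X]).degree = 2 := by compute_degree!
      rwa [h2] at this
    refine ⟨(f %ₘ (X ^ 2 + 1 : R[X])).coeff 0, (f %ₘ (X ^ 2 + 1 : R[X])).coeff 1, ?_⟩
    rw [← hf]
    conv_lhs => rw [← h1]
    rw [map_add, map_mul, hI, zero_mul, add_zero]
    have h3 : (f %ₘ (X ^ 2 + 1 : R[X])).degree ≤ 1 := Order.le_of_lt_succ hlt
    conv_lhs => rw [eq_X_add_C_of_degree_le_one h3]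
    simp; ring
  have hMsq : ∀ z : R⟮I⟯, ∃ w : R⟮I⟯, w ^ 2 = z := by
    intro z
    obtain ⟨a, b, hab⟩ := hMel z
    obtain ⟨u, v, huv⟩ := rcf_sq (E := E) hsr hsq I hI2 a b
    refine ⟨⟨algebraMap R E u + algebraMap R E v * I, ?_⟩, ?_⟩
    · exact add_mem ((R⟮I⟯).algebraMap_mem _) (mul_mem ((R⟮I⟯).algebraMap_mem _)
        (IntermediateField.mem_adjoin_simple_self R I))
    · apply Subtype.ext
      rw [hab, ← huv]; rfl
  have hMrank : Module.finrank R R⟮I⟯ = 2 := by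
    rw [IntermediateField.adjoin.finrank (Algebra.IsIntegral.isIntegral I)]
    have hm : (X ^ 2 + 1 : R[X]).Monic := by monicity!
    have h2 : (X ^ 2 + 1 : R[X]).natDegree = 2 := by compute_degree!
    have h3 : Irreducible (X ^ 2 + 1 : R[X]) := by
      refine Polynomial.irreducible_of_degree_le_three_of_not_isRoot (by rw [h2]; decide) ?_
      intro r hr
      apply hsr
      have : (-1 : R) = r * r := by
        simp only [IsRoot, eval_add, eval_pow, eval_X, eval_one] at hr
        linear_combination -hr
      rw [this]; exact IsSumSq.mul_self _
    rw [← minpoly.eq_of_irreducible_of_monic h3 hI hm, h2]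
  let H : Subgroup (E ≃ₐ[R] E) := (R⟮I⟯).fixingSubgroup
  have hH : Nat.card H = 2 ^ (n - 1) := by
    have h1 : Nat.card H = Module.finrank R⟮I⟯ E := IsGalois.card_fixingSubgroup_eq_finrank _
    have h2 := Module.finrank_mul_finrank R R⟮I⟯ E
    rw [hMrank, hE] at h2
    rw [h1]
    obtain ⟨j, rfl⟩ := Nat.exists_eq_add_of_le' hn2.le
    rw [pow_succ] at h2
    simp only [Nat.add_sub_cancel]
    omega
  obtain ⟨H', hH'⟩ := Sylow.exists_subgroup_card_pow_prime (G := H) 2 (n := n - 2) (by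
    rw [hH]; exact pow_dvd_pow _ (by omega))
  let H2 : Subgroup (E ≃ₐ[R] E) := H'.map H.subtype
  have hH2 : Nat.card H2 = 2 ^ (n - 2) := by
    rw [← hH']
    exact Nat.card_congr (H'.equivMapOfInjective H.subtype H.subtype_injective).toEquiv.symm
  have hle : H2 ≤ H := Subgroup.map_subtype_le _
  have hlt : ∃ β ∈ IntermediateField.fixedField H2, β ∉ R⟮I⟯ := by
    by_contra hcon
    push Not at hcon
    have h1 : IntermediateField.fixedField H2 ≤ R⟮I⟯ := hcon
    have h2 : Module.finrank (IntermediateField.fixedField H2) E = 2 ^ (n - 2) := by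
      rw [IntermediateField.finrank_fixedField_eq_card, hH2]
    have h3 := IsGalois.card_fixingSubgroup_eq_finrank (R⟮I⟯)
    have h5 : H ≤ H2 := by
      have := IntermediateField.fixingSubgroup_antitone h1
      rwa [IntermediateField.fixingSubgroup_fixedField] at this
    have h6 : H = H2 := le_antisymm h5 hle
    rw [← h6, hH] at hH2
    have := Nat.pow_right_injective (le_refl 2) hH2
    omega
  obtain ⟨β, hβ, hβM⟩ := hlt
  -- minimal polynomial of β over M has degree ≤ 2
  have hdeg : (minpoly R⟮I⟯ β).natDegree ≤ 2 := by
    have hM' : R⟮I⟯ ≤ IntermediateField.fixedField H2 := by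
      rw [IntermediateField.le_iff_le]; exact hle
    let M' := IntermediateField.extendScalars hM'
    have h1 : Module.finrank R⟮I⟯ M' = 2 := by
      have e1 := Module.finrank_mul_finrank R⟮I⟯ M' E
      have e2 : Module.finrank M' E = 2 ^ (n - 2) := by
        have : Module.finrank (IntermediateField.fixedField H2) E = 2 ^ (n - 2) := by
          rw [IntermediateField.finrank_fixedField_eq_card, hH2]
        exact this
      have e3 := IsGalois.card_fixingSubgroup_eq_finrank (R⟮I⟯)
      change Nat.card H = _ at e3
      rw [hH] at e3
      rw [e2, ← e3] at e1
      obtain ⟨j, rfl⟩ := Nat.exists_eq_add_of_le' hn2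
      have e4 : j + 2 - 2 = j := by omega
      have e5 : j + 2 - 1 = j + 1 := by omega
      change _ * 2 ^ (j + 2 - 2) = 2 ^ (j + 2 - 1) at e1
      rw [e4, e5, pow_succ, mul_comm (2 ^ j)] at e1
      exact Nat.eq_of_mul_eq_mul_right (by positivity) e1
    let β' : M' := ⟨β, hβ⟩
    haveI : FiniteDimensional R⟮I⟯ M' := Module.finite_of_finrank_pos (by omega)
    have h2 : minpoly R⟮I⟯ β' = minpoly R⟮I⟯ β :=
      (minpoly.algebraMap_eq (B := M') (B' := E) (algebraMap M' E).injective β').symm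
    rw [← h2, ← h1]
    exact minpoly.natDegree_le β'
  have hmon := minpoly.monic (Algebra.IsIntegral.isIntegral (R := R⟮I⟯) β)
  have hae := minpoly.aeval R⟮I⟯ β
  set f := minpoly R⟮I⟯ β with hf
  apply hβM
  have hpos : 0 < f.natDegree := minpoly.natDegree_pos (Algebra.IsIntegral.isIntegral β)
  have hcase : f.natDegree = 1 ∨ f.natDegree = 2 := by omega
  rcases hcase with h1 | h2
  · have := (minpoly.natDegree_eq_one_iff (A := R⟮I⟯) (x := β)).1 h1
    obtain ⟨y, hy⟩ := this
    rw [← hy]; exact y.2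
  · have e : f = C (f.coeff 0) + C (f.coeff 1) * X + X ^ 2 := by
      conv_lhs => rw [f.as_sum_range_C_mul_X_pow, h2]
      simp only [Finset.sum_range_succ, Finset.sum_range_zero]
      have : f.coeff 2 = 1 := by rw [← h2]; exact hmon
      rw [this]; simp
    obtain ⟨w, hw⟩ := hMsq (f.coeff 1 ^ 2 - 4 * f.coeff 0)
    rw [e] at hae
    simp only [map_add, map_mul, aeval_C, aeval_X, map_pow] at hae
    have hw' := congrArg (algebraMap R⟮I⟯ E) hw
    simp only [map_sub, map_mul, map_pow, map_ofNat] at hw'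
    have h3 : (2 * β + algebraMap R⟮I⟯ E (f.coeff 1) - algebraMap R⟮I⟯ E w) *
        (2 * β + algebraMap R⟮I⟯ E (f.coeff 1) + algebraMap R⟮I⟯ E w) = 0 := by
      linear_combination 4 * hae - hw'
    rcases mul_eq_zero.1 h3 with h4 | h4
    · have : β = algebraMap R⟮I⟯ E ((w - f.coeff 1) / 2) := by
        simp only [map_sub, map_div₀, map_ofNat]
        linear_combination (1/2) * h4
      rw [this]; exact ((w - f.coeff 1) / 2 : R⟮I⟯).2
    · have : β = algebraMap R⟮I⟯ E ((- w - f.coeff 1) / 2) := by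
        simp only [map_sub, map_neg, map_div₀, map_ofNat]
        linear_combination (1/2) * h4
      rw [this]; exact ((-w - f.coeff 1) / 2 : R⟮I⟯).2
end Polynomial

namespace Polynomial
open Polynomial IntermediateField

lemma _root_.IsSumSq.mapHom {A B F : Type} [Ring A] [Ring B] [FunLike F A B] [RingHomClass F A B]
    {x : A} (hx : IsSumSq x) (f : F) : IsSumSq (f x) := by
  induction hx with
  | zero => rw [map_zero]; exact IsSumSq.zero
  | sq_add a hs ih => rw [map_add, map_mul]; exact IsSumSq.sq_add _ ih

lemma sumsq_iSup {K Ω : Type} [Field K] [Field Ω] [Algebra K Ω] (c : Set (IntermediateField K Ω))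
    (hc : IsChain (· ≤ ·) c) (hne : c.Nonempty) (x : ↥(sSup c)) (hx : IsSumSq x) :
    ∃ L ∈ c, ∃ y : L, (y : Ω) = x ∧ IsSumSq y := by
  have hmem : ∀ a : Ω, a ∈ sSup c → ∃ L ∈ c, a ∈ L := by
    intro a ha
    haveI : Nonempty c := hne.to_subtype
    have hd : Directed (· ≤ ·) (fun L : c => (L : IntermediateField K Ω)) := by
      intro a b
      rcases hc.total a.2 b.2 with h | h
      · exact ⟨b, h, le_rfl⟩
      · exact ⟨a, le_rfl, h⟩
    rw [sSup_eq_iSup'] at ha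
    have := IntermediateField.coe_iSup_of_directed hd
    have h2 : a ∈ ((⨆ L : c, (L : IntermediateField K Ω) : IntermediateField K Ω) : Set Ω) := ha
    rw [this] at h2
    obtain ⟨L, hL⟩ := Set.mem_iUnion.1 h2
    exact ⟨L, L.2, hL⟩
  induction hx with
  | zero => 
    obtain ⟨L, hL⟩ := hne
    exact ⟨L, hL, 0, by simp, IsSumSq.zero⟩
  | sq_add a hs ih => 
    obtain ⟨L, hL, y, hy, hys⟩ := ih
    obtain ⟨L', hL', ha⟩ := hmem a a.2
    rcases hc.total hL hL' with h | h
    · refine ⟨L', hL', ⟨a, ha⟩ * ⟨a, ha⟩ + IntermediateField.inclusion h y, ?_, ?_⟩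
      · simp [← hy]
      · exact IsSumSq.sq_add _ (hys.mapHom (IntermediateField.inclusion h))
    · refine ⟨L, hL, ⟨a, h ha⟩ * ⟨a, h ha⟩ + y, ?_, ?_⟩
      · simp [← hy]
      · exact IsSumSq.sq_add _ hys

lemma sumsq_adjoinRoot {R : Type} [Field R] (g : R[X]) (hg : g.Monic) (hd : g.natDegree ≠ 0)
    (x : AdjoinRoot g) (hx : IsSumSq x) : ∃ (n : ℕ) (U : Fin n → R[X]),
      (∀ i, (U i).natDegree < g.natDegree) ∧ x = AdjoinRoot.mk g (∑ i, U i * U i) := by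
  induction hx with
  | zero => exact ⟨0, Fin.elim0, fun i => i.elim0, by simp⟩
  | sq_add a hs ih =>
    obtain ⟨n, U, hU, hx⟩ := ih
    obtain ⟨p, rfl⟩ := AdjoinRoot.mk_surjective a
    refine ⟨n + 1, Fin.cons (p %ₘ g) U, ?_, ?_⟩
    · intro i
      refine Fin.cases ?_ (fun j => ?_) i
      · simp only [Fin.cons_zero]
        exact natDegree_modByMonic_lt _ hg (fun h => hd (by simp [h]))
      · simpa using hU j
    · have : AdjoinRoot.mk g p = AdjoinRoot.mk g (p %ₘ g) := by
        rw [AdjoinRoot.mk_eq_mk]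
        exact ⟨p /ₘ g, by linear_combination - modByMonic_add_div p g⟩
      rw [Fin.sum_univ_succ, map_add, map_mul, hx, this]
      simp

/-- semireal fields without semireal proper simple extensions -/
def SRMax (R : Type) [Field R] : Prop :=
  ¬ IsSumSq (-1 : R) ∧ ∀ g : R[X], g.Monic → Irreducible g → 2 ≤ g.natDegree →
    ∃ (n : ℕ) (U : Fin n → R[X]), (∀ i, (U i).natDegree < g.natDegree) ∧ g ∣ 1 + ∑ i, U i * U i

theorem exists_SRMax {K : Type} [Field K] (h : ¬ IsSumSq (-1 : K)) :
    ∃ (R : Type) (_ : Field R) (_ : K →+* R), SRMax R := by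
  let Ω := AlgebraicClosure K
  have hbot : ¬ IsSumSq (-1 : (⊥ : IntermediateField K Ω)) := by
    intro hb
    apply h
    have := hb.mapHom (IntermediateField.botEquiv K Ω)
    simpa using this
  obtain ⟨R, -, hR⟩ := zorn_le_nonempty₀ {L : IntermediateField K Ω | ¬ IsSumSq (-1 : L)} (by
    intro c hcs hc L hL
    refine ⟨sSup c, ?_, fun z hz => le_sSup hz⟩
    intro hs
    obtain ⟨L', hL', y, hy, hys⟩ := sumsq_iSup c hc ⟨L, hL⟩ _ hs
    apply hcs hL'
    have : y = -1 := by
      apply Subtype.ext; rw [hy]; simp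
    rwa [this] at hys) ⊥ hbot
  refine ⟨R, inferInstance, algebraMap K R, hR.prop, ?_⟩
  intro g hgm hg hd
  obtain ⟨x, hx⟩ := IsAlgClosed.exists_aeval_eq_zero Ω g (by
    intro h0
    rw [degree_eq_natDegree hg.ne_zero] at h0
    have : g.natDegree = 0 := by exact_mod_cast h0
    omega)
  have hmin : g = minpoly R x := minpoly.eq_of_irreducible_of_monic hg hx hgm
  have hinte : IsIntegral R x := ⟨g, hgm, by rwa [aeval_def] at hx⟩
  have hbig : IsSumSq (-1 : R⟮x⟯) := by
    by_contra hcon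
    have h1 : R ≤ (R⟮x⟯).restrictScalars K := by
      intro z hz
      exact (R⟮x⟯).algebraMap_mem ⟨z, hz⟩
    have h2 := hR.le_of_ge (y := (R⟮x⟯).restrictScalars K) hcon h1
    have h3 : x ∈ R := h2 (IntermediateField.mem_adjoin_simple_self R x)
    have h4 : g.IsRoot ⟨x, h3⟩ := by
      rw [IsRoot.def]
      apply Subtype.ext
      have : ((g.eval ⟨x, h3⟩ : R) : Ω) = aeval x g := by
        have := aeval_algebraMap_apply Ω (⟨x, h3⟩ : R) g
        rw [coe_aeval_eq_eval] at this
        exact this.symm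
      rw [this, hx]; rfl
    have h5 := degree_eq_one_of_irreducible_of_root hg h4
    have h7 : g.natDegree = 1 := natDegree_eq_of_degree_eq_some h5
    omega
  have h6 := hbig.mapHom (IntermediateField.adjoinRootEquivAdjoin R hinte).symm
  rw [map_neg, map_one, ← hmin] at h6
  obtain ⟨n, U, hU, he⟩ := sumsq_adjoinRoot g hgm (by omega) _ h6
  refine ⟨n, U, hU, ?_⟩
  rw [← AdjoinRoot.mk_eq_zero, map_add, ← he]
  simp

lemma sq_key {R : Type} [Field R] (h : ¬ IsSumSq (-1 : R)) (a : R) (n : ℕ) (U : Fin n → R[X])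
    (hU : ∀ i, (U i).natDegree < (X ^ 2 - C a : R[X]).natDegree) (hdv : X ^ 2 - C a ∣ 1 + ∑ i, U i * U i) : IsSumSq (-a) := by
  have hm : (X ^ 2 - C a : R[X]).Monic := by monicity!
  have hd : (X ^ 2 - C a : R[X]).natDegree = 2 := by compute_degree!
  obtain ⟨w, hw⟩ := hdv
  rw [hd] at hU
  have hUf : ∀ i, U i = C ((U i).coeff 1) * X + C ((U i).coeff 0) := fun i =>
    eq_X_add_C_of_natDegree_le_one (by have := hU i; omega)
  have hwc : w.natDegree = 0 := by
    have h1 : (1 + ∑ i, U i * U i).natDegree ≤ 2 := by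
      refine (natDegree_add_le _ _).trans (max_le (by simp) ?_)
      refine natDegree_sum_le_of_forall_le _ _ fun i _ => ?_
      refine natDegree_mul_le.trans ?_
      have := hU i; omega
    by_cases hw0 : w = 0
    · simp [hw0]
    rw [hw, natDegree_mul hm.ne_zero hw0, hd] at h1
    omega
  rw [eq_C_of_natDegree_eq_zero hwc] at hw
  set e := w.coeff 0
  have h0 : 1 + ∑ i, (U i).coeff 0 * (U i).coeff 0 = - (a * e) := by
    have := congrArg (fun p => coeff p 0) hw
    simpa [mul_coeff_zero, finsetSum_coeff] using this
  have h2 : ∑ i, (U i).coeff 1 * (U i).coeff 1 = e := by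
    have := congrArg (fun p => coeff p 2) hw
    simp only [coeff_add, finsetSum_coeff, coeff_mul_C, coeff_sub, coeff_X_pow] at this
    rw [show (C a).coeff 2 = 0 by rw [coeff_C]; simp, show (1:R[X]).coeff 2 = 0 by rw [coeff_one]; simp] at this
    simp only [if_true, sub_zero, one_mul, zero_add] at this
    rw [← this]
    refine Finset.sum_congr rfl fun i _ => ?_
    conv_rhs => rw [hUf i]
    have : (C ((U i).coeff 1) * X + C ((U i).coeff 0)) * (C ((U i).coeff 1) * X + C ((U i).coeff 0))
      = C ((U i).coeff 1 * (U i).coeff 1) * X ^ 2 + C (2 * (U i).coeff 1 * (U i).coeff 0) * X ^ 1 + C ((U i).coeff 0 * (U i).coeff 0) := by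
      simp only [map_mul, map_ofNat]; ring
    rw [this]
    simp only [coeff_add, coeff_C_mul, coeff_X_pow, coeff_C]
    simp
  have hs0 : IsSumSq (1 + ∑ i, (U i).coeff 0 * (U i).coeff 0) := by
    refine IsSumSq.add (by simpa using IsSumSq.mul_self (1:R)) ?_
    exact IsSumSq.sum fun i _ => IsSumSq.mul_self _
  have hs2 : IsSumSq e := h2 ▸ IsSumSq.sum fun i _ => IsSumSq.mul_self _
  by_cases he : e = 0
  · exfalso
    apply h
    rw [he] at h0
    have : (-1 : R) = ∑ i, (U i).coeff 0 * (U i).coeff 0 := by linear_combination -h0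
    rw [this]
    exact IsSumSq.sum fun i _ => IsSumSq.mul_self _
  · have : -a = (-(a * e)) * (e * (e⁻¹ * e⁻¹)) := by field_simp
    rw [this, ← h0]
    exact hs0.mul (hs2.mul (IsSumSq.mul_self _))

lemma SRMax.sq {R : Type} [Field R] (h : SRMax R) (a : R) : IsSquare a ∨ IsSquare (-a) := by
  have key : ∀ a : R, ¬ IsSquare a → IsSumSq (-a) := by
    intro a ha
    have hm : (X ^ 2 - C a : R[X]).Monic := by monicity!
    have hd : (X ^ 2 - C a : R[X]).natDegree = 2 := by compute_degree!
    have hirr : Irreducible (X ^ 2 - C a : R[X]) := by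
      apply irreducible_of_degree_le_three_of_not_isRoot
      · rw [hd]; simp
      · intro x hx
        apply ha
        refine ⟨x, ?_⟩
        simp only [IsRoot.def, eval_sub, eval_pow, eval_X, eval_C] at hx
        linear_combination -hx
    obtain ⟨n, U, hU, hw⟩ := h.2 _ hm hirr (by omega)
    exact sq_key h.1 a n U hU hw
  by_contra hcon
  push Not at hcon
  have h1 := key a hcon.1
  have h2 := key (-a) hcon.2
  rw [neg_neg] at h2
  have ha : a ≠ 0 := by rintro rfl; exact hcon.1 ⟨0, by simp⟩
  apply h.1
  have : (-1 : R) = (-a) * a * (a⁻¹ * a⁻¹) := by field_simp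
  rw [this]
  exact (h1.mul h2).mul (IsSumSq.mul_self _)

lemma natDegree_sumsq {R : Type} [Field R] (h : ¬ IsSumSq (-1 : R)) {n : ℕ} (U : Fin n → R[X]) :
    Even (∑ i, U i * U i).natDegree := by
  classical
  by_cases hall : ∀ i, U i = 0
  · simp [hall]
  push Not at hall
  obtain ⟨i0, hi0⟩ := hall
  have hdom : ∀ {n : ℕ} (c : Fin n → R), ∑ i, c i * c i = 0 → ∀ i, c i = 0 := by
    intro n c hc i
    by_contra hi
    apply h
    have h1 : (-1 : R) = ∑ j ∈ Finset.univ.erase i, (c j / c i) * (c j / c i) := by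
      have := Finset.add_sum_erase Finset.univ (fun j => c j * c j) (Finset.mem_univ i)
      rw [hc] at this
      have h3 : ∑ j ∈ Finset.univ.erase i, (c j / c i) * (c j / c i) = (∑ j ∈ Finset.univ.erase i, c j * c j) * (c i * c i)⁻¹ := by
        rw [Finset.sum_mul]; refine Finset.sum_congr rfl fun j _ => by field_simp
      rw [h3, eq_comm, mul_inv_eq_iff_eq_mul₀ (mul_ne_zero hi hi)]
      linear_combination this
    rw [h1]
    exact IsSumSq.sum fun i _ => IsSumSq.mul_self _
  set D := Finset.univ.sup (fun i => (U i).natDegree)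
  have hD : ∀ i, (U i).natDegree ≤ D := fun i => Finset.le_sup (f := fun i => (U i).natDegree) (Finset.mem_univ i)
  have hcoef : (∑ i, U i * U i).coeff (D + D) = ∑ i, (U i).coeff D * (U i).coeff D := by
    rw [finsetSum_coeff]
    exact Finset.sum_congr rfl fun i _ => coeff_mul_add_eq_of_natDegree_le (hD i) (hD i)
  have hne : (∑ i, U i * U i).coeff (D + D) ≠ 0 := by
    rw [hcoef]
    intro h0
    have h1 := hdom _ h0
    obtain ⟨i, -, hi⟩ := Finset.exists_mem_eq_sup Finset.univ ⟨i0, Finset.mem_univ _⟩ (fun i => (U i).natDegree)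
    have h2 : (U i).leadingCoeff = 0 := by
      have := h1 i
      rwa [show D = (U i).natDegree from hi] at this
    rw [leadingCoeff_eq_zero] at h2
    have hD0 : D = 0 := by rw [show D = (U i).natDegree from hi, h2]; simp
    have h3 := h1 i0
    have h4 := hD i0
    rw [hD0] at h3 h4
    apply hi0
    rw [eq_C_of_natDegree_le_zero h4, h3, C_0]
  have : (∑ i, U i * U i).natDegree = D + D := by
    apply le_antisymm _ (le_natDegree_of_ne_zero hne)
    refine natDegree_sum_le_of_forall_le _ _ fun i _ => ?_
    refine natDegree_mul_le.trans ?_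
    have := hD i; omega
  exact ⟨D, this⟩

lemma SRMax.odd {R : Type} [Field R] (h : SRMax R) (p : R[X]) (hp : Odd p.natDegree) : ∃ r, p.IsRoot r := by
  induction hn : p.natDegree using Nat.strong_induction_on generalizing p with
  | _ n ih =>
  subst hn
  by_cases hirr : Irreducible p
  · by_cases h1 : p.natDegree = 1
    · have := Polynomial.exists_root_of_degree_eq_one (p := p) ((degree_eq_iff_natDegree_eq_of_pos (by norm_num)).2 h1)
      exact this
    obtain ⟨j, hj⟩ := hp
    have hlc : (C p.leadingCoeff⁻¹ : R[X]) ≠ 0 := by simpa using hirr.ne_zero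
    set g := p * C p.leadingCoeff⁻¹ with hg
    have hgm : g.Monic := monic_mul_leadingCoeff_inv hirr.ne_zero
    have hgd : g.natDegree = p.natDegree := by
      rw [hg, natDegree_mul hirr.ne_zero hlc]; simp
    have hgi : Irreducible g := by
      rw [hg, irreducible_mul_isUnit]
      · exact hirr
      · exact isUnit_C.2 (isUnit_iff_ne_zero.2 (by simpa using hlc))
    obtain ⟨n, U, hU, w, hw⟩ := h.2 g hgm hgi (by omega)
    have hs : 1 + ∑ i, U i * U i = ∑ i, (Fin.cons 1 U : Fin (n+1) → R[X]) i * (Fin.cons 1 U : Fin (n+1) → R[X]) i := by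
      rw [Fin.sum_univ_succ]; simp
    have hev := natDegree_sumsq h.1 (Fin.cons 1 U : Fin (n+1) → R[X])
    rw [← hs] at hev
    have hle : (1 + ∑ i, U i * U i).natDegree ≤ 2 * (p.natDegree - 1) := by
      refine (natDegree_add_le _ _).trans (max_le (by simp) ?_)
      refine natDegree_sum_le_of_forall_le _ _ fun i _ => ?_
      refine natDegree_mul_le.trans ?_
      have := hU i; omega
    have hcontra : ∀ r, w.IsRoot r → False := by
      intro r hr
      have h3 := congrArg (eval r) hw
      rw [eval_mul, hr, mul_zero, eval_add, eval_one, eval_finsetSum] at h3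
      simp only [eval_mul] at h3
      apply h.1
      have : (-1 : R) = ∑ i, (U i).eval r * (U i).eval r := by linear_combination -h3
      rw [this]
      exact IsSumSq.sum fun i _ => IsSumSq.mul_self _
    by_cases hw0 : w = 0
    · exact (hcontra 0 (by simp [hw0])).elim
    rw [hw, natDegree_mul hgm.ne_zero hw0, hgd] at hle hev
    obtain ⟨e, he⟩ := hev
    obtain ⟨r, hr⟩ := ih w.natDegree (by omega) w ⟨e - j - 1, by omega⟩ rfl
    exact (hcontra r hr).elim
  · have hp0 : p ≠ 0 := by rintro rfl; simp at hp
    have hnu : ¬ IsUnit p := by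
      intro hu
      rw [natDegree_eq_zero_of_isUnit hu] at hp; simp at hp
    rw [irreducible_iff] at hirr
    push Not at hirr
    obtain ⟨a, b, hab, hau, hbu⟩ := hirr hnu
    have ha0 : a ≠ 0 := by rintro rfl; simp at hab; exact hp0 hab
    have hb0 : b ≠ 0 := by rintro rfl; simp at hab; exact hp0 hab
    have hdeg : p.natDegree = a.natDegree + b.natDegree := by rw [hab, natDegree_mul ha0 hb0]
    have hap : 0 < a.natDegree := Nat.pos_of_ne_zero fun h0 => hau (by rw [eq_C_of_natDegree_eq_zero h0] at ha0 ⊢; exact isUnit_C.2 (isUnit_iff_ne_zero.2 (by simpa using ha0)))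
    have hbp : 0 < b.natDegree := Nat.pos_of_ne_zero fun h0 => hbu (by rw [eq_C_of_natDegree_eq_zero h0] at hb0 ⊢; exact isUnit_C.2 (isUnit_iff_ne_zero.2 (by simpa using hb0)))
    rw [hdeg, Nat.odd_add] at hp
    by_cases ho : Odd a.natDegree
    · obtain ⟨r, hr⟩ := ih _ (by omega) a ho rfl
      exact ⟨r, by rw [hab, IsRoot.def, eval_mul, hr, zero_mul]⟩
    · have : Odd b.natDegree := by
        by_contra hb
        rw [Nat.not_odd_iff_even] at hb
        exact ho (hp.2 hb)
      obtain ⟨r, hr⟩ := ih _ (by omega) b this rfl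
      exact ⟨r, by rw [hab, IsRoot.def, eval_mul, hr, mul_zero]⟩

theorem exists_rcf {K : Type} [Field K] (h : ¬ IsSumSq (-1 : K)) :
    ∃ (R : Type) (_ : Field R) (_ : LinearOrder R) (_ : IsStrictOrderedRing R) (_ : K →+* R),
      (∀ a : R, 0 ≤ a → IsSquare a) ∧ ∀ p : R[X], Irreducible p → p.natDegree ≤ 2 := by
  classical
  obtain ⟨R, iF, φ, hM⟩ := exists_SRMax h
  have hadd : ∀ a b : R, IsSquare a → IsSquare b → IsSquare (a + b) := by
    rintro _ _ ⟨a, rfl⟩ ⟨b, rfl⟩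
    rcases hM.sq (a * a + b * b) with h1 | ⟨c, hc⟩
    · exact h1
    by_cases hc0 : c = 0
    · rw [hc0] at hc
      exact ⟨0, by linear_combination -hc⟩
    · exfalso
      apply hM.1
      have : (-1 : R) = (a / c) * (a / c) + (b / c) * (b / c) := by
        field_simp; linear_combination hc
      rw [this]
      exact (IsSumSq.mul_self _).add (IsSumSq.mul_self _)
  have hanti : ∀ a : R, IsSquare a → IsSquare (-a) → a = 0 := by
    rintro _ ⟨a, rfl⟩ ⟨b, hb⟩
    by_contra h0
    apply hM.1
    have ha : a ≠ 0 := by rintro rfl; simp at h0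
    have : (-1 : R) = (b / a) * (b / a) := by field_simp; linear_combination hb
    rw [this]; exact IsSumSq.mul_self _
  let L : LinearOrder R :=
    { le := fun a b => IsSquare (b - a)
      le_refl := fun a => ⟨0, by simp⟩
      le_trans := fun a b c h1 h2 => by
        have := hadd _ _ h1 h2
        show IsSquare (c - a)
        convert this using 1; ring
      le_antisymm := fun a b h1 h2 => by
        have := hanti (b - a) h1 (by convert h2 using 1; ring)
        exact (sub_eq_zero.1 this).symm
      le_total := fun a b => by
        rcases hM.sq (b - a) with h1 | h1
        · exact Or.inl h1
        · right; show IsSquare (a - b); convert h1 using 1; ring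
      toDecidableLE := Classical.decRel _ }
  have hle : ∀ a b : R, a ≤ b ↔ IsSquare (b - a) := fun a b => Iff.rfl
  have iS : IsStrictOrderedRing R := by
    haveI : IsOrderedAddMonoid R := 
      { add_le_add_left := fun a b hab c => by
          rw [hle] at hab ⊢; convert hab using 1; ring }
    haveI : ZeroLEOneClass R := ⟨(hle 0 1).2 ⟨1, by simp⟩⟩
    refine IsStrictOrderedRing.of_mul_pos ?_
    intro a b ha hb
    refine lt_of_le_of_ne ?_ (mul_ne_zero ha.ne' hb.ne').symm
    have h1 := (hle _ _).1 ha.le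
    have h2 := (hle _ _).1 hb.le
    rw [hle]
    rw [sub_zero] at *
    exact h1.mul h2
  refine ⟨R, iF, L, iS, φ, fun a ha => ?_, fun p hp => ?_⟩
  · rw [hle, sub_zero] at ha; exact ha
  · haveI : CharZero R := IsStrictOrderedRing.toCharZero
    exact rcf_fta hM.1 hM.sq hM.odd p hp
end Polynomial

namespace Polynomial
open Polynomial

section bez
variable {A B : Type} [CommRing A] [CommRing B]

def bezN (p : A[X]) : A[X][X] := p.map C * C (derivative p) - (derivative p).map C * C p

def bez (p : A[X]) : A[X][X] := bezN p /ₘ (X - C X)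

def tsq (g : A[X]) : A[X][X] := g.map C * C g

lemma eval_X_map_C (p : A[X]) : (p.map (C : A →+* A[X])).eval X = p := by
  rw [eval_map]; exact eval₂_C_X

lemma bez_spec (p : A[X]) : (X - C X) * bez p = bezN p := by
  rw [bez, mul_divByMonic_eq_iff_isRoot, IsRoot.def, bezN]
  simp only [eval_sub, eval_mul, eval_C, eval_X_map_C]
  ring

lemma bez_unique {p : A[X]} {E : A[X][X]} (h : (X - C X) * E = bezN p) : E = bez p := by
  rw [← bez_spec] at h
  exact (monic_X_sub_C (X : A[X])).isRegular.left h

lemma bez_map (φ : A →+* B) (p : A[X]) : bez (p.map φ) = (bez p).map (mapRingHom φ) := by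
  symm
  apply bez_unique
  have h := congrArg (Polynomial.map (mapRingHom φ)) (bez_spec p)
  have hc : ∀ q : A[X], (q.map C).map (mapRingHom φ) = (q.map φ).map C := by
    intro q
    rw [map_map, map_map]
    congr 1
    ext a; simp
  rw [Polynomial.map_mul] at h
  simp only [Polynomial.map_sub, map_X, map_C, coe_mapRingHom] at h
  rw [h, bezN, bezN]
  simp only [Polynomial.map_sub, Polynomial.map_mul, map_C, coe_mapRingHom, hc, derivative_map]

lemma bez_mul (p q : A[X]) : bez (p * q) = tsq p * bez q + tsq q * bez p := by
  symm
  apply bez_unique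
  rw [mul_add]
  have h1 := bez_spec p
  have h2 := bez_spec q
  have : (X - C X) * (tsq p * bez q) + (X - C X) * (tsq q * bez p) = tsq p * bezN q + tsq q * bezN p := by
    rw [← h1, ← h2]; ring
  rw [this]
  simp only [bezN, tsq, derivative_mul, Polynomial.map_mul, Polynomial.map_add, C_mul, C_add]
  ring

lemma tsq_mul (p q : A[X]) : tsq (p * q) = tsq p * tsq q := by
  simp only [tsq, Polynomial.map_mul, C_mul]; ring

lemma bez_C (c : A) : bez (C c) = 0 := by
  symm; apply bez_unique; simp [bezN]

lemma bez_lin (a : A) : bez (X - C a) = 1 := by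
  symm; apply bez_unique
  simp [bezN]

lemma bez_quad (a b s : A) (hs : s * s = 2) : bez ((X - C a) ^ 2 + C (b ^ 2)) =
    tsq (C s * (X - C a)) - tsq (C (s * b)) := by
  symm; apply bez_unique
  have h : (C (C s) * C (C s) : A[X][X]) = 2 := by
    rw [← C_mul, ← C_mul, hs]; rfl
  simp only [bezN, tsq, derivative_add, derivative_pow, derivative_sub, derivative_X, derivative_C, Polynomial.map_mul,
    Polynomial.map_add, Polynomial.map_sub, Polynomial.map_pow, map_X, map_C, C_mul, C_add, C_sub, C_pow]
  simp [show (C 2 : A[X]) = 2 from rfl, show (C 2 : A[X][X]) = 2 from rfl]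
  linear_combination (((X : A[X][X]) - C X) * ((X - C (C a)) * (C X - C (C a))) - (X - C X) * (C (C b) * C (C b))) * h

lemma bez_natDegree (p : A[X]) (d : ℕ) (hd : p.natDegree ≤ d) (a : ℕ) (ha : d ≤ a) : (bez p).coeff a = 0 := by
  by_cases h1 : Nontrivial A
  · by_cases h0 : d = 0
    · have : p = C (p.coeff 0) := eq_C_of_natDegree_le_zero (by omega)
      rw [this, bez_C, coeff_zero]
    · apply coeff_eq_zero_of_natDegree_lt
      refine lt_of_lt_of_le ?_ ha
      rw [bez, natDegree_divByMonic _ (monic_X_sub_C _), natDegree_X_sub_C]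
      have : (bezN p).natDegree ≤ d := by
        rw [bezN]
        refine (natDegree_sub_le _ _).trans (max_le ?_ ?_)
        · refine natDegree_mul_le.trans ?_
          rw [natDegree_C, add_zero]
          exact natDegree_map_le.trans hd
        · refine natDegree_mul_le.trans ?_
          rw [natDegree_C, add_zero]
          refine natDegree_map_le.trans ((natDegree_derivative_le p).trans (by omega))
      omega
  · haveI := not_nontrivial_iff_subsingleton.1 h1
    exact Subsingleton.elim _ _

lemma bez_rec (p : A[X]) (a : ℕ) : (bez p).coeff a - X * (bez p).coeff (a + 1) =
    C (p.coeff (a + 1)) * derivative p - C ((derivative p).coeff (a + 1)) * p := by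
  have := congrArg (fun q => coeff q (a + 1)) (bez_spec p)
  simp only [sub_mul, coeff_sub, coeff_X_mul, coeff_C_mul, bezN, coeff_mul_C, coeff_map] at this
  exact this

lemma bez_rec0 (p : A[X]) : - (X * (bez p).coeff 0) =
    C (p.coeff 0) * derivative p - C ((derivative p).coeff 0) * p := by
  have := congrArg (fun q => coeff q 0) (bez_spec p)
  simp only [sub_mul, coeff_sub, mul_coeff_zero, coeff_X_zero, zero_mul, coeff_C_mul, coeff_C_zero, bezN, coeff_map] at this
  linear_combination this

lemma coeff_coeff_swap (p : A[X][X]) (a c : ℕ) :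
    ((Bivariate.swap p).coeff a).coeff c = (p.coeff c).coeff a := by
  induction p using Polynomial.induction_on' with
  | add p q hp hq => simp [hp, hq]
  | monomial n f =>
    rw [Bivariate.swap_monomial, coeff_mul_C, coeff_map, coeff_C_mul, coeff_monomial, coeff_X_pow]
    by_cases h : c = n
    · simp [h]
    · simp [h, Ne.symm h]

lemma bez_symm (p : A[X]) (a c : ℕ) : ((bez p).coeff a).coeff c = ((bez p).coeff c).coeff a := by
  have h : Bivariate.swap (bez p) = bez p := by
    apply bez_unique
    have h1 := congrArg (Bivariate.swap (R := A)) (bez_spec p)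
    rw [map_mul, map_sub, Bivariate.swap_X, Bivariate.swap_Y, bezN, map_sub, map_mul, map_mul,
      Bivariate.swap_C, Bivariate.swap_C, Bivariate.swap_map_C, Bivariate.swap_map_C] at h1
    rw [bezN]
    linear_combination -h1
  rw [← coeff_coeff_swap, h]

/-- The bilinear pairing given by the coefficients. -/
def pr (d : ℕ) (E : A[X][X]) (v w : Fin d → A) : A :=
  ∑ a : Fin d, ∑ c : Fin d, v a * w c * (E.coeff a).coeff c

lemma pr_add (d : ℕ) (E E' : A[X][X]) (v w : Fin d → A) : pr d (E + E') v w = pr d E v w + pr d E' v w := by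
  simp only [pr, coeff_add, mul_add, Finset.sum_add_distrib]

lemma pr_sub (d : ℕ) (E E' : A[X][X]) (v w : Fin d → A) : pr d (E - E') v w = pr d E v w - pr d E' v w := by
  simp only [pr, coeff_sub, mul_sub, Finset.sum_sub_distrib]

lemma pr_sum {ι : Type} (s : Finset ι) (d : ℕ) (E : ι → A[X][X]) (v w : Fin d → A) :
    pr d (∑ i ∈ s, E i) v w = ∑ i ∈ s, pr d (E i) v w := by
  classical
  induction s using Finset.induction_on with
  | empty => simp [pr]
  | insert i s hi ih => rw [Finset.sum_insert hi, Finset.sum_insert hi, pr_add, ih]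

def dt (d : ℕ) (g : A[X]) : (Fin d → A) →ₗ[A] A where
  toFun v := ∑ a : Fin d, g.coeff a * v a
  map_add' v w := by simp [mul_add, Finset.sum_add_distrib]
  map_smul' c v := by simp [Finset.mul_sum, mul_left_comm]

lemma pr_tsq (d : ℕ) (g : A[X]) (v w : Fin d → A) : pr d (tsq g) v w = dt d g v * dt d g w := by
  simp only [pr, dt, tsq, coeff_mul_C, coeff_map, coeff_C_mul, LinearMap.coe_mk, AddHom.coe_mk,
    Finset.sum_mul_sum]
  refine Finset.sum_congr rfl fun a _ => Finset.sum_congr rfl fun c _ => by ring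

lemma pr_eq (d : ℕ) (E : A[X][X]) (v w : Fin d → A) :
    pr d E v w = Matrix.toBilin' (Matrix.of fun a c : Fin d => (E.coeff a).coeff c) v w := by
  rw [Matrix.toBilin'_apply, pr]
  refine Finset.sum_congr rfl fun a _ => Finset.sum_congr rfl fun c _ => by simp; ring

lemma pr_map (d : ℕ) (φ : A →+* B) (E : A[X][X]) (v w : Fin d → A) :
    pr d (E.map (mapRingHom φ)) (fun i => φ (v i)) (fun i => φ (w i)) = φ (pr d E v w) := by
  simp [pr, map_sum, coeff_map]
end bez

/-- the real closed field property -/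
def RC (F : Type) [Field F] [LinearOrder F] : Prop :=
  (∀ a : F, 0 ≤ a → IsSquare a) ∧ ∀ p : F[X], Irreducible p → p.natDegree ≤ 2

section rc
variable {F : Type} [Field F] [LinearOrder F] [IsStrictOrderedRing F]

theorem rc_induction (hF : RC F) (P : F[X] → Prop) (hc : ∀ c ≠ 0, P (C c))
    (hlin : ∀ a q, q ≠ 0 → P q → P ((X - C a) * q))
    (hquad : ∀ a b q, b ≠ 0 → q ≠ 0 → P q → P (((X - C a) ^ 2 + C (b ^ 2)) * q)) (p : F[X]) (hp : p ≠ 0) : P p := by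
  induction hn : p.natDegree using Nat.strong_induction_on generalizing p with
  | _ n ih =>
  subst hn
  by_cases h0 : p.natDegree = 0
  · rw [eq_C_of_natDegree_eq_zero h0] at hp ⊢
    exact hc _ (by simpa using hp)
  obtain ⟨t, ht, q, rfl⟩ := WfDvdMonoid.exists_irreducible_factor (not_isUnit_of_natDegree_pos p (by omega)) hp
  have hq0 : q ≠ 0 := right_ne_zero_of_mul hp
  have hq : ∀ c : F, c ≠ 0 → P (C c * q) := by
    intro c hc0
    have hne : C c * q ≠ 0 := mul_ne_zero (by simpa using hc0) hq0
    refine ih _ ?_ _ hne rfl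
    rw [natDegree_mul (by simpa using hc0) hq0, natDegree_mul ht.ne_zero hq0, natDegree_C]
    have := ht.natDegree_pos
    omega
  have hlin' : ∀ c a : F, c ≠ 0 → t = C c * (X - C a) → P (t * q) := by
    rintro c a hc0 rfl
    have := hlin a (C c * q) (mul_ne_zero (by simpa using hc0) hq0) (hq c hc0)
    convert this using 1; ring
  have hroot : ∀ r : F, t.IsRoot r → P (t * q) := by
    intro r hr
    have h1 := degree_eq_one_of_irreducible_of_root ht hr
    obtain ⟨s, hs⟩ := dvd_iff_isRoot.2 hr
    have hs0 : s ≠ 0 := by rintro rfl; simp at hs; exact ht.ne_zero hs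
    have h2 : t.natDegree = 1 := natDegree_eq_of_degree_eq_some h1
    rw [hs, natDegree_mul (X_sub_C_ne_zero r) hs0, natDegree_X_sub_C] at h2
    have h3 := eq_C_of_natDegree_eq_zero (show s.natDegree = 0 by omega)
    refine hlin' (s.coeff 0) r ?_ ?_
    · rintro h; rw [h] at h3; simp at h3; exact hs0 h3
    · rw [← h3, mul_comm]; exact hs
  have h2 := hF.2 t ht
  have h3 := ht.natDegree_pos
  rcases Nat.lt_or_ge t.natDegree 2 with hlt | hge
  · have h4 : t.natDegree = 1 := by omega
    obtain ⟨r, hr⟩ := exists_root_of_degree_eq_one (p := t) ((degree_eq_iff_natDegree_eq_of_pos (by norm_num)).2 h4)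
    exact hroot r hr
  have hd : t.natDegree = 2 := by omega
  set c := t.coeff 2
  set e := t.coeff 1
  set f := t.coeff 0
  have hc0 : c ≠ 0 := by
    have : t.leadingCoeff ≠ 0 := leadingCoeff_ne_zero.2 ht.ne_zero
    rwa [leadingCoeff, hd] at this
  have ht3 : t = C c * X ^ 2 + C e * X + C f := by
    rw [t.as_sum_range_C_mul_X_pow, hd]
    simp [Finset.sum_range_succ, c, e, f]; ring
  set a := -(e / (2 * c)) with ha
  set D := f / c - a ^ 2 with hD
  have he : e = -2 * c * a := by rw [ha]; field_simp
  have hf : f = c * (D + a ^ 2) := by rw [hD]; field_simp; ring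
  have ht4 : t = C c * ((X - C a) ^ 2 + C D) := by
    rw [ht3, he, hf]
    simp only [C_mul, C_add, C_neg, C_pow]
    rw [show (C 2 : F[X]) = 2 from rfl]; ring
  rcases le_or_gt D 0 with hD0 | hD0
  · obtain ⟨s, hs⟩ := hF.1 (-D) (by linarith)
    apply hroot (a + s)
    rw [IsRoot.def, ht4]
    simp only [eval_mul, eval_C, eval_add, eval_pow, eval_sub, eval_X]
    rw [show D = - (s * s) by linarith]; ring
  · obtain ⟨s, hs⟩ := hF.1 D hD0.le
    have := hquad a s (C c * q) (by rintro rfl; simp at hs; exact hD0.ne' hs) (mul_ne_zero (by simpa using hc0) hq0) (hq c hc0)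
    rw [ht4]
    convert this using 1
    rw [hs]; ring

lemma eval_quad_pos (a b y : F) (hb : b ≠ 0) : 0 < ((X - C a) ^ 2 + C (b ^ 2)).eval y := by
  simp only [eval_C, eval_add, eval_pow, eval_sub, eval_X]
  positivity

theorem rc_pos (hF : RC F) (p : F[X]) (hp : p ≠ 0) : (∀ y, p.eval y ≠ 0) → ∀ y, 0 < p.eval y * p.leadingCoeff := by
  refine rc_induction hF (fun p => (∀ y, p.eval y ≠ 0) → ∀ y, 0 < p.eval y * p.leadingCoeff) ?_ ?_ ?_ p hp
  · intro c hc _ y; simp; positivity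
  · intro a q hq _ h
    exact (h a (by simp)).elim
  · intro a b q hb hq ih h y
    have h1 := ih (fun y hy => h y (by rw [eval_mul, hy, mul_zero])) y
    have hm : ((X - C a) ^ 2 + C (b ^ 2)).Monic := by monicity!
    rw [eval_mul, leadingCoeff_mul, hm.leadingCoeff, one_mul, mul_assoc]
    exact mul_pos (eval_quad_pos a b y hb) h1

theorem bez_decomp (hF : RC F) (p : F[X]) (hp : p ≠ 0) : ∃ (ι κ : Type) (_ : Fintype ι) (_ : Fintype κ)
    (g : ι → F[X]) (h l : κ → F[X]), Fintype.card ι + 2 * Fintype.card κ = p.natDegree ∧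
      bez p = ∑ i, tsq (g i) + ∑ j, (tsq (h j) - tsq (l j)) ∧ (IsEmpty ι ↔ ∀ y, p.eval y ≠ 0) := by
  refine rc_induction hF (fun p => ∃ (ι κ : Type) (_ : Fintype ι) (_ : Fintype κ)
    (g : ι → F[X]) (h l : κ → F[X]), Fintype.card ι + 2 * Fintype.card κ = p.natDegree ∧
      bez p = ∑ i, tsq (g i) + ∑ j, (tsq (h j) - tsq (l j)) ∧ (IsEmpty ι ↔ ∀ y, p.eval y ≠ 0)) ?_ ?_ ?_ p hp
  · intro c hc
    refine ⟨Empty, Empty, inferInstance, inferInstance, Empty.elim, Empty.elim, Empty.elim, by simp, by simp [bez_C], ?_⟩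
    simp [hc]; infer_instance
  · rintro a q hq ⟨ι, κ, _, _, g, h, l, hcard, hbez, hemp⟩
    refine ⟨Option ι, κ, inferInstance, inferInstance, fun o => o.elim q (fun i => (X - C a) * g i),
      fun j => (X - C a) * h j, fun j => (X - C a) * l j, ?_, ?_, ?_⟩
    · rw [natDegree_mul (X_sub_C_ne_zero a) hq, natDegree_X_sub_C, Fintype.card_option, ← hcard]; ring
    · rw [bez_mul, bez_lin, hbez, Fintype.sum_option]
      simp only [Option.elim, tsq_mul, ← mul_sub, ← Finset.mul_sum]
      ring
    · refine ⟨fun h => (h.false none).elim, fun h => (h a (by simp)).elim⟩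
  · rintro a b q hb hq ⟨ι, κ, _, _, g, h, l, hcard, hbez, hemp⟩
    obtain ⟨s, hs⟩ := hF.1 2 (by norm_num)
    set t : F[X] := (X - C a) ^ 2 + C (b ^ 2)
    have ht : t.natDegree = 2 := by 
      have : t = (X - C a) ^ 2 + C (b ^ 2) := rfl
      rw [this]; compute_degree!
    have ht0 : t ≠ 0 := by intro h; rw [h] at ht; simp at ht
    refine ⟨ι, Option κ, inferInstance, inferInstance, fun i => t * g i,
      fun o => o.elim (q * (C s * (X - C a))) (fun j => t * h j), fun o => o.elim (q * C (s * b)) (fun j => t * l j), ?_, ?_, ?_⟩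
    · rw [natDegree_mul ht0 hq, ht, Fintype.card_option, ← hcard]; ring
    · rw [bez_mul, bez_quad a b s hs.symm, hbez, Fintype.sum_option]
      simp only [Option.elim, tsq_mul, ← mul_sub, ← Finset.mul_sum]
      ring
    · rw [hemp]
      have : ∀ y, (t * q).eval y ≠ 0 ↔ q.eval y ≠ 0 := by
        intro y
        rw [eval_mul, mul_ne_zero_iff]
        exact ⟨fun h => h.2, fun h => ⟨(eval_quad_pos a b y hb).ne', h⟩⟩
      simp only [this]

/-- inertia bound -/
lemma inertia {ι κ : Type} [Fintype ι] [Fintype κ] (d : ℕ) (E : F[X][X]) (g : ι → F[X]) (h l : κ → F[X])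
    (hE : E = ∑ i, tsq (g i) + ∑ j, (tsq (h j) - tsq (l j))) (v : Fin d → Fin d → F)
    (D : Fin d → F) (hv : ∀ i j, pr d E (v i) (v j) = if i = j then D i else 0) :
    Fintype.card {i // D i < 0} ≤ Fintype.card κ := by
  classical
  by_contra hlt
  push Not at hlt
  let f : ({i // D i < 0} → F) →ₗ[F] (κ → F) :=
    { toFun := fun w j => ∑ i, w i * dt d (l j) (v i)
      map_add' := fun w w' => by ext j; simp [add_mul, Finset.sum_add_distrib]
      map_smul' := fun c w => by ext j; simp [Finset.mul_sum, mul_assoc] }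
  have hk : LinearMap.ker f ≠ ⊥ := LinearMap.ker_ne_bot_of_finrank_lt (by simpa using hlt)
  obtain ⟨w, hw, hw0⟩ := (Submodule.ne_bot_iff _).1 hk
  have hw1 : ∀ j, ∑ i, w i * dt d (l j) (v i) = 0 := fun j => congrFun (LinearMap.mem_ker.1 hw) j
  set u : Fin d → F := ∑ i, w i • v i with hu
  have h1 : pr d E u u = ∑ i, w i * w i * D i := by
    rw [pr_eq, hu]
    simp only [map_sum, map_smul, LinearMap.sum_apply, LinearMap.smul_apply, ← pr_eq, hv, smul_eq_mul]
    refine Finset.sum_congr rfl fun i _ => ?_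
    rw [Finset.sum_eq_single i]
    · simp; ring
    · intro j _ hj
      rw [if_neg (fun h => hj (Subtype.ext h))]; simp
    · simp
  have h2 : 0 ≤ pr d E u u := by
    rw [hE, pr_add, pr_sum, pr_sum]
    refine add_nonneg (Finset.sum_nonneg fun i _ => ?_) (Finset.sum_nonneg fun j _ => ?_)
    · rw [pr_tsq]; exact mul_self_nonneg _
    · rw [pr_sub, pr_tsq, pr_tsq]
      have : dt d (l j) u = 0 := by
        rw [hu, map_sum]; simp only [map_smul, smul_eq_mul]; exact hw1 j
      rw [this, zero_mul, sub_zero]; exact mul_self_nonneg _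
  obtain ⟨i, hi⟩ := Function.ne_iff.1 hw0
  have h3 : ∑ i, w i * w i * D i < 0 := by
    refine Finset.sum_neg' (fun i _ => ?_) ⟨i, Finset.mem_univ _, ?_⟩
    · exact mul_nonpos_of_nonneg_of_nonpos (mul_self_nonneg _) i.2.le
    · exact mul_neg_of_pos_of_neg (mul_self_pos.2 hi) i.2
  linarith

lemma inertia' {κ : Type} [Fintype κ] (d : ℕ) (E : F[X][X]) (h l : κ → F[X])
    (hE : E = ∑ j, (tsq (h j) - tsq (l j))) (v : Fin d → Fin d → F)
    (D : Fin d → F) (hv : ∀ i j, pr d E (v i) (v j) = if i = j then D i else 0) :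
    Fintype.card {i // 0 < D i} ≤ Fintype.card κ := by
  have := inertia d (-E) (Empty.elim) l h (by rw [hE, ← Finset.sum_neg_distrib]; simp) v (fun i => - D i) (by
    intro i j
    have : pr d (-E) (v i) (v j) = - pr d E (v i) (v j) := by
      have h := pr_sub d 0 E (v i) (v j)
      have h0 : pr d 0 (v i) (v j) = 0 := by simp [pr]
      rw [zero_sub, h0, zero_sub] at h; exact h
    rw [this, hv]; split <;> simp)
  convert this using 3
  simp
end rc

section nondeg
variable {k : Type} [Field k]

lemma bez_nondeg (p : k[X]) (hp : IsCoprime p (derivative p)) (d : ℕ) (hd : d = p.natDegree) (u : Fin d → k)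
    (hu : ∀ v, pr d (bez p) v u = 0) : u = 0 := by
  classical
  by_cases hd0 : d = 0
  · ext i; have := i.2; omega
  have hp0 : p ≠ 0 := by rintro rfl; simp at hd; exact hd0 hd
  let ℓ : k[X] →ₗ[k] k :=
    { toFun := fun q => ∑ c : Fin d, u c * (q % p).coeff c
      map_add' := fun q q' => by simp [add_mod, mul_add, Finset.sum_add_distrib]
      map_smul' := fun c q => by 
        have : (c • q) % p = c • (q % p) := by
          rw [mod_def, mod_def, smul_modByMonic]
        simp [this, Finset.mul_sum, mul_left_comm] }
  have hℓp : ∀ q, ℓ (q * p) = 0 := by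
    intro q
    have : q * p % p = 0 := EuclideanDomain.mod_eq_zero.2 (dvd_mul_left _ _)
    simp [ℓ, this]
  have hℓb : ∀ a, ℓ ((bez p).coeff a) = 0 := by
    intro a
    by_cases ha : a < d
    · have h1 := hu (Pi.single ⟨a, ha⟩ 1)
      have h2 : (bez p).coeff a % p = (bez p).coeff a := by
        rw [mod_eq_self_iff hp0, degree_eq_natDegree hp0, degree_lt_iff_coeff_zero]
        intro c hc
        rw [bez_symm, bez_natDegree p d hd.symm.le c (by omega), coeff_zero]
      show ∑ c : Fin d, u c * ((bez p).coeff a % p).coeff c = 0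
      rw [pr, Finset.sum_eq_single ⟨a, ha⟩] at h1
      rw [h2, ← h1]
      · refine Finset.sum_congr rfl fun c _ => by simp
      · intro b _ hb; simp [hb]
      · simp
    · rw [bez_natDegree p d hd.symm.le a (by omega), map_zero]
  have key : ∀ j a, ℓ (X ^ j * (bez p).coeff a) = 0 ∧ ℓ (X ^ j * derivative p) = 0 := by
    have hstep : ∀ j, (∀ a, ℓ (X ^ j * (bez p).coeff a) = 0) → ℓ (X ^ j * derivative p) = 0 := by
      intro j h
      have h1 := bez_rec p (d - 1)
      rw [show d - 1 + 1 = d by omega, bez_natDegree p d hd.symm.le d le_rfl,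
        coeff_eq_zero_of_natDegree_lt (lt_of_le_of_lt (natDegree_derivative_le p) (by omega))] at h1
      have h2 := congrArg (fun q => ℓ (X ^ j * q)) h1
      simp only [mul_zero, sub_zero, C_0, zero_mul, h] at h2
      rw [← smul_eq_C_mul, mul_smul_comm, map_smul, smul_eq_mul, eq_comm, mul_eq_zero] at h2
      refine h2.resolve_left ?_
      rw [hd]; exact leadingCoeff_ne_zero.2 hp0
    intro j
    induction j with
    | zero => 
      have h0 : ∀ a, ℓ (X ^ 0 * (bez p).coeff a) = 0 := by simpa using hℓb
      exact fun a => ⟨h0 a, hstep _ h0⟩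
    | succ j ih => 
      have h0 : ∀ a, ℓ (X ^ (j+1) * (bez p).coeff a) = 0 := by
        intro a
        rcases a with _ | a
        · have h1 := bez_rec0 p
          have h2 : X ^ (j + 1) * (bez p).coeff 0 = 
              - (p.coeff 0 • (X ^ j * derivative p)) + ((derivative p).coeff 0) • (X ^ j * p) := by
            simp only [smul_eq_C_mul]
            linear_combination -X ^ j * h1
          rw [h2, map_add, map_neg, map_smul, map_smul, (ih 0).2, hℓp]; simp
        · have h1 := bez_rec p a
          have h2 : X ^ (j + 1) * (bez p).coeff (a + 1) = X ^ j * (bez p).coeff a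
              - p.coeff (a + 1) • (X ^ j * derivative p) + ((derivative p).coeff (a + 1)) • (X ^ j * p) := by
            simp only [smul_eq_C_mul]
            linear_combination -X ^ j * h1
          rw [h2, map_add, map_sub, map_smul, map_smul, (ih a).1, (ih a).2, hℓp]; simp
      exact fun a => ⟨h0 a, hstep _ h0⟩
  have hall : ∀ q, ℓ (q * derivative p) = 0 := by
    intro q
    induction q using Polynomial.induction_on' with
    | add q r hq hr => rw [add_mul, map_add, hq, hr, add_zero]
    | monomial n c =>
      rw [← C_mul_X_pow_eq_monomial, mul_assoc, ← smul_eq_C_mul, map_smul, (key n 0).2, smul_zero]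
  obtain ⟨s, t, hst⟩ := hp
  have hfin : ∀ q, ℓ q = 0 := by
    intro q
    have : q = (q * s) * p + (q * t) * derivative p := by linear_combination -q * hst
    rw [this, map_add, hall, hℓp, add_zero]
  ext c
  have h1 := hfin (X ^ (c : ℕ))
  have h2 : (X ^ (c : ℕ) : k[X]) % p = X ^ (c : ℕ) := by
    rw [mod_eq_self_iff hp0, degree_X_pow, degree_eq_natDegree hp0, ← hd]
    exact_mod_cast c.2
  have h3 : ∑ e : Fin d, u e * ((X ^ (c : ℕ) : k[X]) % p).coeff e = 0 := h1
  rw [h2, Finset.sum_eq_single c] at h3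
  · simpa using h3
  · intro b _ hb
    rw [coeff_X_pow, if_neg (fun h => hb (Fin.ext h)), mul_zero]
  · simp
end nondeg
end Polynomial

namespace Polynomial
open Polynomial

lemma rc_real : RC ℝ :=
  ⟨fun a ha => ⟨√a, (Real.mul_self_sqrt ha).symm⟩, fun p hp => hp.natDegree_le_two⟩

lemma clearP {A : Type} [CommRing A] [IsDomain A] (p : (FractionRing A)[X]) :
    ∃ (c : A) (p' : A[X]), c ≠ 0 ∧ p'.map (algebraMap A (FractionRing A)) = C (algebraMap A (FractionRing A) c) * p := by
  obtain ⟨b, hb⟩ := IsLocalization.integerNormalization_map_to_map (nonZeroDivisors A) p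
  refine ⟨b, _, nonZeroDivisors.ne_zero b.2, hb.trans ?_⟩
  rw [← smul_eq_C_mul, algebraMap_smul]

lemma diag {A : Type} [CommRing A] [IsDomain A] [CharZero A] (f : A[X])
    (hsep : IsCoprime (f.map (algebraMap A (FractionRing A))) (derivative (f.map (algebraMap A (FractionRing A))))) :
    ∃ (v : Fin f.natDegree → Fin f.natDegree → A) (D : Fin f.natDegree → A), (∀ i, D i ≠ 0) ∧
      ∀ i j, pr f.natDegree (bez f) (v i) (v j) = if i = j then D i else 0 := by
  classical
  set k := FractionRing A
  set d := f.natDegree with hd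
  set al := algebraMap A k with hal
  have hinj : Function.Injective al := IsFractionRing.injective A k
  have hdk : d = (f.map al).natDegree := by rw [natDegree_map_eq_of_injective hinj]
  set Bf := Matrix.toBilin' (Matrix.of fun a c : Fin d => ((bez (f.map al)).coeff a).coeff c) with hBf
  have hpr : ∀ v w, Bf v w = pr d (bez (f.map al)) v w := fun v w => (pr_eq _ _ _ _).symm
  haveI : CharZero k := charZero_of_injective_algebraMap hinj
  haveI : Invertible (2 : k) := invertibleOfNonzero two_ne_zero
  have hsymm : ∀ v w, pr d (bez (f.map al)) v w = pr d (bez (f.map al)) w v := by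
    intro v w
    rw [pr, pr, Finset.sum_comm]
    refine Finset.sum_congr rfl fun a _ => Finset.sum_congr rfl fun c _ => ?_
    rw [bez_symm]; ring
  obtain ⟨b, hb⟩ := LinearMap.BilinForm.exists_orthogonal_basis (B := Bf) ⟨fun v w => by
    rw [RingHom.id_apply, hpr, hpr, hsymm]⟩
  have hfr : Module.finrank k (Fin d → k) = d := by simp
  set b' := b.reindex (finCongr hfr) with hb'
  have horth : ∀ i j, i ≠ j → pr d (bez (f.map al)) (b' i) (b' j) = 0 := by
    intro i j hij
    rw [← hpr, hb', Module.Basis.reindex_apply, Module.Basis.reindex_apply]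
    exact hb (fun h => hij ((finCongr hfr).symm.injective h))
  have hself : ∀ i, pr d (bez (f.map al)) (b' i) (b' i) ≠ 0 := by
    intro i h0
    apply b'.ne_zero i
    apply bez_nondeg (f.map al) hsep d hdk
    intro v
    rw [← hpr]
    have : Bf.flip (b' i) = 0 := by
      apply b'.ext
      intro j
      show Bf (b' j) (b' i) = 0
      rw [hpr]
      by_cases hij : j = i
      · rw [hij, h0]
      · exact horth j i hij
    have h1 := LinearMap.congr_fun this v
    simpa using h1
  obtain ⟨c, v, hc, hv⟩ := frac_common_denom (R := A) (fun ij : Fin d × Fin d => b' ij.1 ij.2)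
  have hc' : al c ≠ 0 := (map_ne_zero_iff _ hinj).2 hc
  have hvv : ∀ i, (fun a => al (v (i, a))) = al c • b' i := by
    intro i; ext a; rw [← hv]; rfl
  have hE : bez (f.map al) = (bez f).map (mapRingHom al) := bez_map al f
  have hval : ∀ i j, al (pr d (bez f) (fun a => v (i, a)) (fun a => v (j, a))) =
      al c * al c * pr d (bez (f.map al)) (b' i) (b' j) := by
    intro i j
    rw [← pr_map, ← hE, hvv, hvv, ← hpr, ← hpr]
    simp only [map_smul, LinearMap.smul_apply, smul_eq_mul]; ring
  refine ⟨fun i a => v (i, a), fun i => pr d (bez f) (fun a => v (i, a)) (fun a => v (i, a)), fun i h => ?_, fun i j => ?_⟩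
  · have := hval i i
    have h' : pr d (bez f) (fun a => v (i, a)) (fun a => v (i, a)) = 0 := h
    rw [h', map_zero] at this
    exact mul_ne_zero (mul_ne_zero hc' hc') (hself i) this.symm
  · split_ifs with h
    · rw [h]
    · apply hinj
      rw [hval, horth i j h, mul_zero, map_zero]

section sgn
variable {R : Type} [Field R] [LinearOrder R] [IsStrictOrderedRing R]

lemma sgn_match (φ : ℝ[X] →+* R) (hφ : Function.Injective φ) (S : Finset ℝ[X]) (hS : ∀ p ∈ S, p ≠ 0) :
    ∃ x : ℝ, ∀ p ∈ S, p.eval x ≠ 0 ∧ (0 < p.eval x ↔ 0 < φ p) := by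
  classical
  have hmono : ∀ c : ℝ, 0 < c → 0 < φ (C c) := by
    intro c hc
    have h1 : φ (C c) = φ (C √c) * φ (C √c) := by
      rw [← map_mul, ← C_mul, Real.mul_self_sqrt hc.le]
    rw [h1]
    apply mul_self_pos.2
    rw [map_ne_zero_iff _ hφ]
    simpa using (Real.sqrt_pos.2 hc).ne'
  have hlt : ∀ a b : ℝ, φ (C a) < φ (C b) → a < b := by
    intro a b h
    by_contra hab
    push Not at hab
    rcases hab.eq_or_lt with h1 | h1
    · rw [h1] at h; exact lt_irrefl _ h
    · have := hmono (a - b) (by linarith)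
      rw [C_sub, map_sub] at this
      linarith
  have hne : ∀ r : ℝ, φ (C r) ≠ φ X := fun r h => by
    have := hφ h
    have h1 := congrArg natDegree this
    simp at h1
  set Z : Finset ℝ := S.biUnion (fun p => p.roots.toFinset)
  obtain ⟨x, hx1, hx2⟩ := Order.exists_between_finsets (Z.filter fun r => φ (C r) < φ X) (Z.filter fun r => φ X < φ (C r)) (by
    intro a ha b hb
    exact hlt a b ((Finset.mem_filter.1 ha).2.trans (Finset.mem_filter.1 hb).2))
  refine ⟨x, fun p hp => ?_⟩
  have hroots : ∀ r ∈ p.roots, r ∈ Z := fun r hr => Finset.mem_biUnion.2 ⟨p, hp, by simpa using hr⟩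
  have key : p ≠ 0 → (∀ r, p.eval r = 0 → r ∈ Z) → p.eval x ≠ 0 ∧ φ p ≠ 0 ∧ (0 < p.eval x ↔ 0 < φ p) := by
    intro hp0
    refine rc_induction rc_real (fun p => (∀ r, p.eval r = 0 → r ∈ Z) → p.eval x ≠ 0 ∧ φ p ≠ 0 ∧ (0 < p.eval x ↔ 0 < φ p)) ?_ ?_ ?_ p hp0
    · intro c hc _
      rw [eval_C]
      refine ⟨hc, by rw [map_ne_zero_iff _ hφ]; simpa using hc, fun h => hmono c h, fun h => ?_⟩
      have := hlt 0 c (by simpa using h)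
      exact this
    · intro a q hq ih hr
      obtain ⟨h1, h2, h3⟩ := ih (fun r hr' => hr r (by rw [eval_mul, hr', mul_zero]))
      have ha : a ∈ Z := hr a (by simp)
      rw [eval_mul, map_mul, eval_sub, eval_X, eval_C, map_sub]
      rcases lt_or_gt_of_ne (hne a) with h | h
      · have h4 := hx1 a (Finset.mem_filter.2 ⟨ha, h⟩)
        have h5 : 0 < x - a := by linarith
        have h6 : 0 < φ X - φ (C a) := by linarith
        exact ⟨mul_ne_zero h5.ne' h1, mul_ne_zero h6.ne' h2, by rw [mul_pos_iff_of_pos_left h5, mul_pos_iff_of_pos_left h6, h3]⟩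
      · have h4 := hx2 a (Finset.mem_filter.2 ⟨ha, h⟩)
        have h5 : x - a < 0 := by linarith
        have h6 : φ X - φ (C a) < 0 := by linarith
        refine ⟨mul_ne_zero h5.ne h1, mul_ne_zero h6.ne h2, ?_⟩
        rw [mul_pos_iff, mul_pos_iff]
        have h7 : q.eval x < 0 ↔ φ q < 0 := by
          rw [← not_iff_not, not_lt, not_lt, le_iff_lt_or_eq, le_iff_lt_or_eq]
          simp [h1.symm, h2.symm, h3]
        simp [h5, h6, h5.le.not_gt, h6.le.not_gt, h7]
    · intro a b q hb hq ih hr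
      obtain ⟨h1, h2, h3⟩ := ih (fun r hr' => hr r (by rw [eval_mul, hr', mul_zero]))
      have h5 := eval_quad_pos a b x hb
      have h6 : 0 < φ ((X - C a) ^ 2 + C (b ^ 2)) := by
        rw [map_add, map_pow]
        have := hmono (b ^ 2) (by positivity)
        positivity
      rw [eval_mul, map_mul]
      exact ⟨mul_ne_zero h5.ne' h1, mul_ne_zero h6.ne' h2, by rw [mul_pos_iff_of_pos_left h5, mul_pos_iff_of_pos_left h6, h3]⟩
  obtain ⟨h1, -, h3⟩ := key (hS p hp) (fun r hr => hroots r (by rw [mem_roots (hS p hp)]; exact hr))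
  exact ⟨h1, h3⟩

theorem transfer (hR : RC R) (φ : ℝ[X] →+* R) (hφ : Function.Injective φ) (f : ℝ[X][X])
    (hsep : IsCoprime (f.map (algebraMap ℝ[X] (FractionRing ℝ[X]))) (derivative (f.map (algebraMap ℝ[X] (FractionRing ℝ[X])))))
    (hpsd : ∀ x y : ℝ, 0 ≤ (f.map (evalRingHom x)).eval y) (η : R) : 0 ≤ (f.map φ).eval η := by
  classical
  obtain ⟨v, D, hD0, hD⟩ := diag f hsep
  have hinj : Function.Injective (algebraMap ℝ[X] (FractionRing ℝ[X])) := IsFractionRing.injective _ _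
  have hf0 : f ≠ 0 := by
    rintro rfl
    simp only [Polynomial.map_zero, derivative_zero] at hsep
    exact not_isCoprime_zero_zero hsep
  obtain ⟨c, s, t, hc, hst⟩ : ∃ (c : ℝ[X]) (s t : ℝ[X][X]), c ≠ 0 ∧ s * f + t * derivative f = C c := by
    obtain ⟨a, b, hab⟩ := hsep
    obtain ⟨c1, a', hc1, ha⟩ := clearP a
    obtain ⟨c2, b', hc2, hb⟩ := clearP b
    refine ⟨c1 * c2, C c2 * a', C c1 * b', mul_ne_zero hc1 hc2, ?_⟩
    apply map_injective _ hinj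
    simp only [Polynomial.map_add, Polynomial.map_mul, map_C, ha, hb, ← derivative_map]
    rw [map_mul, C_mul]
    linear_combination (C (algebraMap ℝ[X] (FractionRing ℝ[X]) c1) * C (algebraMap ℝ[X] (FractionRing ℝ[X]) c2)) * hab
  have hlc : f.leadingCoeff ≠ 0 := leadingCoeff_ne_zero.2 hf0
  obtain ⟨x, hx⟩ := sgn_match φ hφ (insert c (insert f.leadingCoeff (Finset.univ.image D))) (by
    intro p hp
    simp only [Finset.mem_insert, Finset.mem_image, Finset.mem_univ, true_and] at hp
    rcases hp with rfl | rfl | ⟨i, rfl⟩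
    · exact hc
    · exact hlc
    · exact hD0 i)
  have hxc := hx c (by simp)
  have hxl := hx f.leadingCoeff (by simp)
  have hxD : ∀ i, _ := fun i => hx (D i) (by simp)
  -- the real side
  set f0 := f.map (evalRingHom x) with hf0d
  have hdeg0 : f0.natDegree = f.natDegree := natDegree_map_of_leadingCoeff_ne_zero _ (by simpa using hxl.1)
  have hlc0 : f0.leadingCoeff = f.leadingCoeff.eval x := by
    rw [leadingCoeff, hdeg0, hf0d, coeff_map]; rfl
  have hf00 : f0 ≠ 0 := by
    rw [← leadingCoeff_ne_zero, hlc0]; exact hxl.1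
  have hnr : ∀ y, f0.eval y ≠ 0 := by
    intro y hy
    have hmin : IsLocalMin (fun z => f0.eval z) y := by
      refine Filter.Eventually.of_forall fun z => ?_
      show f0.eval y ≤ f0.eval z
      rw [hy]; exact hpsd x z
    have h1 := hmin.deriv_eq_zero
    rw [Polynomial.deriv] at h1
    have h2 := congrArg (fun q => (q.map (evalRingHom x)).eval y) hst
    simp only [Polynomial.map_add, Polynomial.map_mul, ← derivative_map, eval_add, eval_mul, map_C, eval_C] at h2
    rw [← hf0d, hy, h1] at h2
    simp at h2
    exact hxc.1 h2.symm
  have hlpos : 0 < f.leadingCoeff.eval x := by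
    have h1 := rc_pos rc_real f0 hf00 hnr 0
    rw [hlc0] at h1
    have h2 := hpsd x 0
    rcases lt_or_gt_of_ne hxl.1 with h | h
    · nlinarith
    · exact h
  obtain ⟨ι, κ, _, _, g, h, l, hcard, hbez, hemp⟩ := bez_decomp rc_real f0 hf00
  haveI := hemp.2 hnr
  have hpos : Fintype.card {i // 0 < (D i).eval x} ≤ Fintype.card κ := by
    refine inertia' f.natDegree (bez f0) h l ?_ (fun i a => (v i a).eval x) _ ?_
    · rw [hbez]; simp
    · intro i j
      have h1 := pr_map f.natDegree (evalRingHom x) (bez f) (v i) (v j)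
      rw [hD, ← bez_map] at h1
      simp only [coe_evalRingHom] at h1
      rw [hf0d, h1]; split_ifs <;> simp
  -- the other side
  set f1 := f.map φ with hf1d
  have hdeg1 : f1.natDegree = f.natDegree := natDegree_map_eq_of_injective hφ f
  have hlc1 : f1.leadingCoeff = φ f.leadingCoeff := leadingCoeff_map_of_injective hφ f
  have hf10 : f1 ≠ 0 := (Polynomial.map_ne_zero_iff hφ).2 hf0
  obtain ⟨ι', κ', _, _, g', h', l', hcard', hbez', hemp'⟩ := bez_decomp hR f1 hf10
  have hneg : Fintype.card {i // φ (D i) < 0} ≤ Fintype.card κ' := by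
    refine inertia f.natDegree (bez f1) g' h' l' hbez' (fun i a => φ (v i a)) _ ?_
    intro i j
    have h1 := pr_map f.natDegree φ (bez f) (v i) (v j)
    rw [hD, ← bez_map] at h1
    rw [hf1d, h1]; split_ifs <;> simp
  have htot : f.natDegree ≤ Fintype.card {i // 0 < (D i).eval x} + Fintype.card {i // φ (D i) < 0} := by
    have h1 : ∀ i, 0 < (D i).eval x ∨ φ (D i) < 0 := by
      intro i
      rcases lt_or_gt_of_ne ((map_ne_zero_iff _ hφ).2 (hD0 i)) with h | h
      · exact Or.inr h
      · exact Or.inl ((hxD i).2.2 h)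
    calc f.natDegree = Fintype.card {i // 0 < (D i).eval x ∨ φ (D i) < 0} := by simp [h1]
      _ ≤ _ := Fintype.card_subtype_or _ _
  have hc0 : Fintype.card ι = 0 := Fintype.card_eq_zero
  have hι' : IsEmpty ι' := by
    rw [← Fintype.card_eq_zero_iff]; omega
  have := rc_pos hR f1 hf10 (hemp'.1 hι') η
  rw [hlc1] at this
  have h2 := hxl.2.1 hlpos
  exact ((mul_pos_iff_of_pos_right h2).1 this).le
end sgn
end Polynomial

namespace Polynomial
open Polynomial

lemma nonneg_of_dense (p q : ℝ[X]) (hq : q ≠ 0) (h : ∀ x, q.eval x ≠ 0 → 0 ≤ p.eval x) (x : ℝ) :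
    0 ≤ p.eval x := by
  have hfin : {x : ℝ | q.eval x = 0}.Finite := by
    refine (q.roots.toFinset.finite_toSet).subset fun x hx => ?_
    simpa [hq] using hx
  have hd : Dense {x : ℝ | q.eval x = 0}ᶜ := hfin.countable.dense_compl ℝ
  have hcl : IsClosed {x : ℝ | 0 ≤ p.eval x} := isClosed_le continuous_const p.continuous
  have h1 : closure ({x : ℝ | q.eval x = 0}ᶜ) ⊆ {x : ℝ | 0 ≤ p.eval x} :=
    hcl.closure_subset_iff.2 fun x hx => h x hx
  exact h1 (hd x)

lemma nonneg_of_dense2 (p q : ℝ[X][X]) (hq : q ≠ 0)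
    (h : ∀ x y, (q.map (evalRingHom x)).eval y ≠ 0 → 0 ≤ (p.map (evalRingHom x)).eval y) (x y : ℝ) :
    0 ≤ (p.map (evalRingHom x)).eval y := by
  have h1 : ∀ x, q.leadingCoeff.eval x ≠ 0 → ∀ y, 0 ≤ (p.map (evalRingHom x)).eval y := by
    intro x hx
    refine nonneg_of_dense _ (q.map (evalRingHom x)) ?_ (h x)
    intro h0
    apply hx
    have := congrArg (fun r => coeff r q.natDegree) h0
    simpa [coeff_map] using this
  have h2 := nonneg_of_dense (p.eval (C y)) q.leadingCoeff (leadingCoeff_ne_zero.2 hq) (by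
    intro x hx
    have := h1 x hx y
    rwa [map_evalRingHom_eval] at this) x
  rw [map_evalRingHom_eval]
  exact h2

lemma sumsq_of_neg_one {L : Type} [Field L] [CharZero L] (h : IsSumSq (-1 : L)) (f : L) : IsSumSq f := by
  have : f = ((f + 1) / 2) * ((f + 1) / 2) + (-1) * (((f - 1) / 2) * ((f - 1) / 2)) := by ring
  rw [this]
  exact (IsSumSq.mul_self _).add (h.mul (IsSumSq.mul_self _))

/-- A field with `f` not a sum of squares maps to a semireal field in which `-f` is a square. -/
lemma exists_ext {L : Type} [Field L] [CharZero L] (f : L) (hf : ¬ IsSumSq f) :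
    ∃ (L' : Type) (_ : Field L') (φ : L →+* L'), ¬ IsSumSq (-1 : L') ∧ IsSquare (-(φ f)) := by
  have h1 : ¬ IsSumSq (-1 : L) := fun h => hf (sumsq_of_neg_one h f)
  by_cases hs : IsSquare (-f)
  · exact ⟨L, inferInstance, RingHom.id L, h1, hs⟩
  have hm : (X ^ 2 - C (-f) : L[X]).Monic := by monicity!
  have hd : (X ^ 2 - C (-f) : L[X]).natDegree = 2 := by compute_degree!
  have hirr : Irreducible (X ^ 2 - C (-f) : L[X]) := by
    apply irreducible_of_degree_le_three_of_not_isRoot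
    · rw [hd]; simp
    · intro x hx
      apply hs
      refine ⟨x, ?_⟩
      simp only [IsRoot.def, eval_sub, eval_pow, eval_X, eval_C] at hx
      linear_combination -hx
  haveI : Fact (Irreducible (X ^ 2 - C (-f) : L[X])) := ⟨hirr⟩
  refine ⟨AdjoinRoot (X ^ 2 - C (-f) : L[X]), inferInstance, AdjoinRoot.of _, ?_, ?_⟩
  · intro h
    obtain ⟨n, U, hU, he⟩ := sumsq_adjoinRoot _ hm (by omega) _ h
    apply hf
    have := sq_key h1 (-f) n U hU (by
      rw [← AdjoinRoot.mk_eq_zero, map_add, ← he, map_one]; ring)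
    rwa [neg_neg] at this
  · refine ⟨AdjoinRoot.root _, ?_⟩
    have h2 : AdjoinRoot.mk (X ^ 2 - C (-f)) (X ^ 2 - C (-f)) = 0 := AdjoinRoot.mk_self
    rw [map_sub, map_pow, AdjoinRoot.mk_X, AdjoinRoot.mk_C] at h2
    rw [← map_neg (AdjoinRoot.of _)]
    linear_combination -h2

lemma clear_sumsq {A : Type} [CommRing A] [IsDomain A] (x : FractionRing A) (hx : IsSumSq x) :
    ∃ (h s : A), h ≠ 0 ∧ IsSumSq s ∧ algebraMap A (FractionRing A) s = algebraMap A _ (h * h) * x := by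
  induction hx with
  | zero => exact ⟨1, 0, one_ne_zero, IsSumSq.zero, by simp⟩
  | sq_add a hs ih =>
    obtain ⟨h, s, h0, hs, he⟩ := ih
    obtain ⟨n, d, hd, rfl⟩ := IsFractionRing.div_surjective (A := A) a
    have hd0 : d ≠ 0 := nonZeroDivisors.ne_zero hd
    have hd1 : algebraMap A (FractionRing A) d ≠ 0 := by simpa using hd0
    refine ⟨h * d, (n * h) * (n * h) + (d * d) * s, mul_ne_zero h0 hd0,
      (IsSumSq.mul_self _).add ((IsSumSq.mul_self _).mul hs), ?_⟩
    simp only [map_add, map_mul] at he ⊢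
    rw [he]; field_simp

theorem H17 (f : ℝ[X][X]) (hpsd : ∀ x y : ℝ, 0 ≤ (f.map (evalRingHom x)).eval y) :
    ∃ h : ℝ[X][X], h ≠ 0 ∧ IsSumSq (h * h * f) := by
  induction hn : f.natDegree using Nat.strong_induction_on generalizing f with
  | _ n ih =>
  subst hn
  by_cases hf0 : f = 0
  · exact ⟨1, one_ne_zero, by rw [hf0, mul_zero]; exact IsSumSq.zero⟩
  have hinj : Function.Injective (algebraMap ℝ[X] (FractionRing ℝ[X])) := IsFractionRing.injective _ _
  haveI : CharZero (FractionRing ℝ[X]) := charZero_of_injective_algebraMap hinj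
  by_cases hsep : IsCoprime (f.map (algebraMap ℝ[X] (FractionRing ℝ[X]))) (derivative (f.map (algebraMap ℝ[X] (FractionRing ℝ[X]))))
  · have hinj2 : Function.Injective (algebraMap ℝ[X][X] (FractionRing ℝ[X][X])) := IsFractionRing.injective _ _
    haveI : CharZero (FractionRing ℝ[X][X]) := charZero_of_injective_algebraMap hinj2
    by_cases hs : IsSumSq (algebraMap ℝ[X][X] (FractionRing ℝ[X][X]) f)
    · obtain ⟨h, s, h0, hs, he⟩ := clear_sumsq _ hs
      refine ⟨h, h0, ?_⟩
      rw [← map_mul] at he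
      rwa [← hinj2 he]
    · exfalso
      obtain ⟨L', _, φ, h1, h2⟩ := exists_ext _ hs
      obtain ⟨R, _, _, _, ψ, hsq, hirr⟩ := exists_rcf h1
      set Φ : ℝ[X][X] →+* R := (ψ.comp φ).comp (algebraMap _ _) with hΦ
      have hΦi : Function.Injective Φ := (RingHom.injective (ψ.comp φ)).comp hinj2
      have h3 := transfer (R := R) ⟨hsq, hirr⟩ (Φ.comp C) (hΦi.comp C_injective) f hsep hpsd (Φ X)
      have h4 : (f.map (Φ.comp C)).eval (Φ X) = Φ f := by
        rw [eval_map, ← hom_eval₂, eval₂_C_X]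
      rw [h4] at h3
      obtain ⟨r, hr⟩ := h2
      have h5 : Φ f = - (ψ r * ψ r) := by
        rw [← map_mul, ← hr, map_neg, neg_neg]; rfl
      have h6 : Φ f ≠ 0 := (map_ne_zero_iff _ hΦi).2 hf0
      have h7 := mul_self_nonneg (ψ r)
      exact h6 (le_antisymm (by linarith) h3)
  · have hsf : ¬ Squarefree (f.map (algebraMap ℝ[X] (FractionRing ℝ[X]))) := by
      rw [← PerfectField.separable_iff_squarefree]; exact hsep
    rw [Squarefree] at hsf
    push Not at hsf
    obtain ⟨p, ⟨r, hr⟩, hpu⟩ := hsf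
    obtain ⟨c1, p1, hc1, hp1⟩ := clearP p
    obtain ⟨c2, r1, hc2, hr1⟩ := clearP r
    set c := c1 * c1 * c2
    have hc : c ≠ 0 := mul_ne_zero (mul_ne_zero hc1 hc1) hc2
    have hcf : C c * f = p1 * p1 * r1 := by
      apply map_injective _ hinj
      simp only [Polynomial.map_mul, map_C, hp1, hr1, hr, c, map_mul]; ring
    have hne : C c * f ≠ 0 := mul_ne_zero (by simpa using hc) hf0
    have hp10 : p1 ≠ 0 := by rintro rfl; simp [hc, hf0] at hcf
    have hr10 : r1 ≠ 0 := by rintro rfl; simp [hc, hf0] at hcf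
    have hpd : p1.natDegree ≠ 0 := by
      intro h0
      have h1 : (p1.map (algebraMap ℝ[X] (FractionRing ℝ[X]))).natDegree = 0 := by
        rw [natDegree_map_eq_of_injective hinj, h0]
      have hp0 : p ≠ 0 := by
        rintro rfl
        rw [mul_zero, zero_mul, Polynomial.map_eq_zero_iff hinj] at hr
        exact hf0 hr
      rw [hp1, natDegree_C_mul ((map_ne_zero_iff _ hinj).2 hc1)] at h1
      apply hpu
      rw [eq_C_of_natDegree_eq_zero h1] at hp0 ⊢
      exact isUnit_C.2 (IsUnit.mk0 _ (by simpa using hp0))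
    have hdeg : (C c * r1).natDegree < f.natDegree := by
      have h1 := congrArg natDegree hcf
      rw [natDegree_C_mul hc, natDegree_mul (mul_ne_zero hp10 hp10) hr10, natDegree_mul hp10 hp10] at h1
      rw [natDegree_C_mul hc]; omega
    have hid : (C c * C c) * f = (p1 * p1) * (C c * r1) := by linear_combination C c * hcf
    obtain ⟨h, h0, hS⟩ := ih _ hdeg (C c * r1) (nonneg_of_dense2 _ p1 hp10 (by
      intro x y hxy
      have h1 := congrArg (fun q => (q.map (evalRingHom x)).eval y) hid
      simp only [Polynomial.map_mul, eval_mul] at h1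
      have h2 := hpsd x y
      have h3 := mul_self_nonneg ((map (evalRingHom x) (C c)).eval y)
      have h4 := mul_self_pos.2 hxy
      rw [← mul_nonneg_iff_of_pos_left h4, Polynomial.map_mul, eval_mul, ← h1]
      exact mul_nonneg h3 h2)) rfl
    refine ⟨C c * h, mul_ne_zero (by simpa using hc) h0, ?_⟩
    have : C c * h * (C c * h) * f = (p1 * p1) * (h * h * (C c * r1)) := by linear_combination h * h * hid
    rw [this]
    exact (IsSumSq.mul_self _).mul hS
end Polynomial

lemma psd_two (a c : ℝ) (r : ℂ) (h : ∀ (z : ℂ) (μ : ℝ), 0 ≤ a * Complex.normSq z + 2 * μ * (star z * r).re + μ ^ 2 * c) :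
    0 ≤ a ∧ Complex.normSq r ≤ a * c := by
  have ha : 0 ≤ a := by simpa using h 1 0
  refine ⟨ha, ?_⟩
  have hz : ∀ l : ℝ, (star (-(l:ℂ) * r) * r).re = - l * Complex.normSq r := by
    intro l
    simp [Complex.normSq_apply]; ring
  have hn : ∀ l : ℝ, Complex.normSq (-(l:ℂ) * r) = l ^ 2 * Complex.normSq r := by
    intro l
    simp [Complex.normSq_apply]; ring
  rcases ha.eq_or_lt with h0 | h0
  · subst h0
    have hr := Complex.normSq_nonneg r
    by_contra hcon
    rw [zero_mul] at hcon
    push Not at hcon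
    have h1 := h (-((|c| + 1) / Complex.normSq r : ℝ) * r) 1
    rw [hz] at h1
    have h2 : (|c| + 1) / Complex.normSq r * Complex.normSq r = |c| + 1 := by field_simp
    have h3 := le_abs_self c
    nlinarith [abs_nonneg c]
  · have h1 := h (-((1:ℝ):ℂ) * r) a
    rw [hz, hn] at h1
    by_contra hcon
    push Not at hcon
    nlinarith [mul_pos h0 (sub_pos.2 hcon)]

section ldl
variable {A T : Type} [CommRing A] [StarRing A] 

/-- Positive semidefinite (hermitian) matrices over a ring with a family of evaluations. -/
def PSDm (ev : T → A →+* ℂ) {n : Type} [Fintype n] (F : Matrix n n A) : Prop :=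
  F.conjTranspose = F ∧ ∀ t (v : n → ℂ), 0 ≤ (∑ i, ∑ j, star (v i) * ev t (F i j) * v j).re

lemma PSDm.herm {ev : T → A →+* ℂ} {n : Type} [Fintype n] {F : Matrix n n A} (h : PSDm ev F) (i j) :
    star (F i j) = F j i := by
  have := congrFun (congrFun h.1 j) i
  simpa [Matrix.conjTranspose_apply] using this

lemma PSDm.key {ev : T → A →+* ℂ} (hev : ∀ t a, ev t (star a) = star (ev t a)) {n : ℕ}
    {F : Matrix (Fin (n+1)) (Fin (n+1)) A} (h : PSDm ev F) (t : T) (v : Fin n → ℂ) :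
    0 ≤ (ev t (F 0 0)).re ∧ Complex.normSq (∑ j, ev t (F 0 j.succ) * v j) ≤
      (ev t (F 0 0)).re * (∑ i, ∑ j, star (v i) * ev t (F i.succ j.succ) * v j).re := by
  apply psd_two
  intro z μ
  have h1 := h.2 t (Fin.cons z fun j => (μ : ℂ) * v j)
  have him : (ev t (F 0 0)).im = 0 := by
    have := hev t (F 0 0)
    rw [h.herm] at this
    exact Complex.conj_eq_iff_im.1 this.symm
  have e1 : (∑ i, ∑ j, star ((Fin.cons z fun j => (μ : ℂ) * v j : Fin (n+1) → ℂ) i) * ev t (F i j) * (Fin.cons z fun j => (μ : ℂ) * v j : Fin (n+1) → ℂ) j)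
     = star z * ev t (F 0 0) * z + μ * (star z * ∑ j, ev t (F 0 j.succ) * v j) +
       μ * star (star z * ∑ j, ev t (F 0 j.succ) * v j) + μ ^ 2 * ∑ i, ∑ j, star (v i) * ev t (F i.succ j.succ) * v j := by
    rw [Fin.sum_univ_succ, Fin.sum_univ_succ]
    simp only [Fin.cons_zero, Fin.cons_succ, Fin.sum_univ_succ]
    rw [Finset.sum_add_distrib, star_mul', star_star, star_sum]
    simp only [Finset.mul_sum, star_mul', ← hev, h.herm]
    have : ∀ x : ℝ, star (x : ℂ) = x := Complex.conj_ofReal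
    simp only [this]
    rw [add_assoc (_ + _), add_assoc, add_assoc]
    congr 2
    · exact Finset.sum_congr rfl fun j _ => by ring
    congr 1
    · exact Finset.sum_congr rfl fun j _ => by ring
    · exact Finset.sum_congr rfl fun j _ => Finset.sum_congr rfl fun i _ => by ring
  rw [e1] at h1
  have e2 : (star z * ev t (F 0 0) * z).re = (ev t (F 0 0)).re * Complex.normSq z := by
    simp [Complex.normSq_apply, him]; ring
  have e3 : ∀ w : ℂ, ((μ:ℂ) * star w).re = μ * w.re := by intro w; simp
  have e4 : ∀ w : ℂ, ((μ:ℂ)^2 * w).re = μ ^ 2 * w.re := by intro w; rw [← Complex.ofReal_pow, Complex.re_ofReal_mul]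
  rw [Complex.add_re, Complex.add_re, Complex.add_re, e2, e3, e4, Complex.re_ofReal_mul] at h1
  linarith

theorem ldl [IsDomain A] (ev : T → A →+* ℂ) (hev : ∀ t a, ev t (star a) = star (ev t a))
    (hinj : ∀ a, (∀ t, ev t a = 0) → a = 0) (n : ℕ) (F : Matrix (Fin n) (Fin n) A) (hF : PSDm ev F) :
    ∃ (h : A) (U : Matrix (Fin n) (Fin n) A) (d : Fin n → A), h ≠ 0 ∧
      (∀ i, star (d i) = d i ∧ ∀ t, 0 ≤ (ev t (d i)).re) ∧
      (star h * h) • F = U.conjTranspose * Matrix.diagonal d * U := by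
  induction n with
  | zero => exact ⟨1, 0, 0, one_ne_zero, fun i => i.elim0, by ext i; exact i.elim0⟩
  | succ n ih =>
    have hentry : ∀ (N : ℕ) (U : Matrix (Fin N) (Fin N) A) (d : Fin N → A) (i j : Fin N), (U.conjTranspose * Matrix.diagonal d * U) i j = ∑ l, star (U l i) * d l * U l j := by
      intro N U d i j
      rw [Matrix.mul_apply]
      simp [Matrix.mul_diagonal, Matrix.conjTranspose_apply]
    have him : ∀ t, ((ev t (F 0 0)).re : ℂ) = ev t (F 0 0) := by
      intro t
      have := hev t (F 0 0)
      rw [hF.herm] at this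
      exact Complex.conj_eq_iff_re.1 this.symm
    by_cases h00 : F 0 0 = 0
    · have h0j : ∀ j, F 0 (Fin.succ j) = 0 := by
        intro j
        apply hinj
        intro t
        have := (hF.key hev t (Pi.single j 1)).2
        rw [h00, map_zero, Complex.zero_re, zero_mul] at this
        simpa [Pi.single_apply] using le_antisymm this (Complex.normSq_nonneg _)
      have hj0 : ∀ j, F (Fin.succ j) 0 = 0 := by
        intro j; rw [← hF.herm, h0j, star_zero]
      obtain ⟨h, U, d, hh, hd, he⟩ := ih (F.submatrix Fin.succ Fin.succ) ⟨by
        ext i j; simp [Matrix.conjTranspose_apply, hF.herm], by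
        intro t v
        have := hF.2 t (Fin.cons 0 v)
        simpa [Fin.sum_univ_succ] using this⟩
      refine ⟨h, Matrix.of (Fin.cons 0 fun i => Fin.cons 0 (U i)), Fin.cons 0 d, hh, ?_, ?_⟩
      · intro i
        refine Fin.cases ⟨by simp, by simp⟩ (fun i => by simpa using hd i) i
      · ext i j
        rw [hentry, Fin.sum_univ_succ]
        simp only [Matrix.smul_apply, smul_eq_mul, Matrix.of_apply, Fin.cons_zero, Fin.cons_succ, Pi.zero_apply]
        refine Fin.cases ?_ (fun i => ?_) i <;> refine Fin.cases ?_ (fun j => ?_) j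
        · simp [h00]
        · simp [h0j]
        · simp [hj0]
        · have := congrFun (congrFun he i) j
          rw [hentry] at this
          simpa using this
    · set S : Matrix (Fin n) (Fin n) A := Matrix.of fun i j => F 0 0 * F i.succ j.succ - F i.succ 0 * F 0 j.succ with hS
      obtain ⟨h, U, d, hh, hd, he⟩ := ih S ⟨by
        ext i j; simp [S, Matrix.conjTranspose_apply, hF.herm]; ring, by
        intro t v
        have h1 := (hF.key hev t v).2
        have e1 : ∑ i, ∑ j, star (v i) * ev t (S i j) * v j = ev t (F 0 0) * (∑ i, ∑ j, star (v i) * ev t (F i.succ j.succ) * v j)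
            - star (∑ j, ev t (F 0 j.succ) * v j) * (∑ j, ev t (F 0 j.succ) * v j) := by
          rw [star_sum, Finset.sum_mul, Finset.mul_sum, ← Finset.sum_sub_distrib]
          refine Finset.sum_congr rfl fun i _ => ?_
          rw [Finset.mul_sum, Finset.mul_sum, ← Finset.sum_sub_distrib]
          refine Finset.sum_congr rfl fun j _ => ?_
          simp only [S, Matrix.of_apply, map_sub, map_mul, star_mul', ← hev, hF.herm]; ring
        rw [e1, Complex.sub_re, ← him, Complex.re_ofReal_mul]
        have e2 : ∀ w : ℂ, (star w * w).re = Complex.normSq w := by intro w; simp [Complex.normSq_apply]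
        rw [e2]; linarith⟩
      refine ⟨h * F 0 0, Matrix.of (Fin.cons (fun j => h * F 0 j) fun i => Fin.cons 0 (U i)), Fin.cons (F 0 0) (fun i => F 0 0 * d i), mul_ne_zero hh h00, ?_, ?_⟩
      · intro i
        refine Fin.cases ⟨by simp [hF.herm], fun t => ?_⟩ (fun i => ⟨?_, fun t => ?_⟩) i
        · simpa using (hF.key hev t 0).1
        · simp [hF.herm, (hd i).1]
        · simp only [Fin.cons_succ, map_mul]
          rw [← him, Complex.re_ofReal_mul]
          exact mul_nonneg (hF.key hev t 0).1 ((hd i).2 t)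
      · ext i j
        rw [hentry, Fin.sum_univ_succ]
        simp only [Matrix.smul_apply, smul_eq_mul, Matrix.of_apply, Fin.cons_zero, Fin.cons_succ, star_mul', hF.herm]
        refine Fin.cases ?_ (fun i => ?_) i <;> refine Fin.cases ?_ (fun j => ?_) j
        · simp; ring
        · simp; ring
        · simp; ring
        · have := congrFun (congrFun he i) j
          rw [hentry] at this
          simp only [Matrix.smul_apply, smul_eq_mul, S, Matrix.of_apply] at this
          simp only [Fin.cons_succ]
          have e3 : ∑ x, star (U x i) * (F 0 0 * d x) * U x j = F 0 0 * ∑ x, star (U x i) * d x * U x j := by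
            rw [Finset.mul_sum]; exact Finset.sum_congr rfl fun x _ => by ring
          rw [e3, ← this]; ring
end ldl

namespace Polynomial
open Polynomial

lemma star_real (x : ℝ) : star (x : ℂ) = x := Complex.conj_ofReal x

lemma re_nonneg_of_dense (p : ℂ[X]) (s : Set ℝ) (hs : s.Finite) (h : ∀ x ∉ s, 0 ≤ (p.eval (x:ℂ)).re) (x : ℝ) :
    0 ≤ (p.eval (x:ℂ)).re := by
  have hd : Dense sᶜ := hs.countable.dense_compl ℝ
  have hcl : IsClosed {x : ℝ | 0 ≤ (p.eval (x:ℂ)).re} :=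
    isClosed_le continuous_const (Complex.continuous_re.comp (p.continuous.comp Complex.continuous_ofReal))
  exact (hcl.closure_subset_iff.2 fun x hx => h x hx) (hd x)

/-- Scalar Fejer-Riesz, with the zeros of the factor outside of the open upper half plane. -/
theorem fr_scalar (f : ℂ[X]) (hf0 : f ≠ 0) (hst : star f = f) (hpos : ∀ x : ℝ, 0 ≤ (f.eval (x:ℂ)).re) :
    ∃ a : ℂ[X], star a * a = f ∧ ∀ z : ℂ, 0 < z.im → a.eval z ≠ 0 := by
  induction hn : f.natDegree using Nat.strong_induction_on generalizing f with
  | _ n ih =>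
  subst hn
  by_cases hd : f.natDegree = 0
  · obtain ⟨c, hc⟩ : ∃ c, f = C c := ⟨_, eq_C_of_natDegree_eq_zero hd⟩
    subst hc
    rw [star_poly_C, C_inj] at hst
    have hre : (c.re : ℂ) = c := Complex.conj_eq_iff_re.1 hst
    have hc0 : c ≠ 0 := by simpa using hf0
    have h0 := hpos 0
    rw [eval_C] at h0
    refine ⟨C (√c.re : ℂ), ?_, fun z _ => ?_⟩
    · rw [star_poly_C, star_real, ← C_mul, ← Complex.ofReal_mul, Real.mul_self_sqrt h0, hre]
    · rw [eval_C]
      intro h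
      rw [Complex.ofReal_eq_zero, Real.sqrt_eq_zero h0] at h
      rw [h] at hre; exact hc0 (by simpa using hre.symm)
  · have hev : ∀ z, f.eval (star z) = star (f.eval z) := by
      intro z
      have := eval_star_poly f (star z)
      rwa [hst, star_star] at this
    obtain ⟨a, ha, haim⟩ : ∃ a, f.IsRoot a ∧ a.im ≤ 0 := by
      obtain ⟨a, ha⟩ := Complex.exists_root (f := f) (by rw [← natDegree_pos_iff_degree_pos]; omega)
      by_cases h : a.im ≤ 0
      · exact ⟨a, ha, h⟩
      · refine ⟨star a, ?_, ?_⟩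
        · rw [IsRoot.def, hev, ha.eq_zero, star_zero]
        · have : (star a).im = - a.im := Complex.conj_im a
          rw [this]; linarith
    obtain ⟨f1, hf1⟩ : ∃ f1, f = ((X - C (star a)) * (X - C a)) * f1 := by
      by_cases hreal : star a = a
      · have hare : (a.re : ℂ) = a := Complex.conj_eq_iff_re.1 hreal
        have h2 : f.derivative.IsRoot a := by
          have hd1 := (f.hasDerivAt ((a.re : ℝ):ℂ)).real_of_complex
          have hmin : IsLocalMin (fun x : ℝ => (f.eval (x:ℂ)).re) a.re := by
            refine Filter.Eventually.of_forall fun z => ?_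
            show (f.eval (a.re:ℂ)).re ≤ (f.eval (z:ℂ)).re
            rw [hare, ha.eq_zero]; exact hpos z
          have hd2 := hmin.hasDerivAt_eq_zero hd1
          rw [hare] at hd2
          have him : star (f.derivative.eval a) = f.derivative.eval a := by
            have h3 : star (derivative f) = derivative f := by
              ext i
              rw [coeff_star_poly, coeff_derivative, star_mul', ← coeff_star_poly, hst]
              simp
            have := eval_star_poly (derivative f) (star a)
            rw [h3, star_star, hreal] at this
            exact this.symm
          have him' := Complex.conj_eq_iff_re.1 him
          rw [IsRoot.def, ← him', hd2]; rfl
        have h3 : 1 < f.rootMultiplicity a := (one_lt_rootMultiplicity_iff_isRoot hf0).2 ⟨ha, h2⟩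
        rw [hreal, ← sq]
        exact (pow_dvd_pow _ h3).trans (pow_rootMultiplicity_dvd f a)
      · obtain ⟨g, hg⟩ := dvd_iff_isRoot.2 ha
        have h1 : g.IsRoot (star a) := by
          have : f.eval (star a) = 0 := by rw [hev, ha.eq_zero, star_zero]
          rw [hg, eval_mul, mul_eq_zero] at this
          rcases this with h | h
          · simp only [eval_sub, eval_X, eval_C] at h
            exact absurd (sub_eq_zero.1 h) hreal
          · exact h
        obtain ⟨g1, hg1⟩ := dvd_iff_isRoot.2 h1
        exact ⟨g1, by rw [hg, hg1]; ring⟩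
    have hm0 : (X - C (star a)) * (X - C a) ≠ 0 := mul_ne_zero (X_sub_C_ne_zero _) (X_sub_C_ne_zero _)
    have hf10 : f1 ≠ 0 := by rintro rfl; exact hf0 (by rw [hf1, mul_zero])
    have hdeg : f1.natDegree < f.natDegree := by
      have h1 := congrArg natDegree hf1
      rw [natDegree_mul hm0 hf10, natDegree_mul (X_sub_C_ne_zero _) (X_sub_C_ne_zero _), natDegree_X_sub_C, natDegree_X_sub_C] at h1
      omega
    have hms : star ((X - C (star a)) * (X - C a)) = (X - C (star a)) * (X - C a) := by
      rw [star_mul', star_sub, star_sub, star_poly_X, star_poly_C, star_poly_C, star_star]; ring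
    have hst1 : star f1 = f1 := by
      have h1 := hst
      rw [hf1, star_mul', hms] at h1
      exact mul_left_cancel₀ hm0 h1
    obtain ⟨b, hb, hbz⟩ := ih _ hdeg f1 hf10 hst1 (re_nonneg_of_dense f1 {a.re} (Set.finite_singleton _) (by
      intro x hx
      have h1 := hpos x
      have h2 : ((x:ℂ) - star a) * (x - a) = (Complex.normSq (x - a) : ℂ) := by
        rw [Complex.normSq_eq_conj_mul_self, map_sub, Complex.conj_ofReal]; rfl
      rw [hf1, eval_mul, eval_mul, eval_sub, eval_sub, eval_X, eval_C, eval_C, h2, Complex.re_ofReal_mul] at h1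
      have h3 : 0 < Complex.normSq (x - a) := by
        rw [Complex.normSq_pos]
        intro h
        rw [sub_eq_zero] at h
        apply hx
        rw [← h]; simp
      exact (mul_nonneg_iff_of_pos_left h3).1 h1)) rfl
    refine ⟨(X - C a) * b, ?_, ?_⟩
    · rw [star_mul', star_sub, star_poly_X, star_poly_C, hf1, ← hb]; ring
    · intro z hz
      rw [eval_mul]
      refine mul_ne_zero ?_ (hbz z hz)
      rw [eval_sub, eval_X, eval_C]
      intro h
      rw [sub_eq_zero] at h
      rw [h] at hz; linarith

/-- evaluation of a polynomial in `x` (inner) and `y` (outer) at real points. -/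
def ev2 (t : ℝ × ℝ) : ℂ[X][X] →+* ℂ := evalEvalRingHom (t.1 : ℂ) (t.2 : ℂ)
def ev1 (t : ℝ) : ℂ[X] →+* ℂ := evalRingHom (t : ℂ)

lemma evalEval_star (f : ℂ[X][X]) (x y : ℂ) : (star f).evalEval x y = star (f.evalEval (star x) (star y)) := by
  rw [evalEval, evalEval, eval_star_poly, eval_star_poly, star_poly_C]

lemma ev2_star (t) (f : ℂ[X][X]) : ev2 t (star f) = star (ev2 t f) := by
  have := evalEval_star f t.1 t.2
  rwa [star_real, star_real] at this

lemma ev1_star (t) (f : ℂ[X]) : ev1 t (star f) = star (ev1 t f) := by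
  have := eval_star_poly f (t : ℂ)
  rwa [star_real] at this

lemma eq_zero_of_real (p : ℂ[X]) (h : ∀ x : ℝ, p.eval (x:ℂ) = 0) : p = 0 := by
  apply eq_zero_of_infinite_isRoot
  refine Set.Infinite.mono (s := Set.range (fun x : ℝ => (x:ℂ))) ?_ (Set.infinite_range_of_injective Complex.ofReal_injective)
  rintro _ ⟨x, rfl⟩
  exact h x

lemma ev1_inj (f : ℂ[X]) (h : ∀ t, ev1 t f = 0) : f = 0 := eq_zero_of_real f h

lemma ev2_inj (f : ℂ[X][X]) (h : ∀ t, ev2 t f = 0) : f = 0 := by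
  have h1 : ∀ x : ℝ, f.map (evalRingHom (x:ℂ)) = 0 := by
    intro x
    apply eq_zero_of_real
    intro y
    rw [map_evalRingHom_eval]
    exact h (x, y)
  ext1 i
  rw [coeff_zero]
  apply eq_zero_of_real
  intro x
  have := congrArg (fun q => coeff q i) (h1 x)
  simpa using this

lemma sumsq_fin {A : Type} [CommRing A] (x : A) (hx : IsSumSq x) : ∃ (n : ℕ) (u : Fin n → A), x = ∑ i, u i * u i := by
  induction hx with
  | zero => exact ⟨0, 0, by simp⟩
  | sq_add a hs ih =>
    obtain ⟨n, u, rfl⟩ := ih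
    exact ⟨n + 1, Fin.cons a u, by simp [Fin.sum_univ_succ]⟩

theorem sos_scalar2 (f : ℂ[X][X]) (hst : star f = f) (hpos : ∀ t, 0 ≤ (ev2 t f).re) :
    ∃ (h : ℂ[X][X]) (N : ℕ) (u : Fin N → ℂ[X][X]), h ≠ 0 ∧ star h * h * f = ∑ i, star (u i) * u i := by
  set ρ : ℝ[X][X] →+* ℂ[X][X] := mapRingHom (mapRingHom Complex.ofRealHom) with hρ
  have hρi : Function.Injective ρ := map_injective _ (map_injective _ Complex.ofReal_injective)
  have hρs : ∀ a, star (ρ a) = ρ a := by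
    intro a
    ext i j
    simp [coeff_star_poly, hρ, coeff_map]
  obtain ⟨f', hf'⟩ : ∃ f', ρ f' = f := by
    have : f ∈ ρ.range := by
      rw [mem_map_range]
      intro i
      rw [mem_map_range]
      intro j
      have h1 := congrArg (fun q => coeff (coeff q i) j) hst
      simp only [coeff_star_poly] at h1
      exact ⟨((f.coeff i).coeff j).re, Complex.conj_eq_iff_re.1 h1⟩
    exact this
  subst hf'
  obtain ⟨h, h0, hs⟩ := H17 f' (by
    intro x y
    have h1 := hpos (x, y)
    have h2 : ev2 (x, y) (ρ f') = (((f'.map (evalRingHom x)).eval y : ℝ) : ℂ) := by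
      rw [map_evalRingHom_eval]
      have e1 : (ev2 (x, y)).comp ρ = Complex.ofRealHom.comp (evalEvalRingHom x y) := by
        ext <;> simp [ev2, ρ]
      exact RingHom.congr_fun e1 f'
    rw [h2, Complex.ofReal_re] at h1
    exact h1)
  obtain ⟨N, u, hu⟩ := sumsq_fin _ hs
  refine ⟨ρ h, N, fun i => ρ (u i), (map_ne_zero_iff _ hρi).2 h0, ?_⟩
  simp only [hρs, ← map_mul, ← map_sum]
  rw [hu]
end Polynomial

namespace Polynomial
open Polynomial

theorem sos_abs {A : Type} [CommRing A] [StarRing A] [IsDomain A] (n : ℕ) (F : Matrix (Fin n) (Fin n) A)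
    (h : A) (U : Matrix (Fin n) (Fin n) A) (d : Fin n → A) (hh : h ≠ 0)
    (he : (star h * h) • F = U.conjTranspose * Matrix.diagonal d * U)
    (g : Fin n → A) (N : Fin n → ℕ) (u : ∀ i, Fin (N i) → A) (hg0 : ∀ i, g i ≠ 0)
    (hg : ∀ i, star (g i) * g i * d i = ∑ l, star (u i l) * u i l) :
    ∃ (h : A) (Q : Matrix (Σ i : Fin n, Fin (N i)) (Fin n) A), h ≠ 0 ∧
      Q.conjTranspose * Q = (star h * h) • F := by
  obtain ⟨G, hG⟩ : ∃ G, G = ∏ i, g i := ⟨_, rfl⟩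
  have hG0 : G ≠ 0 := hG ▸ Finset.prod_ne_zero_iff.2 fun i _ => hg0 i
  have hdv : ∀ i, ∃ c, G = g i * c := fun i => hG ▸ Finset.dvd_prod_of_mem g (Finset.mem_univ i)
  choose c hc using hdv
  refine ⟨h * G, Matrix.of fun l j => c l.1 * u l.1 l.2 * U l.1 j, mul_ne_zero hh hG0, ?_⟩
  have e1 : (star (h * G) * (h * G)) • F = (star G * G) • ((star h * h) • F) := by
    rw [smul_smul, star_mul']; congr 1; ring
  rw [e1, he]
  ext i j
  rw [Matrix.mul_apply, Matrix.smul_apply, Matrix.mul_apply]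
  simp only [Matrix.mul_diagonal, Matrix.conjTranspose_apply, Matrix.of_apply, smul_eq_mul, Finset.mul_sum]
  rw [Fintype.sum_sigma]
  refine Finset.sum_congr rfl fun l _ => ?_
  have e2 : ∀ x, star (c l * u l x * U l i) * (c l * u l x * U l j) = (star (c l) * c l * star (U l i) * U l j) * (star (u l x) * u l x) := by
    intro x; simp only [star_mul']; ring
  simp only [e2]
  rw [← Finset.mul_sum, ← hg]
  have e3 : star G * G = (star (c l) * c l) * (star (g l) * g l) := by
    rw [hc l, star_mul']; ring
  rw [e3]; ring

theorem sos_mat2 (n : ℕ) (F : Matrix (Fin n) (Fin n) ℂ[X][X]) (hF : PSDm ev2 F) :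
    ∃ (h : ℂ[X][X]) (κ : Type) (_ : Fintype κ) (_ : DecidableEq κ) (Q : Matrix κ (Fin n) ℂ[X][X]), h ≠ 0 ∧
      Q.conjTranspose * Q = (star h * h) • F := by
  obtain ⟨h, U, d, hh, hd, he⟩ := ldl ev2 ev2_star ev2_inj n F hF
  choose g N u hg0 hg using fun i => sos_scalar2 (d i) (hd i).1 (hd i).2
  obtain ⟨h', Q, h0, hQ⟩ := sos_abs n F h U d hh he g N u hg0 hg
  exact ⟨h', _, inferInstance, inferInstance, Q, h0, hQ⟩

lemma map_star_alg (f : ℂ[X][X]) : (star f).map (algebraMap ℂ[X] (FractionRing ℂ[X])) = star (f.map (algebraMap ℂ[X] (FractionRing ℂ[X]))) := by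
  ext i
  rw [coeff_map, coeff_star_poly, coeff_star_poly, coeff_map, star_frac_algebraMap]

theorem sos2 (n : ℕ) (F : Matrix (Fin n) (Fin n) ℂ[X][X]) (hF : PSDm ev2 F) :
    ∃ (c : ℂ[X]) (κ : Type) (_ : Fintype κ) (_ : DecidableEq κ) (Q : Matrix κ (Fin n) ℂ[X][X]),
      (∀ z : ℂ, 0 < z.im → c.eval z ≠ 0) ∧
      Q.conjTranspose * Q = (C (star c * c)) • F := by
  obtain ⟨h, κ, _, _, Q, h0, hQ⟩ := sos_mat2 n F hF
  set al := algebraMap ℂ[X] (FractionRing ℂ[X]) with hal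
  have hinj : Function.Injective al := IsFractionRing.injective _ _
  have hmapc : ∀ (κ : Type) [Fintype κ] (Q : Matrix κ (Fin n) ℂ[X][X]),
      (Q.map (mapRingHom al)).conjTranspose = Q.conjTranspose.map (mapRingHom al) := by
    intro κ _ Q
    ext1 i j
    simp only [Matrix.conjTranspose_apply, Matrix.map_apply, coe_mapRingHom]
    exact (map_star_alg _).symm
  obtain ⟨Q1, hQ1⟩ := CP aniso_complex.poly.frac (Q.map (mapRingHom al)) (h.map al)
    ((Polynomial.map_ne_zero_iff hinj).2 h0) (F.map (mapRingHom al)) (by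
      rw [hmapc, ← Matrix.map_mul, hQ, ← map_star_alg, ← Polynomial.map_mul]
      ext1 i j
      simp only [Matrix.smul_apply, Matrix.map_apply, smul_eq_mul, coe_mapRingHom, Polynomial.map_mul]
      rfl)
  choose d Q2 hd hQ2' using fun i j => clearP (Q1 i j)
  have hQ2 : ∀ i j, (Q2 i j).map al = C (al (d i j)) * Q1 i j := hQ2'
  have hals : ∀ x, star (al x) = al (star x) := fun x => star_frac_algebraMap x
  set D := ∏ i, ∏ j, d i j with hD
  have hD0 : D ≠ 0 := Finset.prod_ne_zero_iff.2 fun i _ => Finset.prod_ne_zero_iff.2 fun j _ => hd i j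
  have hdv : ∀ i j, ∃ e, D = d i j * e := fun i j =>
    (Finset.dvd_prod_of_mem (fun j => d i j) (Finset.mem_univ j)).trans (Finset.dvd_prod_of_mem (fun i => ∏ j, d i j) (Finset.mem_univ i))
  choose e he using hdv
  set Q3 : Matrix κ (Fin n) ℂ[X][X] := Matrix.of fun i j => C (e i j) * Q2 i j with hQ3
  have hQ3m : Q3.map (mapRingHom al) = (C (al D)) • Q1 := by
    ext1 i j
    simp only [Q3, Matrix.map_apply, Matrix.of_apply, Polynomial.map_mul, coe_mapRingHom, map_C, hQ2, Matrix.smul_apply, smul_eq_mul]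
    rw [he i j, map_mul, C_mul]; ring
  have h1 : Q3.conjTranspose * Q3 = (C (star D * D)) • F := by
    have : (Q3.conjTranspose * Q3).map (mapRingHom al) = ((C (star D * D)) • F).map (mapRingHom al) := by
      rw [Matrix.map_mul, ← hmapc, hQ3m, Matrix.conjTranspose_smul, Matrix.smul_mul, Matrix.mul_smul, hQ1, smul_smul]
      ext1 i j
      simp only [Matrix.map_apply, Matrix.smul_apply, smul_eq_mul, Polynomial.map_mul, C_mul, star_poly_C, coe_mapRingHom, map_C, hals]
    exact Matrix.map_injective (map_injective _ hinj) this
  obtain ⟨c, hc, hcz⟩ := fr_scalar (star D * D) (mul_ne_zero (star_ne_zero.2 hD0) hD0) (by rw [star_mul', star_star, mul_comm]) (by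
    intro x
    have e1 : (star D * D).eval (x:ℂ) = star (D.eval (x:ℂ)) * D.eval (x:ℂ) := by
      rw [eval_mul, eval_star_poly, star_real]
    rw [e1]
    have e2 : ∀ w : ℂ, (star w * w).re = Complex.normSq w := by intro w; simp [Complex.normSq_apply]
    rw [e2]; exact Complex.normSq_nonneg _)
  exact ⟨c, κ, inferInstance, inferInstance, Q3, hcz, by rw [hc, h1]⟩

end Polynomial

namespace Polynomial
open Polynomial

section flip
variable {m n : Type} [Fintype m] [Fintype n]

def evM (A : Matrix m n ℂ[X]) (x : ℂ) : Matrix m n ℂ := A.map (eval x)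
def Ker (A : Matrix m n ℂ[X]) (w x : ℂ) : Matrix n n ℂ := (evM A w).conjTranspose * evM A x

lemma evM_mul {l : Type} [Fintype l] (A : Matrix m n ℂ[X]) (B : Matrix n l ℂ[X]) (x : ℂ) : evM (A * B) x = evM A x * evM B x := by
  have := Matrix.map_mul (L := A) (M := B) (f := evalRingHom x)
  exact this

lemma Ker_mul {l : Type} [Fintype l] (A : Matrix m n ℂ[X]) (B : Matrix n l ℂ[X]) (w x : ℂ) :
    Ker (A * B) w x = (evM B w).conjTranspose * Ker A w x * evM B x := by
  simp only [Ker, evM_mul, Matrix.conjTranspose_mul, Matrix.mul_assoc]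

lemma evM_conjTranspose (A : Matrix m n ℂ[X]) (x : ℂ) : evM A.conjTranspose x = (evM A (star x)).conjTranspose := by
  ext i j
  simp only [evM, Matrix.map_apply, Matrix.conjTranspose_apply, eval_star_poly]

lemma evM_ext {A B : Matrix m n ℂ[X]} (h : ∀ x, evM A x = evM B x) : A = B := by
  ext1 i j
  apply Polynomial.funext
  intro x
  exact congrFun (congrFun (h x) i) j

lemma Ker_star (A : Matrix m n ℂ[X]) (x : ℂ) : Ker A (star x) x = evM (A.conjTranspose * A) x := by
  rw [evM_mul, evM_conjTranspose, Ker]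

lemma gram_eq_iff {m' : Type} [Fintype m'] {A : Matrix m n ℂ[X]} {B : Matrix m' n ℂ[X]} :
    A.conjTranspose * A = B.conjTranspose * B ↔ ∀ x, Ker A (star x) x = Ker B (star x) x := by
  simp only [Ker_star]
  exact ⟨fun h x => by rw [h], fun h => evM_ext h⟩

/-- Flipping a zero: `b* A = (X - a) η`, replace by `(X - ā) η`. -/
def flip (A : Matrix m n ℂ[X]) (b : m → ℂ) (a : ℂ) (η : n → ℂ[X]) : Matrix m n ℂ[X] :=
  Matrix.of fun i j => A i j + C ((a - star a) * b i) * η j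

lemma flip_Ker (A : Matrix m n ℂ[X]) (b : m → ℂ) (a : ℂ) (η : n → ℂ[X]) (hb : ∑ i, star (b i) * b i = 1)
    (h : ∀ j, ∑ i, C (star (b i)) * A i j = (X - C a) * η j) (w x : ℂ) :
    Ker (flip A b a η) w x = Ker A w x -
      ((a - star a) * (x - star w)) • Matrix.vecMulVec (fun i => star ((η i).eval w)) (fun j => (η j).eval x) := by
  have h1 : ∀ x j, ∑ i, star (b i) * (A i j).eval x = (x - a) * (η j).eval x := by
    intro x j
    have := congrArg (eval x) (h j)
    simpa [eval_finset_sum] using this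
  ext i j
  have h2 : ∑ l, star ((A l i).eval w) * b l = star ((w - a) * (η i).eval w) := by
    rw [← h1, star_sum]
    exact Finset.sum_congr rfl fun l _ => by rw [star_mul', star_star]; ring
  simp only [Ker, Matrix.mul_apply, Matrix.conjTranspose_apply, evM, Matrix.map_apply, flip, Matrix.of_apply,
    Matrix.sub_apply, Matrix.smul_apply, Matrix.vecMulVec_apply, smul_eq_mul, eval_add, eval_mul, eval_C]
  set c := a - star a with hc
  have hcs : star c = - c := by rw [hc, star_sub, star_star]; ring
  have e1 : ∀ l, star ((A l i).eval w + c * b l * (η i).eval w) * ((A l j).eval x + c * b l * (η j).eval x)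
    = star ((A l i).eval w) * (A l j).eval x + (c * (η j).eval x) * (star ((A l i).eval w) * b l)
      + (-c * star ((η i).eval w)) * (star (b l) * (A l j).eval x)
      + (-c * c * star ((η i).eval w) * (η j).eval x) * (star (b l) * b l) := by
    intro l
    simp only [star_add, star_mul', hcs]; ring
  simp only [e1, Finset.sum_add_distrib, ← Finset.mul_sum]
  rw [hb, h1, h2, star_mul', star_sub]
  rw [hc]; ring

lemma exists_unit (v : m → ℂ) (hv : v ≠ 0) : ∃ r : ℂ, r ≠ 0 ∧ ∑ i, star (r * v i) * (r * v i) = 1 := by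
  set s : ℝ := ∑ i, Complex.normSq (v i) with hs
  have hs0 : 0 < s := by
    obtain ⟨i, hi⟩ := Function.ne_iff.1 hv
    exact Finset.sum_pos' (fun i _ => Complex.normSq_nonneg _) ⟨i, Finset.mem_univ i, Complex.normSq_pos.2 hi⟩
  refine ⟨((√s)⁻¹ : ℝ), by simpa using (Real.sqrt_pos.2 hs0).ne', ?_⟩
  have : ∀ i, star ((((√s)⁻¹ : ℝ) : ℂ) * v i) * ((((√s)⁻¹ : ℝ) : ℂ) * v i) = ((s⁻¹ * Complex.normSq (v i) : ℝ) : ℂ) := by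
    intro i
    rw [star_mul', star_real]
    have h1 : star (v i) * v i = (Complex.normSq (v i) : ℂ) := (Complex.normSq_eq_conj_mul_self).symm
    have h2 : (√s)⁻¹ * (√s)⁻¹ = s⁻¹ := by rw [← mul_inv, Real.mul_self_sqrt hs0.le]
    calc _ = (((√s)⁻¹ * (√s)⁻¹ : ℝ) : ℂ) * (star (v i) * v i) := by push_cast; ring
      _ = _ := by rw [h2, h1]; push_cast; ring
  simp only [this]
  rw [← Complex.ofReal_sum, ← Finset.mul_sum, ← hs, inv_mul_cancel₀ hs0.ne']; simp

lemma exists_flip_data (A : Matrix m n ℂ[X]) (b : m → ℂ) (a : ℂ)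
    (h : ∀ j, ∑ i, star (b i) * (A i j).eval a = 0) :
    ∃ η : n → ℂ[X], ∀ j, ∑ i, C (star (b i)) * A i j = (X - C a) * η j := by
  have : ∀ j, ∃ e, ∑ i, C (star (b i)) * A i j = (X - C a) * e := by
    intro j
    apply dvd_iff_isRoot.2
    rw [IsRoot.def, eval_finset_sum]
    simpa using h j
  choose η hη using this
  exact ⟨η, hη⟩

lemma evM_det [DecidableEq m] (A : Matrix m m ℂ[X]) (x : ℂ) : (evM A x).det = A.det.eval x := by
  have := RingHom.map_det (evalRingHom x) A
  exact this.symm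

lemma flip_det [DecidableEq m] (A : Matrix m m ℂ[X]) (b : m → ℂ) (a : ℂ) (η : m → ℂ[X]) (hb : ∑ i, star (b i) * b i = 1)
    (h : ∀ j, ∑ i, C (star (b i)) * A i j = (X - C a) * η j) :
    (X - C a) * (flip A b a η).det = (X - C (star a)) * A.det := by
  have key : ∀ x, x ≠ a → (x - a) * (flip A b a η).det.eval x = (x - star a) * A.det.eval x := by
    intro x hx
    have hxa : x - a ≠ 0 := sub_ne_zero.2 hx
    have h1 : ∀ j, ∑ i, star (b i) * (A i j).eval x = (x - a) * (η j).eval x := by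
      intro j
      have := congrArg (eval x) (h j)
      simpa [eval_finset_sum] using this
    have h2 : evM (flip A b a η) x = (1 + Matrix.replicateCol Unit (fun i => (a - star a) / (x - a) * b i) * Matrix.replicateRow Unit (fun i => star (b i))) * evM A x := by
      rw [Matrix.add_mul, Matrix.one_mul]
      ext i j
      simp only [evM, flip, Matrix.map_apply, Matrix.of_apply, Matrix.add_apply, Matrix.mul_apply, eval_add, eval_mul, eval_C]
      congr 1
      simp only [Finset.univ_unique, Finset.sum_singleton, Matrix.replicateCol_apply, Matrix.replicateRow_apply, mul_assoc]
      rw [← Finset.mul_sum, ← Finset.mul_sum, h1]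
      field_simp
    rw [← evM_det, ← evM_det, h2, Matrix.det_mul, Matrix.det_one_add_replicateCol_mul_replicateRow]
    have h3 : (fun i => star (b i)) ⬝ᵥ (fun i => (a - star a) / (x - a) * b i) = (a - star a) / (x - a) := by
      rw [dotProduct]
      calc _ = ∑ i, (a - star a) / (x - a) * (star (b i) * b i) := Finset.sum_congr rfl fun i _ => by ring
        _ = _ := by rw [← Finset.mul_sum, hb, mul_one]
    rw [h3]
    field_simp
    ring
  apply mul_left_cancel₀ (X_sub_C_ne_zero a)
  apply Polynomial.funext
  intro x
  by_cases hx : x = a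
  · simp [hx]
  · have := key x hx
    simp only [eval_mul, eval_sub, eval_X, eval_C]
    rw [this]

lemma flip_all [DecidableEq m] (A : Matrix m m ℂ[X]) (hA : A.det ≠ 0) :
    ∃ B : Matrix m m ℂ[X], B.conjTranspose * B = A.conjTranspose * A ∧ ∀ z : ℂ, 0 < z.im → B.det.eval z ≠ 0 := by
  classical
  induction hN : Multiset.card (A.det.roots.filter fun z => 0 < z.im) using Nat.strong_induction_on generalizing A with
  | _ N ih =>
  by_cases hz : ∀ z : ℂ, 0 < z.im → A.det.eval z ≠ 0
  · exact ⟨A, rfl, hz⟩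
  push Not at hz
  obtain ⟨a, haim, ha⟩ := hz
  rw [← evM_det] at ha
  obtain ⟨v, hv0, hv⟩ := Matrix.exists_vecMul_eq_zero_iff.2 ha
  obtain ⟨r, hr, hrs⟩ := exists_unit (star v) (star_ne_zero.2 hv0)
  set b : m → ℂ := fun i => r * star v i with hb
  obtain ⟨η, hη⟩ := exists_flip_data A b a (by
    intro j
    have := congrFun hv j
    simp only [Matrix.vecMul, dotProduct, evM, Matrix.map_apply, Pi.zero_apply] at this
    calc _ = star r * ∑ i, v i * (A i j).eval a := by
          rw [Finset.mul_sum]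
          refine Finset.sum_congr rfl fun i _ => ?_
          simp only [hb, star_mul', Pi.star_apply, star_star]; ring
      _ = 0 := by rw [this, mul_zero])
  have hdet := flip_det A b a η hrs hη
  have hker := flip_Ker A b a η hrs hη
  have hgram : (flip A b a η).conjTranspose * flip A b a η = A.conjTranspose * A := by
    rw [gram_eq_iff]
    intro x
    rw [hker, star_star, sub_self, mul_zero, zero_smul, sub_zero]
  have hroot : (X - C a) ∣ A.det := by
    rw [dvd_iff_isRoot, IsRoot.def, ← evM_det]; exact ha
  obtain ⟨e, he⟩ := hroot
  have hdet2 : (flip A b a η).det = (X - C (star a)) * e := by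
    apply mul_left_cancel₀ (X_sub_C_ne_zero a)
    rw [hdet, he]; ring
  have he0 : e ≠ 0 := by rintro rfl; exact hA (by rw [he, mul_zero])
  have hne : (flip A b a η).det ≠ 0 := by rw [hdet2]; exact mul_ne_zero (X_sub_C_ne_zero _) he0
  obtain ⟨B, hB1, hB2⟩ := ih _ (by
    rw [← hN, hdet2, he, roots_mul (mul_ne_zero (X_sub_C_ne_zero _) he0), roots_mul (mul_ne_zero (X_sub_C_ne_zero _) he0),
      roots_X_sub_C, roots_X_sub_C, Multiset.filter_add, Multiset.filter_add, Multiset.card_add, Multiset.card_add]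
    have h1 : ¬ 0 < (star a).im := by
      have : (star a).im = - a.im := Complex.conj_im a
      rw [this]; linarith
    rw [Multiset.filter_singleton, Multiset.filter_singleton, if_neg h1, if_pos haim]
    simp) (flip A b a η) hne rfl
  exact ⟨B, hB1.trans hgram, hB2⟩
end flip

theorem FR (n : ℕ) (T : Matrix (Fin n) (Fin n) ℂ[X]) (hT : PSDm ev1 T) (hdet : T.det ≠ 0) :
    ∃ A : Matrix (Fin n) (Fin n) ℂ[X], A.conjTranspose * A = T ∧ ∀ z : ℂ, 0 < z.im → A.det.eval z ≠ 0 := by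
  obtain ⟨h, U, d, hh, hd, he⟩ := ldl ev1 ev1_star ev1_inj n T hT
  have hda : ∀ i, ∃ a, star a * a = d i := by
    intro i
    by_cases h0 : d i = 0
    · exact ⟨0, by rw [h0, mul_zero]⟩
    · obtain ⟨a, ha, -⟩ := fr_scalar (d i) h0 (hd i).1 (hd i).2
      exact ⟨a, ha⟩
  choose a ha using hda
  obtain ⟨A, hA⟩ := CP aniso_complex (Matrix.diagonal a * U) h hh T (by
    rw [he, Matrix.conjTranspose_mul, Matrix.diagonal_conjTranspose, Matrix.mul_assoc, ← Matrix.mul_assoc (Matrix.diagonal (star a)),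
      Matrix.diagonal_mul_diagonal, ← Matrix.mul_assoc]
    simp only [Pi.star_apply, ha])
  have hA0 : A.det ≠ 0 := by
    intro h0
    apply hdet
    rw [← hA, Matrix.det_mul, h0, mul_zero]
  obtain ⟨B, hB1, hB2⟩ := flip_all A hA0
  exact ⟨B, hB1.trans hA, hB2⟩
end Polynomial

namespace Polynomial
open Polynomial

lemma PIDlem {R : Type} [CommRing R] [IsDomain R] [IsPrincipalIdealRing R] {m n : Type} [Fintype m] [Fintype n] [DecidableEq n]
    (Xm : Matrix m n R) : ∃ (s : ℕ) (X1 : Matrix m (Fin s) R) (S : Matrix (Fin s) n R) (S' : Matrix n (Fin s) R),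
      Xm = X1 * S ∧ S * S' = 1 ∧ ∀ v, Matrix.mulVec X1 v = 0 → v = 0 := by
  classical
  obtain ⟨s, bas⟩ := Submodule.basisOfPid (Pi.basisFun R m) (LinearMap.range Xm.mulVecLin)
  set f : (n → R) →ₗ[R] (Fin s → R) := bas.equivFun.toLinearMap ∘ₗ Xm.mulVecLin.rangeRestrict with hf
  set g : (Fin s → R) →ₗ[R] (m → R) := (LinearMap.range Xm.mulVecLin).subtype ∘ₗ bas.equivFun.symm.toLinearMap with hg
  have hfs : Function.Surjective f := bas.equivFun.surjective.comp (LinearMap.surjective_rangeRestrict _)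
  have hgi : Function.Injective g := (Submodule.injective_subtype _).comp bas.equivFun.symm.injective
  have hgf : g ∘ₗ f = Xm.mulVecLin := by
    refine LinearMap.ext fun v => ?_
    simp [hf, hg]
  obtain ⟨f', hf'⟩ := Module.projective_lifting_property f LinearMap.id hfs
  refine ⟨s, LinearMap.toMatrix' g, LinearMap.toMatrix' f, LinearMap.toMatrix' f', ?_, ?_, ?_⟩
  · rw [← LinearMap.toMatrix'_comp, hgf]
    exact (LinearMap.toMatrix'_toLin' Xm).symm
  · rw [← LinearMap.toMatrix'_comp, hf', LinearMap.toMatrix'_id]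
  · intro v hv
    rw [LinearMap.toMatrix'_mulVec] at hv
    exact hgi (by rw [hv, map_zero])

section
variable {m n : Type} [Fintype m] [Fintype n]

def BZrel {m' : Type} [Fintype m'] (Xm : Matrix m n ℂ[X]) (Y : Matrix m' n ℂ[X]) : Prop :=
  ∃ (κ : Type) (_ : Fintype κ) (D : Matrix κ n ℂ[X]), ∀ w x : ℂ,
    Ker Xm w x - Ker Y w x = (-Complex.I * (x - star w)) • Ker D w x

/-- Vectors with constant norm are constant. -/
lemma const_of_gram (v : m → ℂ[X]) (c : ℂ) (h : ∑ i, star (v i) * v i = C c) (i : m) : (v i).natDegree = 0 := by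
  classical
  set d := Finset.univ.sup fun i => (v i).natDegree with hd
  have hle : ∀ i, (v i).natDegree ≤ d := fun i => Finset.le_sup (f := fun i => (v i).natDegree) (Finset.mem_univ i)
  by_contra hi
  have hd0 : d ≠ 0 := by have := hle i; omega
  have h1 := congrArg (fun p => coeff p (d + d)) h
  simp only [finset_sum_coeff] at h1
  rw [coeff_C, if_neg (by omega)] at h1
  have h2 : ∀ l, (v l).coeff d = 0 := by
    suffices h2' : (fun l => (v l).coeff d) = 0 from fun l => congrFun h2' l
    apply aniso_complex m
    rw [← h1]
    refine Finset.sum_congr rfl fun l _ => ?_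
    rw [coeff_mul_add_eq_of_natDegree_le ((natDegree_star_poly _).trans_le (hle l)) (hle l), coeff_star_poly]
  obtain ⟨j, -, hj⟩ := Finset.exists_mem_eq_sup Finset.univ ⟨i, Finset.mem_univ i⟩ fun i => (v i).natDegree
  have h3 := h2 j
  rw [hd, hj] at h3
  have h4 : v j = 0 := leadingCoeff_eq_zero.1 h3
  rw [← hd, h4, natDegree_zero] at hj
  exact hd0 hj

lemma BZ_base [DecidableEq n] (Xm : Matrix n n ℂ[X]) (Y : Matrix m n ℂ[X]) (hX : IsUnit Xm.det)
    (h : Xm.conjTranspose * Xm = Y.conjTranspose * Y) : BZrel Xm Y := by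
  refine ⟨Fin 0, inferInstance, 0, fun w x => ?_⟩
  set V := Y * Xm⁻¹ with hV
  have hVX : V * Xm = Y := by
    rw [hV, Matrix.mul_assoc, Matrix.nonsing_inv_mul _ hX, Matrix.mul_one]
  have hVV : V.conjTranspose * V = 1 := by
    have e1 : Xm⁻¹.conjTranspose * (Xm.conjTranspose * Xm) * Xm⁻¹ = 1 := by
      rw [← Matrix.mul_assoc, ← Matrix.conjTranspose_mul, Matrix.mul_nonsing_inv _ hX, Matrix.conjTranspose_one, Matrix.one_mul,
        Matrix.mul_nonsing_inv _ hX]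
    rw [h] at e1
    rw [← e1, hV, Matrix.conjTranspose_mul]
    simp only [Matrix.mul_assoc]
  have hconst : ∀ x y, evM V x = evM V y := by
    intro x y
    ext i j
    have h1 : (V i j).natDegree = 0 := by
      refine const_of_gram (fun i => V i j) 1 ?_ i
      have := congrFun (congrFun hVV j) j
      rw [Matrix.one_apply_eq, Matrix.mul_apply] at this
      simpa [Matrix.conjTranspose_apply] using this
    simp only [evM, Matrix.map_apply]
    rw [eq_C_of_natDegree_eq_zero h1, eval_C, eval_C]
  have hK : Ker V w x = 1 := by
    have h1 : Ker V w x = Ker V (star x) x := by rw [Ker, hconst w (star x)]; rfl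
    rw [h1, Ker_star, hVV]
    ext i j
    simp only [evM, Matrix.map_apply, Matrix.one_apply]
    split_ifs <;> simp
  rw [← hVX, Ker_mul, hK, Matrix.mul_one]
  have h0 : Ker (0 : Matrix (Fin 0) n ℂ[X]) w x = 0 := by
    ext i j; simp [Ker, Matrix.mul_apply]
  rw [h0, smul_zero]
  exact sub_self _

lemma Ker_mulVec_eq {m' : Type} [Fintype m'] {Xm : Matrix m n ℂ[X]} {Y : Matrix m' n ℂ[X]}
    (h : Xm.conjTranspose * Xm = Y.conjTranspose * Y) {a : ℂ} {c : n → ℂ} (hc : Matrix.mulVec (evM Xm a) c = 0) :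
    Matrix.vecMul (star (Matrix.mulVec (evM Y a) c)) (evM Y (star a)) = 0 := by
  have h1 := gram_eq_iff.1 h (star a)
  rw [star_star, Ker, Ker] at h1
  rw [Matrix.star_mulVec, Matrix.vecMul_vecMul, ← h1, ← Matrix.vecMul_vecMul, ← Matrix.star_mulVec, hc, star_zero, Matrix.zero_vecMul]

/-- Extraction of a common right factor. -/
lemma extract [DecidableEq n] (c : n → ℂ) (j0 : n) (hc : c j0 = 1) (a : ℂ) :
    ∃ D : Matrix n n ℂ[X], ∀ (m : Type) [Fintype m] (Xm : Matrix m n ℂ[X]), Matrix.mulVec (evM Xm a) c = 0 →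
      ∃ X1 : Matrix m n ℂ[X], Xm = X1 * D ∧ ∃ ξ : m → ℂ[X], X1 = Xm.updateCol j0 ξ ∧
        ∀ i, ∑ j, C (c j) * Xm i j = (X - C a) * ξ i := by
  refine ⟨(1 : Matrix n n ℂ[X]).updateCol j0 (fun j => if j = j0 then X - C a else - C (c j)), ?_⟩
  intro m _ Xm hX
  have hdv : ∀ i, ∃ e, ∑ j, C (c j) * Xm i j = (X - C a) * e := by
    intro i
    apply dvd_iff_isRoot.2
    rw [IsRoot.def, eval_finset_sum]
    have := congrFun hX i
    simp only [Matrix.mulVec, dotProduct, evM, Matrix.map_apply, Pi.zero_apply] at this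
    rw [← this]
    exact Finset.sum_congr rfl fun j _ => by simp [mul_comm]
  choose ξ hξ using hdv
  refine ⟨Xm.updateCol j0 ξ, ?_, ξ, rfl, hξ⟩
  ext1 i j
  rw [Matrix.mul_apply]
  by_cases hj : j = j0
  · subst hj
    simp only [Matrix.updateCol_self]
    rw [← Finset.add_sum_erase _ _ (Finset.mem_univ j)]
    have e1 := hξ i
    rw [← Finset.add_sum_erase _ _ (Finset.mem_univ j), hc] at e1
    have e2 : ∑ x ∈ Finset.univ.erase j, Xm.updateCol j ξ i x * (if x = j then X - C a else -C (c x)) =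
        - ∑ x ∈ Finset.univ.erase j, C (c x) * Xm i x := by
      rw [← Finset.sum_neg_distrib]
      refine Finset.sum_congr rfl fun x hx => ?_
      have hx' := Finset.ne_of_mem_erase hx
      rw [Matrix.updateCol_ne hx', if_neg hx']; ring
    rw [e2, Matrix.updateCol_self, if_pos rfl]
    rw [map_one, one_mul] at e1
    linear_combination e1
  · rw [Finset.sum_eq_single j]
    · rw [Matrix.updateCol_ne hj, Matrix.updateCol_ne hj, Matrix.one_apply_eq, mul_one]
    · intro x _ hx
      rw [Matrix.updateCol_ne hj, Matrix.one_apply_ne hx, mul_zero]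
    · simp

lemma mul_right_eq_zero_of_det [DecidableEq n] {l : Type} [Fintype l] (M : Matrix l n ℂ[X]) (D : Matrix n n ℂ[X]) (hD : D.det ≠ 0)
    (h : M * D = 0) : M = 0 := by
  have h1 : M * D * D.adjugate = 0 := by rw [h, Matrix.zero_mul]
  rw [Matrix.mul_assoc, Matrix.mul_adjugate, Matrix.mul_smul, Matrix.mul_one] at h1
  exact (smul_eq_zero.1 h1).resolve_left hD

lemma cancel_gram [DecidableEq n] {m' : Type} [Fintype m'] (A : Matrix m n ℂ[X]) (B : Matrix m' n ℂ[X]) (D : Matrix n n ℂ[X]) (hD : D.det ≠ 0)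
    (h : (A * D).conjTranspose * (A * D) = (B * D).conjTranspose * (B * D)) : A.conjTranspose * A = B.conjTranspose * B := by
  rw [← sub_eq_zero]
  apply mul_right_eq_zero_of_det _ D hD
  have h1 : D.conjTranspose * ((A.conjTranspose * A - B.conjTranspose * B) * D) = 0 := by
    rw [Matrix.conjTranspose_mul, Matrix.conjTranspose_mul] at h
    rw [Matrix.sub_mul, Matrix.mul_sub, sub_eq_zero]
    simpa only [Matrix.mul_assoc] using h
  have h2 := congrArg Matrix.conjTranspose h1
  rw [Matrix.conjTranspose_mul, Matrix.conjTranspose_conjTranspose, Matrix.conjTranspose_zero] at h2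
  have h3 := mul_right_eq_zero_of_det _ D hD h2
  rwa [Matrix.conjTranspose_eq_zero] at h3

lemma Ker_fromRows {m' : Type} [Fintype m'] (A : Matrix m n ℂ[X]) (B : Matrix m' n ℂ[X]) (w x : ℂ) :
    Ker (Matrix.fromRows A B) w x = Ker A w x + Ker B w x := by
  ext i j
  simp [Ker, Matrix.mul_apply, evM, Fintype.sum_sum_type]

theorem BZ [DecidableEq n] [DecidableEq m] (Xm : Matrix n n ℂ[X]) (Y : Matrix m n ℂ[X]) (h0 : Xm.det ≠ 0)
    (hX : ∀ z : ℂ, 0 < z.im → Xm.det.eval z ≠ 0)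
    (h : Xm.conjTranspose * Xm = Y.conjTranspose * Y) : BZrel Xm Y := by
  induction hN : Xm.det.natDegree using Nat.strong_induction_on generalizing Xm Y with
  | _ N ih =>
  subst hN
  by_cases hd : Xm.det.natDegree = 0
  · apply BZ_base _ _ _ h
    rw [eq_C_of_natDegree_eq_zero hd] at h0 ⊢
    exact isUnit_C.2 (IsUnit.mk0 _ (by simpa using h0))
  obtain ⟨a, ha⟩ := Complex.exists_root (f := Xm.det) (by rw [← natDegree_pos_iff_degree_pos]; omega)
  have haim : a.im ≤ 0 := by
    by_contra hcon
    push Not at hcon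
    exact hX a hcon ha
  have ha' : (evM Xm a).det = 0 := by rw [evM_det]; exact ha
  obtain ⟨c0, hc00, hc0⟩ := Matrix.exists_mulVec_eq_zero_iff.2 ha'
  obtain ⟨j0, hj0⟩ := Function.ne_iff.1 hc00
  obtain ⟨c, hc1, hc⟩ : ∃ c : n → ℂ, c j0 = 1 ∧ Matrix.mulVec (evM Xm a) c = 0 := by
    refine ⟨(c0 j0)⁻¹ • c0, ?_, ?_⟩
    · simpa using inv_mul_cancel₀ hj0
    · rw [Matrix.mulVec_smul, hc0, smul_zero]
  -- the case of a common null vector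
  have main : ∀ Y : Matrix m n ℂ[X], Xm.conjTranspose * Xm = Y.conjTranspose * Y → Matrix.mulVec (evM Y a) c = 0 → BZrel Xm Y := by
    intro Y h hY
    obtain ⟨D, hD⟩ := extract c j0 hc1 a
    obtain ⟨X1, hX1, ξ, hξ1, hξ2⟩ := hD n Xm hc
    obtain ⟨Y1, hY1, -⟩ := hD m Y hY
    have hdet : Xm.det = (X - C a) * X1.det := by
      have e1 : Xm.updateCol j0 (fun k => ∑ i, C (c i) • Xm k i) = Xm.updateCol j0 ((X - C a) • ξ) := by
        congr 1
        ext1 k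
        simpa using hξ2 k
      have e2 := Matrix.det_updateCol_sum Xm j0 (fun i => C (c i))
      rw [e1, Matrix.det_updateCol_smul, ← hξ1, hc1, map_one, one_smul] at e2
      exact e2.symm
    have hX10 : X1.det ≠ 0 := by intro h1; rw [h1, mul_zero] at hdet; exact h0 hdet
    have hDdet : D.det ≠ 0 := by
      intro h1
      apply h0; rw [hX1, Matrix.det_mul, h1, mul_zero]
    have hg : X1.conjTranspose * X1 = Y1.conjTranspose * Y1 := by
      apply cancel_gram _ _ D hDdet
      rw [← hX1, ← hY1, h]
    obtain ⟨κ, _, E, hE⟩ := ih X1.det.natDegree (by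
      rw [hdet, natDegree_mul (X_sub_C_ne_zero a) hX10, natDegree_X_sub_C]; omega) X1 Y1 hX10 (by
        intro z hz hz0
        apply hX z hz
        rw [hdet, eval_mul, hz0, mul_zero]) hg rfl
    refine ⟨κ, inferInstance, E * D, fun w x => ?_⟩
    rw [hX1, hY1, Ker_mul, Ker_mul, Ker_mul, ← Matrix.sub_mul, ← Matrix.mul_sub, hE, Matrix.mul_smul, Matrix.smul_mul]
  by_cases hb0 : Matrix.mulVec (evM Y a) c = 0
  · exact main Y h hb0
  have haneg : a.im < 0 := by
    refine lt_of_le_of_ne haim fun h1 => hb0 ?_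
    have hareal : star a = a := Complex.conj_eq_iff_im.2 h1
    have h2 := Ker_mulVec_eq h hc
    rw [hareal] at h2
    have h3 : star (Matrix.mulVec (evM Y a) c) ⬝ᵥ Matrix.mulVec (evM Y a) c = 0 := by
      rw [Matrix.dotProduct_mulVec, h2, zero_dotProduct]
    exact aniso_complex m _ h3
  obtain ⟨r, hr0, hr⟩ := exists_unit _ hb0
  set b : m → ℂ := fun i => r * (Matrix.mulVec (evM Y a) c) i with hb
  obtain ⟨η, hη⟩ := exists_flip_data Y b (star a) (by
    intro j
    have h2 := congrFun (Ker_mulVec_eq h hc) j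
    simp only [Matrix.vecMul, dotProduct, Pi.zero_apply] at h2
    calc _ = star r * ∑ i, star (Matrix.mulVec (evM Y a) c) i * evM Y (star a) i j := by
          rw [Finset.mul_sum]
          refine Finset.sum_congr rfl fun i _ => ?_
          simp only [hb, star_mul', Pi.star_apply, evM, Matrix.map_apply]; ring
      _ = 0 := by rw [h2, mul_zero])
  set Y1 := flip Y b (star a) η with hY1
  have hker := flip_Ker Y b (star a) η hr hη
  have hgram : Xm.conjTranspose * Xm = Y1.conjTranspose * Y1 := by
    rw [h, gram_eq_iff]
    intro x
    rw [hker, star_star x, sub_self, mul_zero, zero_smul, sub_zero]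
  have hY1c : Matrix.mulVec (evM Y1 a) c = 0 := by
    ext i
    have e1 : ∑ j, ((a - star a) * (η j).eval a) * c j = ∑ l, star (b l) * (Matrix.mulVec (evM Y a) c) l := by
      simp only [Matrix.mulVec, dotProduct, evM, Matrix.map_apply, Finset.mul_sum]
      rw [Finset.sum_comm]
      refine Finset.sum_congr rfl fun j _ => ?_
      have e2 := congrArg (eval a) (hη j)
      simp only [eval_finset_sum, eval_mul, eval_sub, eval_X, eval_C] at e2
      rw [← e2, Finset.sum_mul]
      exact Finset.sum_congr rfl fun l _ => by ring
    have e3 : ∑ l, star (b l) * (Matrix.mulVec (evM Y a) c) l = r⁻¹ := by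
      have : ∑ l, star (b l) * b l = r * ∑ l, star (b l) * (Matrix.mulVec (evM Y a) c) l := by
        rw [Finset.mul_sum]
        exact Finset.sum_congr rfl fun l _ => by simp only [hb]; ring
      rw [hr] at this
      field_simp
      rw [mul_comm]; exact this.symm
    have e4 : (Matrix.mulVec (evM Y1 a) c) i = (Matrix.mulVec (evM Y a) c) i - b i * ∑ j, ((a - star a) * (η j).eval a) * c j := by
      simp only [Matrix.mulVec, dotProduct, evM, Matrix.map_apply, Finset.mul_sum, hY1, flip, Matrix.of_apply, eval_add, eval_mul, eval_C, star_star]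
      rw [← Finset.sum_sub_distrib]
      exact Finset.sum_congr rfl fun j _ => by ring
    rw [e4, e1, e3, hb, Pi.zero_apply]
    field_simp
    ring
  obtain ⟨κ, _, E, hE⟩ := main Y1 hgram hY1c
  refine ⟨κ ⊕ Unit, inferInstance, Matrix.fromRows E (Matrix.of fun _ j => C ((√(-2 * a.im) : ℝ) : ℂ) * η j), fun w x => ?_⟩
  have e5 : Ker (Matrix.of fun (_ : Unit) j => C ((√(-2 * a.im) : ℝ) : ℂ) * η j) w x =
      ((-2 * a.im : ℝ) : ℂ) • Matrix.vecMulVec (fun i => star ((η i).eval w)) (fun j => (η j).eval x) := by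
    ext i j
    have e6 : ((√(-2 * a.im) : ℝ) : ℂ) * ((√(-2 * a.im) : ℝ) : ℂ) = ((-2 * a.im : ℝ) : ℂ) := by
      rw [← Complex.ofReal_mul, Real.mul_self_sqrt (by linarith)]
    simp only [Ker, Matrix.mul_apply, Matrix.conjTranspose_apply, evM, Matrix.map_apply, Matrix.of_apply, Finset.univ_unique,
      Finset.sum_singleton, eval_mul, eval_C, star_mul', star_real, Matrix.smul_apply, Matrix.vecMulVec_apply, smul_eq_mul]
    rw [← e6]; ring
  rw [Ker_fromRows, smul_add, ← hE, e5, hker, smul_smul]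
  have e7 : (star a - star (star a)) * (x - star w) = Complex.I * (x - star w) * ((-2 * a.im : ℝ) : ℂ) := by
    have : star a - star (star a) = -(2 * Complex.I * a.im) := by
      apply Complex.ext <;> simp <;> ring
    rw [this]; push_cast; ring
  rw [e7]
  module
end
end Polynomial

namespace Polynomial
open Polynomial

/-- kernel of a Gram matrix -/
lemma mul_eq_zero_of_gram {m m' n l : Type} [Fintype m] [Fintype m'] [Fintype n] [Fintype l]
    {Xm : Matrix m n ℂ[X]} {Y : Matrix m' n ℂ[X]}
    (h : Xm.conjTranspose * Xm = Y.conjTranspose * Y) (Z : Matrix n l ℂ[X]) (hZ : Xm * Z = 0) : Y * Z = 0 := by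
  have h1 : (Y * Z).conjTranspose * (Y * Z) = 0 := by
    rw [Matrix.conjTranspose_mul, Matrix.mul_assoc, ← Matrix.mul_assoc _ Y, ← h, Matrix.mul_assoc, hZ, Matrix.mul_zero, Matrix.mul_zero]
  ext1 i j
  have h2 := congrFun (congrFun h1 j) j
  rw [Matrix.mul_apply] at h2
  exact congrFun (aniso_complex.poly m' (fun i => (Y * Z) i j) h2) i

theorem BZ' {m m' n : Type} [Fintype m] [Fintype m'] [Fintype n] [DecidableEq n] [DecidableEq m] [DecidableEq m']
    (Xm : Matrix m n ℂ[X]) (Y : Matrix m' n ℂ[X])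
    (hX : ∀ z : ℂ, 0 < z.im → ∀ u : m → ℂ, Matrix.vecMul u (evM Xm z) = 0 → u = 0)
    (h : Xm.conjTranspose * Xm = Y.conjTranspose * Y) : BZrel Xm Y := by
  obtain ⟨s, X0, S0, S0', hXS, hSS, hinj⟩ := PIDlem Xm
  have hX0 : ∀ z : ℂ, 0 < z.im → ∀ u : m → ℂ, Matrix.vecMul u (evM X0 z) = 0 → u = 0 := by
    intro z hz u hu
    apply hX z hz u
    rw [hXS, evM_mul, ← Matrix.vecMul_vecMul, hu, Matrix.zero_vecMul]
  have hs1 : s ≤ Fintype.card m := by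
    have := card_le_of_injective ℂ[X] X0.mulVecLin ((injective_iff_map_eq_zero _).2 hinj)
    simpa using this
  have hs2 : Fintype.card m ≤ s := by
    have := card_le_of_injective ℂ (evM X0 Complex.I).vecMulLinear ((injective_iff_map_eq_zero _).2 (hX0 Complex.I (by simp)))
    simpa using this
  have e : Fin s ≃ m := Fintype.equivOfCardEq (by rw [Fintype.card_fin]; omega)
  obtain ⟨X1, S, S', hXS, hSS, hinj, hX1⟩ : ∃ (X1 : Matrix m m ℂ[X]) (S : Matrix m n ℂ[X]) (S' : Matrix n m ℂ[X]),
      Xm = X1 * S ∧ S * S' = 1 ∧ (∀ v, Matrix.mulVec X1 v = 0 → v = 0) ∧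
        ∀ z : ℂ, 0 < z.im → ∀ u : m → ℂ, Matrix.vecMul u (evM X1 z) = 0 → u = 0 := by
    refine ⟨X0.submatrix id e.symm, S0.submatrix e.symm id, S0'.submatrix id e.symm, ?_, ?_, ?_, ?_⟩
    · rw [Matrix.submatrix_mul_equiv, ← hXS, Matrix.submatrix_id_id]
    · rw [← Matrix.submatrix_mul _ _ _ id _ Function.bijective_id, hSS, Matrix.submatrix_one_equiv]
    · intro v hv
      have h1 : v ∘ e = 0 := by
        apply hinj
        rw [Matrix.submatrix_mulVec_equiv] at hv
        simpa using hv
      ext1 i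
      have := congrFun h1 (e.symm i)
      simpa using this
    · intro z hz u hu
      apply hX0 z hz u
      ext1 j
      have := congrFun hu (e j)
      simpa [Matrix.vecMul, dotProduct, evM] using this
  have hdet0 : X1.det ≠ 0 := by
    intro h0
    obtain ⟨v, hv, hv0⟩ := Matrix.exists_mulVec_eq_zero_iff.2 h0
    exact hv (hinj v hv0)
  have hdet : ∀ z : ℂ, 0 < z.im → X1.det.eval z ≠ 0 := by
    intro z hz h0
    rw [← evM_det] at h0
    obtain ⟨v, hv, hv0⟩ := Matrix.exists_vecMul_eq_zero_iff.2 h0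
    exact hv (hX1 z hz v hv0)
  have hYS : Y = Y * S' * S := by
    have h1 : Y * (1 - S' * S) = 0 := by
      apply mul_eq_zero_of_gram h
      rw [Matrix.mul_sub, Matrix.mul_one, hXS, Matrix.mul_assoc, ← Matrix.mul_assoc S, hSS, Matrix.one_mul, sub_self]
    rw [Matrix.mul_sub, Matrix.mul_one, sub_eq_zero, ← Matrix.mul_assoc] at h1
    exact h1
  have hX1S : Xm * S' = X1 := by rw [hXS, Matrix.mul_assoc, hSS, Matrix.mul_one]
  have hg : X1.conjTranspose * X1 = (Y * S').conjTranspose * (Y * S') := by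
    rw [← hX1S, Matrix.conjTranspose_mul, Matrix.conjTranspose_mul]
    simp only [Matrix.mul_assoc]
    rw [← Matrix.mul_assoc _ Xm, h]
    simp only [Matrix.mul_assoc]
  obtain ⟨κ, _, D, hD⟩ := BZ X1 (Y * S') hdet0 hdet hg
  refine ⟨κ, inferInstance, D * S, fun w x => ?_⟩
  rw [hYS, hXS, Ker_mul X1, Ker_mul (Y * S'), Ker_mul D, ← Matrix.sub_mul, ← Matrix.mul_sub, hD, Matrix.mul_smul, Matrix.smul_mul]

end Polynomial

namespace Polynomial
open Polynomial

lemma coeff_X_mul_ite {R : Type} [CommRing R] (p : R[X]) (n : ℕ) : (X * p).coeff n = if 1 ≤ n then p.coeff (n - 1) else 0 := by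
  cases n with
  | zero => simp
  | succ n => simp

lemma norm_eval_mono (p : ℂ[X]) (hp : ∀ z : ℂ, 0 < z.im → p.eval z ≠ 0) (a b b' : ℝ) (hb : 0 ≤ b) (h : |b'| ≤ b) :
    ‖p.eval ⟨a, b'⟩‖ ≤ ‖p.eval ⟨a, b⟩‖ := by
  by_cases hp0 : p = 0
  · simp [hp0]
  have hs := (IsAlgClosed.splits p).eq_prod_roots
  have key : ∀ z : ℂ, ‖p.eval z‖ = ‖p.leadingCoeff‖ * (p.roots.map fun r => ‖z - r‖).prod := by
    intro z
    conv_lhs => rw [hs]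
    rw [eval_mul, eval_C, norm_mul, eval_multiset_prod, Multiset.map_map]
    congr 1
    rw [← coe_nnnorm, ]
    have : ‖(p.roots.map ((eval z) ∘ fun a => X - C a)).prod‖ = ((p.roots.map ((eval z) ∘ fun a => X - C a)).map norm).prod :=
      (map_multiset_prod (normHom : ℂ →*₀ ℝ) _)
    rw [coe_nnnorm, this, Multiset.map_map]
    simp
  rw [key, key]
  refine mul_le_mul_of_nonneg_left ?_ (norm_nonneg _)
  apply Multiset.prod_map_le_prod_map₀
  · intro r _; exact norm_nonneg _
  · intro r hr
    have hr' : r.im ≤ 0 := by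
      by_contra hcon
      push Not at hcon
      exact hp r hcon ((mem_roots hp0).1 hr)
    have h1 := abs_le.1 h
    rw [Complex.norm_def, Complex.norm_def]
    apply Real.sqrt_le_sqrt
    simp only [Complex.normSq_apply, Complex.sub_re, Complex.sub_im]
    nlinarith [mul_nonneg (sub_nonneg.2 h1.2) (neg_nonneg.2 hr'), mul_nonneg (by linarith [h1.1] : 0 ≤ b + b') (sub_nonneg.2 h1.2)]

/-- Hurwitz's theorem, boundary slices. -/
lemma hurwitz (q : ℂ[X][X]) (hq : ∀ x y : ℂ, 0 < x.im → 0 < y.im → q.evalEval x y ≠ 0) (x0 : ℝ)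
    (h0 : q.map (evalRingHom (x0 : ℂ)) ≠ 0) (y : ℂ) (hy : 0 < y.im) : (q.map (evalRingHom (x0:ℂ))).eval y ≠ 0 := by
  intro hz
  have hev : ∀ x y : ℂ, (q.map (evalRingHom x)).eval y = q.evalEval x y := fun x y => by
    rw [map_evalRingHom_eval]
  apply h0
  have key : ∀ b' : ℝ, |b'| ≤ y.im → q.evalEval (x0 : ℂ) (⟨y.re, b'⟩ : ℂ) = 0 := by
    intro b' hb'
    have h1 : ∀ ε : ℝ, 0 < ε → ‖q.evalEval ⟨x0, ε⟩ ⟨y.re, b'⟩‖ ≤ ‖q.evalEval ⟨x0, ε⟩ y‖ := by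
      intro ε hε
      rw [← hev, ← hev]
      exact norm_eval_mono _ (fun z hz => by rw [hev]; exact hq _ _ hε hz) y.re y.im b' hy.le hb'
    have hc : ∀ y : ℂ, Continuous fun ε : ℝ => ‖q.evalEval ⟨x0, ε⟩ y‖ := by
      intro y
      refine Continuous.norm ?_
      have : Continuous fun ε : ℝ => (⟨x0, ε⟩ : ℂ) := by
        have : (fun ε : ℝ => (⟨x0, ε⟩ : ℂ)) = fun ε : ℝ => (x0 : ℂ) + ε * Complex.I := by
          funext ε; apply Complex.ext <;> simp
        rw [this]; fun_prop
      exact (Polynomial.continuous _).comp this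
    have h2 : ‖q.evalEval ⟨x0, 0⟩ ⟨y.re, b'⟩‖ ≤ ‖q.evalEval ⟨x0, 0⟩ y‖ := by
      have t1 := ((hc ⟨y.re, b'⟩).tendsto 0).mono_left (nhdsWithin_le_nhds (s := Set.Ioi 0))
      have t2 := ((hc y).tendsto 0).mono_left (nhdsWithin_le_nhds (s := Set.Ioi 0))
      exact le_of_tendsto_of_tendsto t1 t2 (Filter.eventually_of_mem self_mem_nhdsWithin fun ε hε => h1 ε hε)
    rw [hev] at hz
    have h3 : (⟨x0, 0⟩ : ℂ) = (x0 : ℂ) := rfl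
    rw [h3, hz, norm_zero] at h2
    exact norm_le_zero_iff.1 h2
  apply eq_zero_of_infinite_isRoot
  refine Set.Infinite.mono (s := (fun b : ℝ => (⟨y.re, b⟩ : ℂ)) '' Set.Icc (-y.im) y.im) ?_ ?_
  · rintro _ ⟨b, hb, rfl⟩
    change (q.map (evalRingHom (x0:ℂ))).eval _ = 0
    rw [hev]
    exact key b (abs_le.2 hb)
  · refine Set.Infinite.image ?_ (Set.Icc_infinite (by linarith))
    intro b _ b' _ h
    exact congrArg Complex.im h

lemma coef_rel {m m' n : Type} [Fintype m] [Fintype m'] [Fintype n] (Xm : Matrix m n ℂ[X]) (Y : Matrix m' n ℂ[X]) {κ : Type} [Fintype κ]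
    (D : Matrix κ n ℂ[X]) (h : ∀ w x : ℂ, Ker Xm w x - Ker Y w x = (-Complex.I * (x - star w)) • Ker D w x) (i j : n) (a b : ℕ) :
    ∑ l, star ((Xm l i).coeff a) * (Xm l j).coeff b - ∑ l, star ((Y l i).coeff a) * (Y l j).coeff b =
      -Complex.I * ((if 1 ≤ b then ∑ l, star ((D l i).coeff a) * (D l j).coeff (b - 1) else 0) -
        (if 1 ≤ a then ∑ l, star ((D l i).coeff (a - 1)) * (D l j).coeff b else 0)) := by
  have hT : ∀ (N : Type) [Fintype N] (Z : Matrix N n ℂ[X]) (t : ℝ × ℝ),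
      ev2 t (∑ l, (star (Z l i)).map C * C (Z l j)) = Ker Z t.2 t.1 i j := by
    intro N _ Z t
    rw [map_sum]
    simp only [Ker, Matrix.mul_apply, Matrix.conjTranspose_apply, evM, Matrix.map_apply]
    refine Finset.sum_congr rfl fun l _ => ?_
    rw [map_mul]
    simp only [ev2, coe_evalEvalRingHom, evalEval_map_C, evalEval_C, eval_star_poly, star_real]
  have hC : ∀ (N : Type) [Fintype N] (Z : Matrix N n ℂ[X]) (a b : ℕ),
      ((∑ l, (star (Z l i)).map C * C (Z l j)).coeff a).coeff b = ∑ l, star ((Z l i).coeff a) * (Z l j).coeff b := by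
    intro N _ Z a b
    simp only [finset_sum_coeff, coeff_mul_C, coeff_map, coeff_C_mul, coeff_star_poly]
  have key : (∑ l, (star (Xm l i)).map C * C (Xm l j)) - (∑ l, (star (Y l i)).map C * C (Y l j)) =
      C (C (-Complex.I)) * (C X * (∑ l, (star (D l i)).map C * C (D l j)) - X * (∑ l, (star (D l i)).map C * C (D l j))) := by
    rw [← sub_eq_zero]
    apply ev2_inj
    intro t
    rw [map_sub, map_sub, map_mul, map_sub, map_mul, map_mul, hT, hT, hT]
    have := congrFun (congrFun (h t.2 t.1) i) j
    rw [Matrix.sub_apply, Matrix.smul_apply, smul_eq_mul, star_real] at this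
    rw [this]
    simp only [ev2, coe_evalEvalRingHom, evalEval_C, evalEval_X, eval_X, eval_C]
    ring
  have k2 := congrArg (fun p => (coeff p a).coeff b) key
  simp only [coeff_sub, hC] at k2
  rw [k2, coeff_C_mul, coeff_C_mul, coeff_sub, coeff_C_mul, coeff_sub, coeff_X_mul_ite, coeff_X_mul_ite]
  rw [hC]
  congr 2
  split_ifs
  · rw [hC]
  · simp

end Polynomial

namespace Polynomial
open Polynomial

lemma eval_star_real (c : ℂ[X]) (x0 : ℝ) : (star c).eval (x0 : ℂ) = star (c.eval (x0 : ℂ)) := by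
  rw [eval_star_poly, star_real]

lemma map_star_real (p : ℂ[X][X]) (x0 : ℝ) : (star p).map (evalRingHom (x0 : ℂ)) = star (p.map (evalRingHom (x0:ℂ))) := by
  ext1 a
  rw [coeff_map, coeff_star_poly, coeff_star_poly, coeff_map, coe_evalRingHom, eval_star_real]

section
variable {k μ : Type} [Fintype k] [DecidableEq k] [Fintype μ] [DecidableEq μ]

def bG (q : ℂ[X][X]) (P : Matrix μ k ℂ[X][X]) (i j : k) (a b : ℕ) : ℂ[X] :=
  (if i = j then star (q.coeff a) * q.coeff b else 0) - ∑ l, star ((P l i).coeff a) * (P l j).coeff b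

def bT (q : ℂ[X][X]) (P : Matrix μ k ℂ[X][X]) (i j : k) : ℕ → ℕ → ℂ[X]
  | 0, b => C (Complex.I / 2) * bG q P i j 0 (b + 1)
  | a + 1, b => C (Complex.I / 2) * bG q P i j (a + 1) (b + 1) + bT q P i j a (b + 1)

lemma bez_good (q : ℂ[X][X]) (P : Matrix μ k ℂ[X][X]) (hq : ∀ x y : ℂ, 0 < x.im → 0 < y.im → q.evalEval x y ≠ 0)
    (hP : (star q * q) • (1 : Matrix k k ℂ[X][X]) = P.conjTranspose * P) (x0 : ℝ) (h0 : q.map (evalRingHom (x0 : ℂ)) ≠ 0) :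
    ∃ (κ : Type) (_ : Fintype κ) (D : κ → k → ℕ → ℂ),
      (∀ i j a b, (bG q P i j a b).eval (x0:ℂ) = -Complex.I * ((if 1 ≤ b then ∑ l, star (D l i a) * D l j (b - 1) else 0) -
        (if 1 ≤ a then ∑ l, star (D l i (a - 1)) * D l j b else 0))) ∧
      ∀ i j a b, (bT q P i j a b).eval (x0:ℂ) = (1 / 2) * ∑ l, star (D l i a) * D l j b := by
  set q0 := q.map (evalRingHom (x0 : ℂ)) with hq0
  have hz := hurwitz q hq x0 h0
  have hent : ∀ i j, (if i = j then star q * q else 0) = ∑ l, star (P l i) * P l j := by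
    intro i j
    have := congrFun (congrFun hP i) j
    rw [Matrix.smul_apply, Matrix.one_apply, Matrix.mul_apply] at this
    simpa [Matrix.conjTranspose_apply] using this
  set X0 : Matrix k k ℂ[X] := Matrix.diagonal fun _ => q0 with hX0
  set P0 : Matrix μ k ℂ[X] := Matrix.of fun l j => (P l j).map (evalRingHom (x0:ℂ)) with hP0
  have hdet : X0.det = q0 ^ Fintype.card k := by rw [hX0, Matrix.det_diagonal, Finset.prod_const, Finset.card_univ]
  have hgram : X0.conjTranspose * X0 = P0.conjTranspose * P0 := by
    ext1 i j
    have h1 := congrArg (Polynomial.map (evalRingHom (x0:ℂ))) (hent i j)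
    rw [Polynomial.map_sum] at h1
    rw [hX0, Matrix.diagonal_conjTranspose, Matrix.diagonal_mul_diagonal, Matrix.diagonal_apply, Matrix.mul_apply]
    simp only [Polynomial.map_mul, map_star_real] at h1
    simp only [Matrix.conjTranspose_apply, hP0, Matrix.of_apply]
    rw [← h1]
    split_ifs
    · rw [Polynomial.map_mul, map_star_real]; rfl
    · rw [Polynomial.map_zero]
  obtain ⟨κ, _, D, hD⟩ := BZ X0 P0 (by rw [hdet]; exact pow_ne_zero _ h0) (fun z hz' => by
    rw [hdet, eval_pow]; exact pow_ne_zero _ (hz z hz')) hgram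
  have hG : ∀ i j a b, (bG q P i j a b).eval (x0:ℂ) =
      -Complex.I * ((if 1 ≤ b then ∑ l, star ((D l i).coeff a) * (D l j).coeff (b - 1) else 0) -
        (if 1 ≤ a then ∑ l, star ((D l i).coeff (a - 1)) * (D l j).coeff b else 0)) := by
    intro i j a b
    rw [← coef_rel X0 P0 D hD, bG, eval_sub, eval_finset_sum]
    congr 1
    · have e1 : ∀ l, star ((X0 l i).coeff a) * (X0 l j).coeff b = if l = i then (if i = j then star (q0.coeff a) * q0.coeff b else 0) else 0 := by
        intro l
        rw [hX0, Matrix.diagonal_apply, Matrix.diagonal_apply]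
        by_cases hl : l = i
        · subst hl
          by_cases hij : l = j <;> simp [hij]
        · simp [hl]
      rw [Finset.sum_congr rfl fun l _ => e1 l, Finset.sum_ite_eq' Finset.univ i, if_pos (Finset.mem_univ _)]
      split_ifs
      · rw [eval_mul, eval_star_real, hq0, coeff_map, coeff_map]; rfl
      · simp
    · refine Finset.sum_congr rfl fun l _ => ?_
      rw [eval_mul, eval_star_real]
      simp [hP0]
  refine ⟨κ, inferInstance, fun l i a => (D l i).coeff a, hG, ?_⟩
  intro i j a
  induction a with
  | zero =>
    intro b
    rw [bT, eval_mul, eval_C, hG]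
    rw [if_pos (by omega), if_neg (by omega), Nat.add_sub_cancel, sub_zero]
    linear_combination (-1 / 2 * (∑ l, star ((D l i).coeff 0) * (D l j).coeff b)) * Complex.I_mul_I
  | succ a ih =>
    intro b
    rw [bT, eval_add, eval_mul, eval_C, hG, ih]
    simp only [Nat.le_add_left, if_true, Nat.add_sub_cancel]
    linear_combination (-1 / 2 * (∑ l, star ((D l i).coeff (a+1)) * (D l j).coeff b - ∑ l, star ((D l i).coeff a) * (D l j).coeff (b + 1))) * Complex.I_mul_I

/-- Polynomials agreeing at all good real points agree. -/
lemma eq_of_good (q : ℂ[X][X]) (hq0 : q ≠ 0) (f g : ℂ[X])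
    (h : ∀ x0 : ℝ, q.map (evalRingHom (x0 : ℂ)) ≠ 0 → f.eval (x0:ℂ) = g.eval (x0:ℂ)) : f = g := by
  rw [← sub_eq_zero]
  have h1 : (f - g) * q.leadingCoeff = 0 := by
    apply eq_zero_of_real
    intro x
    rw [eval_mul]
    by_cases hx : q.map (evalRingHom (x : ℂ)) = 0
    · have := congrArg (fun p => coeff p q.natDegree) hx
      simp only [coeff_map, coeff_zero] at this
      rw [leadingCoeff]
      rw [coe_evalRingHom] at this
      rw [this, mul_zero]
    · rw [eval_sub, h x hx, sub_self, zero_mul]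
  exact (mul_eq_zero.1 h1).resolve_right (leadingCoeff_ne_zero.2 hq0)

lemma finite_bad (q : ℂ[X][X]) (hq0 : q ≠ 0) : {x0 : ℝ | q.map (evalRingHom (x0 : ℂ)) = 0}.Finite := by
  have h1 : {z : ℂ | q.leadingCoeff.IsRoot z}.Finite := by
    by_contra hcon
    exact leadingCoeff_ne_zero.2 hq0 (eq_zero_of_infinite_isRoot _ hcon)
  refine (h1.preimage (f := fun x : ℝ => (x : ℂ)) (Complex.ofReal_injective.injOn)).subset ?_
  intro x hx
  have := congrArg (fun p => coeff p q.natDegree) hx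
  simp only [coeff_map, coeff_zero] at this
  exact this

/-- The Bezoutian factorization. -/
theorem bez_factor (q : ℂ[X][X]) (P : Matrix μ k ℂ[X][X]) (hq : ∀ x y : ℂ, 0 < x.im → 0 < y.im → q.evalEval x y ≠ 0)
    (hP : (star q * q) • (1 : Matrix k k ℂ[X][X]) = P.conjTranspose * P) (d : ℕ) (hdq : q.natDegree ≤ d)
    (hdP : ∀ i j, (P i j).natDegree ≤ d) :
    ∃ (s : ℕ) (A : Matrix (Fin s) (k × Fin d) ℂ[X]),
      (∀ x : ℂ, 0 < x.im → ∀ u, Matrix.vecMul u (evM A x) = 0 → u = 0) ∧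
      (∀ i j (a b : Fin d), ∑ l, star (A l (i, a)) * A l (j, b) = bT q P i j a b) ∧
      (∀ i j a b, (d ≤ a ∨ d ≤ b) → bT q P i j a b = 0) ∧
      (∀ i j a b, bG q P i j a b = C (-2 * Complex.I) * ((if 1 ≤ b then bT q P i j a (b - 1) else 0) -
        (if 1 ≤ a then bT q P i j (a - 1) b else 0))) := by
  have hq0 : q ≠ 0 := by
    rintro rfl
    exact hq Complex.I Complex.I (by simp) (by simp) (by simp)
  have hG : ∀ i j a b, bG q P i j a b = C (-2 * Complex.I) * ((if 1 ≤ b then bT q P i j a (b - 1) else 0) -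
        (if 1 ≤ a then bT q P i j (a - 1) b else 0)) := by
    intro i j a b
    apply eq_of_good q hq0
    intro x0 hx0
    obtain ⟨κ, _, D, hD1, hD2⟩ := bez_good q P hq hP x0 hx0
    rw [hD1, eval_mul, eval_C, eval_sub]
    split_ifs <;> simp only [hD2, eval_zero] <;> ring
  have hherm : ∀ i j a b, star (bT q P i j a b) = bT q P j i b a := by
    intro i j a b
    apply eq_of_good q hq0
    intro x0 hx0
    obtain ⟨κ, _, D, hD1, hD2⟩ := bez_good q P hq hP x0 hx0
    rw [eval_star_real, hD2, hD2, star_mul', star_sum]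
    congr 1
    · simp
    · exact Finset.sum_congr rfl fun l _ => by rw [star_mul', star_star, mul_comm]
  have hG0 : ∀ i j a b, d < b → bG q P i j a b = 0 := by
    intro i j a b hb
    rw [bG, coeff_eq_zero_of_natDegree_lt (lt_of_le_of_lt hdq hb)]
    simp [coeff_eq_zero_of_natDegree_lt (lt_of_le_of_lt (hdP _ _) hb)]
  have hT0 : ∀ i j a b, d ≤ b → bT q P i j a b = 0 := by
    intro i j a
    induction a with
    | zero => intro b hb; rw [bT, hG0 _ _ _ _ (by omega), mul_zero]
    | succ a ih => intro b hb; rw [bT, hG0 _ _ _ _ (by omega), mul_zero, ih _ (by omega), add_zero]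
  have hT0' : ∀ i j a b, (d ≤ a ∨ d ≤ b) → bT q P i j a b = 0 := by
    rintro i j a b (h | h)
    · rw [← hherm, hT0 _ _ _ _ h, star_zero]
    · exact hT0 _ _ _ _ h
  set Tm : Matrix (k × Fin d) (k × Fin d) ℂ[X] := Matrix.of fun p r => bT q P p.1 r.1 p.2 r.2 with hTm
  have hTh : Tm.conjTranspose = Tm := by
    ext1 p r
    rw [Matrix.conjTranspose_apply, hTm, Matrix.of_apply, Matrix.of_apply, hherm]
  obtain ⟨s, X1, S, S', hXS, hSS, hinj⟩ := PIDlem Tm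
  have hTS : Tm = Tm * S' * S := by
    conv_rhs => rw [hXS, Matrix.mul_assoc X1, hSS, Matrix.mul_one]
    exact hXS
  set T1 := S'.conjTranspose * Tm * S' with hT1
  have hTT : Tm = S.conjTranspose * T1 * S := by
    have h1 : Tm = S.conjTranspose * S'.conjTranspose * Tm := by
      have := congrArg Matrix.conjTranspose hTS
      rw [Matrix.conjTranspose_mul, Matrix.conjTranspose_mul, hTh] at this
      rw [Matrix.mul_assoc]; exact this
    rw [hT1]
    calc Tm = Tm * S' * S := hTS
      _ = (S.conjTranspose * S'.conjTranspose * Tm) * S' * S := by rw [← h1]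
      _ = _ := by simp only [Matrix.mul_assoc]
  have hdet : T1.det ≠ 0 := by
    intro h1
    obtain ⟨v, hv, hv0⟩ := Matrix.exists_mulVec_eq_zero_iff.2 h1
    apply hv
    apply hinj
    have h2 : Tm * S' = X1 := by rw [hXS, Matrix.mul_assoc, hSS, Matrix.mul_one]
    have h3 : Tm * S' = S.conjTranspose * T1 := by rw [hTT, Matrix.mul_assoc, hSS, Matrix.mul_one]
    rw [← h2, h3, ← Matrix.mulVec_mulVec, hv0, Matrix.mulVec_zero]
  have hpsd : PSDm ev1 T1 := by
    refine ⟨?_, ?_⟩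
    · rw [hT1, Matrix.conjTranspose_mul, Matrix.conjTranspose_mul, hTh, Matrix.conjTranspose_conjTranspose, Matrix.mul_assoc]
    · intro t v
      have e1 : ∑ i, ∑ j, star (v i) * ev1 t (T1 i j) * v j = (∑ i, ∑ j, C (star (v i)) * T1 i j * C (v j)).eval (t:ℂ) := by
        simp only [eval_finset_sum, eval_mul, eval_C]; rfl
      rw [e1]
      refine re_nonneg_of_dense _ _ (finite_bad q hq0) ?_ t
      intro x0 hx0
      obtain ⟨κ, _, D, hD1, hD2⟩ := bez_good q P hq hP x0 hx0
      set Dm : Matrix κ (k × Fin d) ℂ := Matrix.of fun l p => D l p.1 p.2 with hDm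
      have e2 : evM Tm x0 = (1 / 2 : ℂ) • (Dm.conjTranspose * Dm) := by
        ext p r
        rw [Matrix.smul_apply, Matrix.mul_apply, smul_eq_mul]
        exact hD2 _ _ _ _
      have e3 : evM T1 x0 = (1 / 2 : ℂ) • ((Dm * evM S' x0).conjTranspose * (Dm * evM S' x0)) := by
        rw [hT1, evM_mul, evM_mul, evM_conjTranspose, star_real, e2, Matrix.conjTranspose_mul]
        simp only [Matrix.mul_smul, Matrix.smul_mul, Matrix.mul_assoc]
      set E := Dm * evM S' x0 with hE
      have e4 : (∑ i, ∑ j, C (star (v i)) * T1 i j * C (v j)).eval (x0:ℂ) =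
          ((1 / 2 * ∑ l, Complex.normSq (Matrix.mulVec E v l) : ℝ) : ℂ) := by
        simp only [eval_finset_sum, eval_mul, eval_C]
        have e5 : ∀ i j, (T1 i j).eval (x0:ℂ) = 1 / 2 * ∑ l, star (E l i) * E l j := by
          intro i j
          have := congrFun (congrFun e3 i) j
          rw [Matrix.smul_apply, Matrix.mul_apply, smul_eq_mul] at this
          exact this
        have e6 : ∀ l, ((Complex.normSq (Matrix.mulVec E v l) : ℝ) : ℂ) = ∑ i, ∑ j, star (v i) * (star (E l i) * E l j) * v j := by
          intro l
          rw [Complex.normSq_eq_conj_mul_self]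
          simp only [Matrix.mulVec, dotProduct, map_sum, map_mul, Finset.sum_mul_sum]
          refine Finset.sum_congr rfl fun i _ => Finset.sum_congr rfl fun j _ => ?_
          simp only [starRingEnd_apply]; ring
        conv_rhs => rw [Complex.ofReal_mul, Complex.ofReal_sum, Finset.sum_congr rfl fun l _ => e6 l, Finset.sum_comm, Finset.mul_sum]
        refine Finset.sum_congr rfl fun i _ => ?_
        conv_rhs => rw [Finset.sum_comm, Finset.mul_sum]
        refine Finset.sum_congr rfl fun j _ => ?_
        rw [e5, Finset.mul_sum, Finset.mul_sum, Finset.sum_mul, Finset.mul_sum]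
        refine Finset.sum_congr rfl fun l _ => ?_
        push_cast; ring
      rw [e4, Complex.ofReal_re]
      exact mul_nonneg (by norm_num) (Finset.sum_nonneg fun l _ => Complex.normSq_nonneg _)
  obtain ⟨A1, hA1, hA1d⟩ := FR s T1 hpsd hdet
  refine ⟨s, A1 * S, ?_, ?_, hT0', hG⟩
  · intro x hx u hu
    have h1 : Matrix.vecMul u (evM A1 x) = 0 := by
      have e1 : A1 = A1 * S * S' := by rw [Matrix.mul_assoc, hSS, Matrix.mul_one]
      rw [e1, evM_mul, ← Matrix.vecMul_vecMul, hu, Matrix.zero_vecMul]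
    by_contra hne
    apply hA1d x hx
    rw [← evM_det]
    exact Matrix.exists_vecMul_eq_zero_iff.1 ⟨u, hne, h1⟩
  · intro i j a b
    have h1 : (A1 * S).conjTranspose * (A1 * S) = Tm := by
      rw [hTT, ← hA1, Matrix.conjTranspose_mul]
      simp only [Matrix.mul_assoc]
    have := congrFun (congrFun h1 (i, a)) (j, b)
    rw [Matrix.mul_apply] at this
    exact this
end
end Polynomial

namespace Polynomial
open Polynomial

section
variable {k μ : Type} [Fintype k] [DecidableEq k] [Fintype μ] [DecidableEq μ]

/-- matrix of coefficients in the outer variable -/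
def cf (d : ℕ) (Z : Matrix μ k ℂ[X][X]) : Matrix μ (k × Fin (d + 1)) ℂ[X] := Matrix.of fun l p => (Z l p.1).coeff p.2

def mono (k : Type) [DecidableEq k] (d : ℕ) (y : ℂ) : Matrix (k × Fin (d + 1)) k ℂ := Matrix.of fun p j => if p.1 = j then y ^ (p.2 : ℕ) else 0

def eeM (Z : Matrix μ k ℂ[X][X]) (x y : ℂ) : Matrix μ k ℂ := Z.map (evalEval x y)

lemma cf_eval (d : ℕ) (Z : Matrix μ k ℂ[X][X]) (h : ∀ l j, (Z l j).natDegree ≤ d) (x y : ℂ) :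
    evM (cf d Z) x * mono k d y = eeM Z x y := by
  ext l j
  rw [Matrix.mul_apply, Fintype.sum_prod_type]
  simp only [evM, cf, mono, Matrix.map_apply, Matrix.of_apply, mul_ite, mul_zero]
  rw [Finset.sum_eq_single j]
  · simp only [if_true, eeM, Matrix.map_apply]
    rw [← map_evalRingHom_eval, eval_eq_sum_range' (n := d + 1) (lt_of_le_of_lt natDegree_map_le (Nat.lt_succ_of_le (h l j)))]
    rw [← Fin.sum_univ_eq_sum_range]
    simp
  · intro b _ hb
    simp [hb]
  · simp

theorem kummert0 (q : ℂ[X][X]) (P : Matrix μ k ℂ[X][X]) (hq : ∀ x y : ℂ, 0 < x.im → 0 < y.im → q.evalEval x y ≠ 0)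
    (hP : (star q * q) • (1 : Matrix k k ℂ[X][X]) = P.conjTranspose * P) :
    ∃ (κ₁ κ₂ : Type) (_ : Fintype κ₁) (_ : Fintype κ₂) (A₁ : ℂ → ℂ → Matrix κ₁ k ℂ) (A₂ : ℂ → ℂ → Matrix κ₂ k ℂ),
      ∀ x y w v : ℂ, (star (q.evalEval w v) * q.evalEval x y) • (1 : Matrix k k ℂ) - (eeM P w v).conjTranspose * eeM P x y =
        (-Complex.I * (x - star w)) • ((A₁ w v).conjTranspose * A₁ x y) +
        (-2 * Complex.I * (y - star v)) • ((A₂ w v).conjTranspose * A₂ x y) := by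
  obtain ⟨d, hdq, hdP⟩ : ∃ d, q.natDegree ≤ d ∧ ∀ i j, (P i j).natDegree ≤ d := by
    refine ⟨q.natDegree + ∑ i, ∑ j, (P i j).natDegree, by omega, fun i j => ?_⟩
    have h1 := Finset.single_le_sum (f := fun i => ∑ j, (P i j).natDegree) (fun _ _ => Nat.zero_le _) (Finset.mem_univ i)
    have h2 := Finset.single_le_sum (f := fun j => (P i j).natDegree) (fun _ _ => Nat.zero_le _) (Finset.mem_univ j)
    omega
  obtain ⟨s, A, hA, hAT, hT0, hG⟩ := bez_factor q P hq hP d hdq hdP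
  set 𝒜 : Fin s → k → ℂ[X][X] := fun l j => ∑ b : Fin d, C (A l (j, b)) * X ^ (b : ℕ) with h𝒜
  have hco : ∀ l j (b : ℕ), (𝒜 l j).coeff b = if h : b < d then A l (j, ⟨b, h⟩) else 0 := by
    intro l j b
    simp only [h𝒜, finset_sum_coeff, coeff_C_mul, coeff_X_pow]
    split_ifs with h
    · rw [Finset.sum_eq_single (⟨b, h⟩ : Fin d)]
      · simp
      · intro c _ hc
        rw [if_neg (fun h' => hc (Fin.ext h'.symm)), mul_zero]
      · simp
    · refine Finset.sum_eq_zero fun c _ => ?_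
      rw [if_neg (fun h' => h (by have := c.2; omega)), mul_zero]
  have hTT : ∀ i j a b, ∑ l, star ((𝒜 l i).coeff a) * (𝒜 l j).coeff b = bT q P i j a b := by
    intro i j a b
    by_cases ha : a < d
    · by_cases hb : b < d
      · rw [← hAT i j ⟨a, ha⟩ ⟨b, hb⟩]
        exact Finset.sum_congr rfl fun l _ => by rw [hco, hco, dif_pos ha, dif_pos hb]
      · rw [hT0 i j a b (Or.inr (by omega))]
        exact Finset.sum_eq_zero fun l _ => by rw [hco l j b, dif_neg hb, mul_zero]
    · rw [hT0 i j a b (Or.inl (by omega))]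
      exact Finset.sum_eq_zero fun l _ => by rw [hco l i a, dif_neg ha, star_zero, zero_mul]
  have hcc : ∀ (c : ℂ) l j b, ((X + C (C c)) * 𝒜 l j).coeff b = (if 1 ≤ b then (𝒜 l j).coeff (b - 1) else 0) + C c * (𝒜 l j).coeff b := by
    intro c l j b
    rw [add_mul, coeff_add, coeff_X_mul_ite, coeff_C_mul]
  have hdA : ∀ (c : ℂ) l j, ((X + C (C c)) * 𝒜 l j).natDegree ≤ d := by
    intro c l j
    rw [natDegree_le_iff_coeff_eq_zero]
    intro b hb
    rw [hcc, hco, hco, dif_neg (by omega), dif_neg (by omega), mul_zero, ite_self, add_zero]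
  set Q1 : ℂ → Matrix (Fin s) k ℂ[X][X] := fun c => Matrix.of fun l j => (X + C (C c)) * 𝒜 l j with hQ1
  set Xp : Matrix (k ⊕ Fin s) k ℂ[X][X] := Matrix.fromRows (Matrix.diagonal fun _ => q) (Q1 (-Complex.I)) with hXp
  set Yp : Matrix (μ ⊕ Fin s) k ℂ[X][X] := Matrix.fromRows P (Q1 Complex.I) with hYp
  have hdX : ∀ l j, (Xp l j).natDegree ≤ d := by
    rintro (l | l) j
    · simp only [hXp, Matrix.fromRows_apply_inl, Matrix.diagonal_apply]
      split_ifs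
      · exact hdq
      · simp
    · exact hdA _ _ _
  have hdY : ∀ l j, (Yp l j).natDegree ≤ d := by
    rintro (l | l) j
    · exact hdP _ _
    · exact hdA _ _ _
  have hgram : (cf d Xp).conjTranspose * cf d Xp = (cf d Yp).conjTranspose * cf d Yp := by
    ext1 p r
    obtain ⟨i, a⟩ := p
    obtain ⟨j, b⟩ := r
    rw [Matrix.mul_apply, Matrix.mul_apply, Fintype.sum_sum_type, Fintype.sum_sum_type]
    simp only [Matrix.conjTranspose_apply, cf, Matrix.of_apply, hXp, hYp, Matrix.fromRows_apply_inl, Matrix.fromRows_apply_inr, hQ1]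
    generalize (a : ℕ) = a
    generalize (b : ℕ) = b
    have e1 : ∑ l, star (coeff (Matrix.diagonal (fun _ => q) l i) a) * coeff (Matrix.diagonal (fun _ => q) l j) b =
        bG q P i j a b + ∑ l, star ((P l i).coeff a) * (P l j).coeff b := by
      rw [bG, sub_add_cancel, Finset.sum_eq_single i]
      · by_cases hij : i = j
        · subst hij; simp
        · simp [hij]
      · intro l _ hl
        simp [hl]
      · simp
    have e2 : ∀ c : ℂ, star c = - c → star c * c = 1 → ∑ l, star (((X + C (C c)) * 𝒜 l i).coeff a) * ((X + C (C c)) * 𝒜 l j).coeff b =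
        (if 1 ≤ a ∧ 1 ≤ b then bT q P i j (a - 1) (b - 1) else 0) + bT q P i j a b +
         C c * ((if 1 ≤ a then bT q P i j (a - 1) b else 0) - (if 1 ≤ b then bT q P i j a (b - 1) else 0)) := by
      intro c hc hc1
      have hc2 : star (C c) * C c = (1 : ℂ[X]) := by rw [star_poly_C, ← C_mul, hc1, C_1]
      have hc3 : star (C c) = - C c := by rw [star_poly_C, hc, C_neg]
      simp only [hcc, star_add, star_mul']
      have e3 : ∀ l, (star (if 1 ≤ a then (𝒜 l i).coeff (a - 1) else 0) + star (C c) * star ((𝒜 l i).coeff a)) *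
          ((if 1 ≤ b then (𝒜 l j).coeff (b - 1) else 0) + C c * (𝒜 l j).coeff b) =
          (if 1 ≤ a ∧ 1 ≤ b then star ((𝒜 l i).coeff (a - 1)) * (𝒜 l j).coeff (b - 1) else 0) + star ((𝒜 l i).coeff a) * (𝒜 l j).coeff b
          + C c * ((if 1 ≤ a then star ((𝒜 l i).coeff (a - 1)) * (𝒜 l j).coeff b else 0) -
            (if 1 ≤ b then star ((𝒜 l i).coeff a) * (𝒜 l j).coeff (b - 1) else 0)) := by
        intro l
        by_cases h1 : 1 ≤ a <;> by_cases h2 : 1 ≤ b <;>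
          simp only [h1, h2, if_true, if_false, and_self, and_true, and_false, star_zero]
        · linear_combination (star ((𝒜 l i).coeff a) * (𝒜 l j).coeff b) * hc2 + (star ((𝒜 l i).coeff a) * (𝒜 l j).coeff (b-1)) * hc3
        · linear_combination (star ((𝒜 l i).coeff a) * (𝒜 l j).coeff b) * hc2
        · linear_combination (star ((𝒜 l i).coeff a) * (𝒜 l j).coeff b) * hc2 + (star ((𝒜 l i).coeff a) * (𝒜 l j).coeff (b-1)) * hc3
        · linear_combination (star ((𝒜 l i).coeff a) * (𝒜 l j).coeff b) * hc2
      rw [Finset.sum_congr rfl fun l _ => e3 l, Finset.sum_add_distrib, Finset.sum_add_distrib, ← Finset.mul_sum, Finset.sum_sub_distrib, hTT]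
      congr 2
      · congr 1
        split_ifs
        · rw [hTT]
        · simp
      · congr 1
        · split_ifs
          · rw [hTT]
          · simp
        · split_ifs
          · rw [hTT]
          · simp
    rw [e1, e2 (-Complex.I) (by simp) (by simp), e2 Complex.I (by simp) (by simp), hG]
    simp only [C_mul, C_neg]
    have : (C (2:ℂ) : ℂ[X]) = 2 := rfl
    rw [this]
    ring
  have hrank : ∀ z : ℂ, 0 < z.im → ∀ u : k ⊕ Fin s → ℂ, Matrix.vecMul u (evM (cf d Xp) z) = 0 → u = 0 := by
    intro z hz u hu
    have h1 : ∀ j, ∑ l, C (u l) * (Xp l j).map (evalRingHom z) = 0 := by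
      intro j
      ext1 b
      simp only [finset_sum_coeff, coeff_C_mul, coeff_map, coeff_zero, coe_evalRingHom]
      by_cases hb : b < d + 1
      · exact congrFun hu (j, ⟨b, hb⟩)
      · refine Finset.sum_eq_zero fun l _ => ?_
        rw [coeff_eq_zero_of_natDegree_lt (lt_of_le_of_lt (hdX l j) (by omega)), eval_zero, mul_zero]
    have h2 : ∀ j, C (u (Sum.inl j)) * q.map (evalRingHom z) + (X - C Complex.I) * ∑ l, C (u (Sum.inr l)) * (𝒜 l j).map (evalRingHom z) = 0 := by
      intro j
      rw [← h1 j, Fintype.sum_sum_type]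
      congr 1
      · rw [Finset.sum_eq_single j]
        · simp [hXp]
        · intro i _ hi
          simp [hXp, hi]
        · simp
      · rw [Finset.mul_sum]
        refine Finset.sum_congr rfl fun l _ => ?_
        simp only [hXp, hQ1, Matrix.fromRows_apply_inr, Matrix.of_apply, Polynomial.map_mul, Polynomial.map_add, Polynomial.map_X, Polynomial.map_C, coe_evalRingHom, eval_C, C_neg, Polynomial.map_neg]
        ring
    have h3 : ∀ j, u (Sum.inl j) = 0 := by
      intro j
      have := congrArg (eval Complex.I) (h2 j)
      simp only [eval_add, eval_mul, eval_sub, eval_X, eval_C, sub_self, zero_mul, add_zero, eval_zero, map_evalRingHom_eval] at this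
      exact (mul_eq_zero.1 this).resolve_right (hq z Complex.I hz (by simp))
    have h4 : (fun l => u (Sum.inr l)) = 0 := by
      apply hA z hz
      ext1 p
      obtain ⟨j, b⟩ := p
      have h5 := h2 j
      rw [h3, C_0, zero_mul, zero_add] at h5
      have h6 := congrArg (fun p => coeff p (b : ℕ)) ((mul_eq_zero.1 h5).resolve_left (X_sub_C_ne_zero _))
      simp only [finset_sum_coeff, coeff_C_mul, coeff_map, coeff_zero, coe_evalRingHom, hco, dif_pos b.2] at h6
      exact h6
    ext1 l
    rcases l with l | l
    · exact h3 l
    · exact congrFun h4 l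
  obtain ⟨κ, _, E, hE⟩ := BZ' (cf d Xp) (cf d Yp) hrank hgram
  refine ⟨κ, Fin s, inferInstance, inferInstance, fun x y => evM E x * mono k d y, fun x y => eeM (Matrix.of 𝒜) x y, ?_⟩
  intro x y w v
  have h1 := congrArg (fun M => (mono k d v).conjTranspose * M * mono k d y) (hE w x)
  have h2 : ∀ (N : Type) [Fintype N] [DecidableEq N] (Z : Matrix N k ℂ[X][X]), (∀ l j, (Z l j).natDegree ≤ d) →
      (mono k d v).conjTranspose * Ker (cf d Z) w x * mono k d y = (eeM Z w v).conjTranspose * eeM Z x y := by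
    intro N _ _ Z hZ
    rw [← cf_eval d Z hZ, ← cf_eval d Z hZ, Matrix.conjTranspose_mul, Ker]
    simp only [Matrix.mul_assoc]
  have h3 : ∀ (N : Type) [Fintype N] (A : Matrix N k ℂ[X][X]) (c : ℂ), ∀ (B : Matrix (Fin s) k ℂ[X][X]), B = Q1 c →
      (eeM (Matrix.fromRows A B) w v).conjTranspose * eeM (Matrix.fromRows A B) x y =
      (eeM A w v).conjTranspose * eeM A x y + (star (v + c) * (y + c)) • ((eeM (Matrix.of 𝒜) w v).conjTranspose * eeM (Matrix.of 𝒜) x y) := by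
    intro N _ A c B hB
    subst hB
    ext i j
    simp only [Matrix.mul_apply, Matrix.add_apply, Matrix.smul_apply, Fintype.sum_sum_type, eeM, Matrix.map_apply, Matrix.conjTranspose_apply,
      Matrix.fromRows_apply_inl, Matrix.fromRows_apply_inr, hQ1, Matrix.of_apply, smul_eq_mul, Finset.mul_sum]
    congr 1
    refine Finset.sum_congr rfl fun l _ => ?_
    simp only [evalEval_mul, evalEval_add, evalEval_X, evalEval_C, eval_C, star_mul']
    ring
  rw [Matrix.mul_sub, Matrix.sub_mul, h2 _ Xp hdX, h2 _ Yp hdY, hXp, hYp, h3 _ _ _ _ rfl, h3 _ _ _ _ rfl, Matrix.mul_smul, Matrix.smul_mul] at h1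
  have h4 : (eeM (Matrix.diagonal fun (_ : k) => q) w v).conjTranspose * eeM (Matrix.diagonal fun (_ : k) => q) x y =
      (star (q.evalEval w v) * q.evalEval x y) • (1 : Matrix k k ℂ) := by
    have h5 : ∀ x y, eeM (Matrix.diagonal fun (_ : k) => q) x y = Matrix.diagonal fun _ => q.evalEval x y := by
      intro x y
      rw [eeM, Matrix.diagonal_map (by simp)]
    rw [h5, h5, Matrix.diagonal_conjTranspose, Matrix.diagonal_mul_diagonal, Matrix.smul_one_eq_diagonal]
    rfl
  have h6 : (mono k d v).conjTranspose * Ker E w x * mono k d y = (evM E w * mono k d v).conjTranspose * (evM E x * mono k d y) := by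
    rw [Matrix.conjTranspose_mul, Ker]
    simp only [Matrix.mul_assoc]
  rw [h4, h6] at h1
  rw [← h1]
  have h7 : -2 * Complex.I * (y - star v) = star (v + Complex.I) * (y + Complex.I) - star (v + -Complex.I) * (y + -Complex.I) := by
    simp only [star_add, star_neg, Complex.star_def, Complex.conj_I]; ring
  rw [h7]
  module
end
end Polynomial

namespace Polynomial
open Polynomial

lemma smul_gram {k κ : Type} [Fintype k] [Fintype κ] (r s : ℂ) (M N : Matrix κ k ℂ) :
    (r • M).conjTranspose * (s • N) = (star r * s) • (M.conjTranspose * N) := by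
  rw [Matrix.conjTranspose_smul, Matrix.smul_mul, Matrix.mul_smul, smul_smul]

theorem kummert {μ : Type} [Fintype μ] [DecidableEq μ] (n : ℕ) (q : ℂ[X][X]) (P : Matrix μ (Fin n) ℂ[X][X])
    (hq : ∀ x y : ℂ, 0 < x.im → 0 < y.im → q.evalEval x y ≠ 0)
    (hF : PSDm ev2 ((star q * q) • (1 : Matrix (Fin n) (Fin n) ℂ[X][X]) - P.conjTranspose * P)) :
    ∃ (κ₁ κ₂ κ₃ : Type) (_ : Fintype κ₁) (_ : Fintype κ₂) (_ : Fintype κ₃) (A₁ : ℂ → ℂ → Matrix κ₁ (Fin n) ℂ)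
      (A₂ : ℂ → ℂ → Matrix κ₂ (Fin n) ℂ) (A₃ : ℂ → ℂ → Matrix κ₃ (Fin n) ℂ),
      ∀ x y w v : ℂ, 0 < x.im → 0 < y.im → 0 < w.im → 0 < v.im → (1 : Matrix (Fin n) (Fin n) ℂ) -
          ((q.evalEval w v)⁻¹ • eeM P w v).conjTranspose * ((q.evalEval x y)⁻¹ • eeM P x y) =
        (-Complex.I * (x - star w)) • ((A₁ w v).conjTranspose * A₁ x y) +
        (-2 * Complex.I * (y - star v)) • ((A₂ w v).conjTranspose * A₂ x y) + (A₃ w v).conjTranspose * A₃ x y := by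
  obtain ⟨c, κ, _, _, Q, hc, hQ⟩ := sos2 n _ hF
  set q' := C c * q with hq'
  have hee : ∀ x y, q'.evalEval x y = c.eval x * q.evalEval x y := by
    intro x y; rw [hq', evalEval_mul, evalEval_C]
  set P' := Matrix.fromRows ((C c) • P) Q with hP'
  have hgram : (star q' * q') • (1 : Matrix (Fin n) (Fin n) ℂ[X][X]) = P'.conjTranspose * P' := by
    rw [hP', Matrix.conjTranspose_fromRows_eq_fromCols_conjTranspose, Matrix.fromCols_mul_fromRows, hQ, Matrix.conjTranspose_smul,
      Matrix.smul_mul, Matrix.mul_smul, smul_smul, smul_sub, smul_smul, hq', star_mul', star_poly_C, C_mul]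
    have : C (star c) * star q * (C c * q) = C (star c) * C c * (star q * q) := by ring
    rw [this]
    abel
  obtain ⟨κ₁, κ₂, _, _, A₁, A₂, h⟩ := kummert0 q' P' (fun x y hx hy => by
    rw [hee]; exact mul_ne_zero (hc x hx) (hq x y hx hy)) hgram
  refine ⟨κ₁, κ₂, κ, inferInstance, inferInstance, inferInstance, fun x y => (q'.evalEval x y)⁻¹ • A₁ x y,
    fun x y => (q'.evalEval x y)⁻¹ • A₂ x y, fun x y => (q'.evalEval x y)⁻¹ • eeM Q x y, ?_⟩
  intro x y w v hx hy hw hv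
  have hx' : q'.evalEval x y ≠ 0 := by rw [hee]; exact mul_ne_zero (hc x hx) (hq x y hx hy)
  have hw' : q'.evalEval w v ≠ 0 := by rw [hee]; exact mul_ne_zero (hc w hw) (hq w v hw hv)
  have h1 := h x y w v
  have h2 : (eeM P' w v).conjTranspose * eeM P' x y = (star (c.eval w) * c.eval x) • ((eeM P w v).conjTranspose * eeM P x y) +
      (eeM Q w v).conjTranspose * eeM Q x y := by
    rw [← smul_gram]
    have h3 : ∀ x y, eeM P' x y = Matrix.fromRows (c.eval x • eeM P x y) (eeM Q x y) := by
      intro x y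
      ext l j
      rcases l with l | l
      · simp [eeM, hP', evalEval_mul, evalEval_C]
      · simp [eeM, hP']
    rw [h3, h3, Matrix.conjTranspose_fromRows_eq_fromCols_conjTranspose, Matrix.fromCols_mul_fromRows]
  rw [h2] at h1
  simp only [smul_gram]
  have hs : star (q'.evalEval w v) ≠ 0 := star_ne_zero.2 hw'
  set r := star (q'.evalEval w v)⁻¹ * (q'.evalEval x y)⁻¹ with hr
  have hr1 : r * (star (q'.evalEval w v) * q'.evalEval x y) = 1 := by
    rw [hr, star_inv₀]; field_simp
  have hr2 : r * (star (c.eval w) * c.eval x) = star (q.evalEval w v)⁻¹ * (q.evalEval x y)⁻¹ := by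
    have e1 : star (c.eval w) ≠ 0 := star_ne_zero.2 (hc w hw)
    have e2 := hc x hx
    have e3 : star (q.evalEval w v) ≠ 0 := star_ne_zero.2 (hq w v hw hv)
    have e4 := hq x y hx hy
    rw [hr, star_inv₀, star_inv₀, hee, hee, star_mul']
    field_simp
  have h4 := congrArg (fun M => r • M) h1
  simp only [smul_sub, smul_add, smul_smul, hr1, hr2, one_smul] at h4
  rw [smul_smul, smul_smul, mul_comm _ r, mul_comm _ r, ← h4]
  abel

end Polynomial

namespace Polynomial
open Polynomial

def cay (x : ℂ) : ℂ := (x - Complex.I) / (x + Complex.I)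

lemma homog (r : MvPolynomial (Fin 2) ℂ) : ∃ D0 : ℕ, ∀ D, D0 ≤ D → ∃ R : ℂ[X][X], ∀ x y : ℂ, x + Complex.I ≠ 0 → y + Complex.I ≠ 0 →
    R.evalEval x y = ((x + Complex.I) * (y + Complex.I)) ^ D * MvPolynomial.eval ![cay x + cay y, cay x * cay y] r := by
  induction r using MvPolynomial.induction_on with
  | C a =>
    refine ⟨0, fun D _ => ⟨(C (X + C Complex.I) * (X + C (C Complex.I))) ^ D * C (C a), fun x y _ _ => ?_⟩⟩
    simp [evalEval_mul, evalEval_pow, evalEval_add, evalEval_C, evalEval_X]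
  | add p q hp hq =>
    obtain ⟨D1, h1⟩ := hp
    obtain ⟨D2, h2⟩ := hq
    refine ⟨max D1 D2, fun D hD => ?_⟩
    obtain ⟨R1, hR1⟩ := h1 D (le_trans (le_max_left _ _) hD)
    obtain ⟨R2, hR2⟩ := h2 D (le_trans (le_max_right _ _) hD)
    refine ⟨R1 + R2, fun x y hx hy => ?_⟩
    rw [evalEval_add, hR1 x y hx hy, hR2 x y hx hy, MvPolynomial.eval_add]
    ring
  | mul_X p n hp =>
    obtain ⟨D1, h1⟩ := hp
    refine ⟨D1 + 1, fun D hD => ?_⟩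
    obtain ⟨D', rfl⟩ : ∃ D', D = D' + 1 := ⟨D - 1, by omega⟩
    obtain ⟨R1, hR1⟩ := h1 D' (by omega)
    fin_cases n
    · refine ⟨R1 * (C (X - C Complex.I) * (X + C (C Complex.I)) + C (X + C Complex.I) * (X - C (C Complex.I))), fun x y hx hy => ?_⟩
      rw [evalEval_mul, hR1 x y hx hy]
      simp only [evalEval_mul, evalEval_add, evalEval_sub, evalEval_C, evalEval_X, Polynomial.eval_add, Polynomial.eval_sub, Polynomial.eval_X, Polynomial.eval_C, MvPolynomial.eval_mul, MvPolynomial.eval_X,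
        pow_succ, cay]
      simp only [Fin.zero_eta, Matrix.cons_val_zero]
      field_simp
    · refine ⟨R1 * (C (X - C Complex.I) * (X - C (C Complex.I))), fun x y hx hy => ?_⟩
      rw [evalEval_mul, hR1 x y hx hy]
      simp only [evalEval_mul, evalEval_add, evalEval_sub, evalEval_C, evalEval_X, Polynomial.eval_add, Polynomial.eval_sub, Polynomial.eval_X, Polynomial.eval_C, MvPolynomial.eval_mul, MvPolynomial.eval_X,
        pow_succ, cay]
      simp only [Fin.mk_one, Matrix.cons_val_one, Matrix.cons_val_zero]
      field_simp

lemma im_add_I_ne {x : ℂ} (hx : 0 < x.im) : x + Complex.I ≠ 0 := by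
  intro h
  have := congrArg Complex.im h
  simp at this
  linarith

lemma cay_lt {x : ℂ} (hx : 0 < x.im) : ‖cay x‖ < 1 := by
  rw [cay, norm_div, div_lt_one (norm_pos_iff.2 (im_add_I_ne hx)), Complex.norm_def, Complex.norm_def]
  apply Real.sqrt_lt_sqrt (Complex.normSq_nonneg _)
  simp only [Complex.normSq_apply, Complex.sub_re, Complex.sub_im, Complex.add_re, Complex.add_im, Complex.I_re, Complex.I_im]
  nlinarith

def icay (z : ℂ) : ℂ := Complex.I * (1 + z) / (1 - z)

lemma one_sub_ne {z : ℂ} (hz : ‖z‖ < 1) : 1 - z ≠ 0 := by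
  intro h
  have : z = 1 := (sub_eq_zero.1 h).symm
  rw [this] at hz
  simp at hz

lemma cay_icay {z : ℂ} (hz : ‖z‖ < 1) : cay (icay z) = z := by
  have h := one_sub_ne hz
  have h1 : icay z + Complex.I = 2 * Complex.I / (1 - z) := by rw [icay]; field_simp; ring
  have h2 : icay z - Complex.I = 2 * Complex.I * z / (1 - z) := by rw [icay]; field_simp; ring
  rw [cay, h1, h2]
  have := Complex.I_ne_zero
  field_simp

lemma icay_ker {z w : ℂ} (hz : ‖z‖ < 1) (hw : ‖w‖ < 1) :
    -Complex.I * (icay z - star (icay w)) = 2 * (1 - star w * z) * (star (1 - w)⁻¹ * (1 - z)⁻¹) := by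
  have h1 := one_sub_ne hz
  have h2 : 1 - star w ≠ 0 := by
    have := star_ne_zero.2 (one_sub_ne hw)
    rwa [star_sub, star_one] at this
  rw [star_inv₀, star_sub, star_one, icay, icay, star_div₀, star_mul', star_sub, star_add, star_one, Complex.star_def, Complex.conj_I]
  rw [Complex.star_def] at h2
  field_simp
  linear_combination (-(1 - (starRingEnd ℂ) w) * (1 + z) - (1 - z) * (1 + (starRingEnd ℂ) w)) * Complex.I_mul_I

lemma icay_im {z : ℂ} (hz : ‖z‖ < 1) : 0 < (icay z).im := by
  have h := icay_ker hz hz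
  have h1 : 0 < Complex.normSq (1 - z) := Complex.normSq_pos.2 (one_sub_ne hz)
  have h2 : Complex.normSq z < 1 := by
    rw [Complex.normSq_eq_norm_sq]; nlinarith [norm_nonneg z]
  have e1 : -Complex.I * (icay z - star (icay z)) = ((2 * (icay z).im : ℝ) : ℂ) := by
    apply Complex.ext <;> simp; ring
  have e2 : 2 * (1 - star z * z) * (star (1 - z)⁻¹ * (1 - z)⁻¹) = ((2 * (1 - Complex.normSq z) * (Complex.normSq (1 - z))⁻¹ : ℝ) : ℂ) := by
    push_cast
    rw [Complex.normSq_eq_conj_mul_self, Complex.normSq_eq_conj_mul_self, star_inv₀, mul_inv]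
    rfl
  rw [e1, e2] at h
  have h3 := Complex.ofReal_injective h
  have : 0 < 2 * (1 - Complex.normSq z) * (Complex.normSq (1 - z))⁻¹ := by
    have := inv_pos.2 h1
    have : 0 < 1 - Complex.normSq z := by linarith
    positivity
  linarith

lemma evalEval_cont (p : ℂ[X][X]) (x y : ℂ) : Continuous fun ε : ℝ => p.evalEval (x + ε * Complex.I) (y + ε * Complex.I) := by
  have : ∀ x y : ℂ, p.evalEval x y = ∑ i ∈ Finset.range (p.natDegree + 1), (p.coeff i).eval x * y ^ i := by
    intro x y
    rw [← map_evalRingHom_eval, eval_eq_sum_range' (n := p.natDegree + 1) (Nat.lt_succ_of_le natDegree_map_le)]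
    simp
  simp only [this]
  refine continuous_finset_sum _ fun i _ => Continuous.mul ?_ ?_
  · exact (Polynomial.continuous _).comp (by fun_prop)
  · fun_prop

lemma norm_matCLM {m k : ℕ} (M : Matrix (Fin m) (Fin k) ℂ) (h : ‖matCLM M‖ ≤ 1) (v : Fin k → ℂ) :
    ∑ l, ‖Matrix.mulVec M v l‖ ^ 2 ≤ ∑ j, ‖v j‖ ^ 2 := by
  have h1 := (matCLM M).le_of_opNorm_le h (WithLp.toLp 2 v)
  rw [one_mul] at h1
  have h2 := pow_le_pow_left₀ (norm_nonneg _) h1 2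
  rw [EuclideanSpace.norm_sq_eq, EuclideanSpace.norm_sq_eq] at h2
  exact h2

lemma psd_boundary {m k : ℕ} (q : ℂ[X][X]) (P : Matrix (Fin m) (Fin k) ℂ[X][X])
    (h : ∀ x y : ℂ, 0 < x.im → 0 < y.im → ∀ v : Fin k → ℂ,
      ∑ l, ‖Matrix.mulVec (eeM P x y) v l‖ ^ 2 ≤ ‖q.evalEval x y‖ ^ 2 * ∑ j, ‖v j‖ ^ 2) :
    PSDm ev2 ((star q * q) • (1 : Matrix (Fin k) (Fin k) ℂ[X][X]) - P.conjTranspose * P) := by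
  refine ⟨?_, ?_⟩
  · rw [Matrix.conjTranspose_sub, Matrix.conjTranspose_mul, Matrix.conjTranspose_conjTranspose, Matrix.conjTranspose_smul,
      Matrix.conjTranspose_one, star_mul', star_star, mul_comm]
  · intro t v
    have hlim : ∑ l, ‖Matrix.mulVec (eeM P t.1 t.2) v l‖ ^ 2 ≤ ‖q.evalEval (t.1 : ℂ) (t.2 : ℂ)‖ ^ 2 * ∑ j, ‖v j‖ ^ 2 := by
      have c1 : Continuous fun ε : ℝ => ∑ l, ‖Matrix.mulVec (eeM P (t.1 + ε * Complex.I) (t.2 + ε * Complex.I)) v l‖ ^ 2 := by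
        refine continuous_finset_sum _ fun l _ => Continuous.pow (Continuous.norm ?_) 2
        simp only [Matrix.mulVec, dotProduct, eeM, Matrix.map_apply]
        exact continuous_finset_sum _ fun j _ => (evalEval_cont _ _ _).mul continuous_const
      have c2 : Continuous fun ε : ℝ => ‖q.evalEval (t.1 + ε * Complex.I) (t.2 + ε * Complex.I)‖ ^ 2 * ∑ j, ‖v j‖ ^ 2 :=
        ((evalEval_cont _ _ _).norm.pow 2).mul continuous_const
      have t1 := (c1.tendsto 0).mono_left (nhdsWithin_le_nhds (s := Set.Ioi 0))
      have t2 := (c2.tendsto 0).mono_left (nhdsWithin_le_nhds (s := Set.Ioi 0))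
      have := le_of_tendsto_of_tendsto t1 t2 (Filter.eventually_of_mem self_mem_nhdsWithin fun ε (hε : 0 < ε) =>
        h _ _ (by simpa using hε) (by simpa using hε) v)
      simpa using this
    have e1 : ∑ i, ∑ j, star (v i) * ev2 t (((star q * q) • (1 : Matrix (Fin k) (Fin k) ℂ[X][X]) - P.conjTranspose * P) i j) * v j =
        ((‖q.evalEval (t.1 : ℂ) (t.2 : ℂ)‖ ^ 2 * ∑ j, ‖v j‖ ^ 2 - ∑ l, ‖Matrix.mulVec (eeM P t.1 t.2) v l‖ ^ 2 : ℝ) : ℂ) := by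
      have n1 : ∀ z : ℂ, ((‖z‖ ^ 2 : ℝ) : ℂ) = star z * z := by
        intro z
        rw [← Complex.normSq_eq_norm_sq, Complex.normSq_eq_conj_mul_self]; rfl
      have e2 : ∀ i j, ev2 t (((star q * q) • (1 : Matrix (Fin k) (Fin k) ℂ[X][X]) - P.conjTranspose * P) i j) =
          (if i = j then star (ev2 t q) * ev2 t q else 0) - ∑ l, star (ev2 t (P l i)) * ev2 t (P l j) := by
        intro i j
        rw [Matrix.sub_apply, Matrix.smul_apply, Matrix.one_apply, Matrix.mul_apply, map_sub, map_sum]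
        congr 1
        · split_ifs
          · rw [smul_eq_mul, mul_one, map_mul, ev2_star]
          · simp
        · exact Finset.sum_congr rfl fun l _ => by rw [Matrix.conjTranspose_apply, map_mul, ev2_star]
      rw [Complex.ofReal_sub, Complex.ofReal_mul, Complex.ofReal_sum, Complex.ofReal_sum, n1]
      simp only [n1]
      have e3 : ∀ l, star (Matrix.mulVec (eeM P t.1 t.2) v l) * Matrix.mulVec (eeM P t.1 t.2) v l =
          ∑ i, ∑ j, star (v i) * (star (ev2 t (P l i)) * ev2 t (P l j)) * v j := by
        intro l
        simp only [Matrix.mulVec, dotProduct, star_sum, star_mul', Finset.sum_mul_sum]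
        refine Finset.sum_congr rfl fun i _ => Finset.sum_congr rfl fun j _ => ?_
        simp only [eeM, Matrix.map_apply, ev2, coe_evalEvalRingHom]
        ring
      have e4 : ∑ l, star (Matrix.mulVec (eeM P t.1 t.2) v l) * Matrix.mulVec (eeM P t.1 t.2) v l =
          ∑ i, ∑ j, star (v i) * (∑ l, star (ev2 t (P l i)) * ev2 t (P l j)) * v j := by
        rw [Finset.sum_congr rfl fun l _ => e3 l, Finset.sum_comm]
        refine Finset.sum_congr rfl fun i _ => ?_
        rw [Finset.sum_comm]
        refine Finset.sum_congr rfl fun j _ => ?_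
        rw [Finset.mul_sum, Finset.sum_mul]
      rw [e4, Finset.mul_sum, ← Finset.sum_sub_distrib]
      refine Finset.sum_congr rfl fun i _ => ?_
      have e5 : star (evalEval (t.1:ℂ) (t.2:ℂ) q) * evalEval (t.1:ℂ) (t.2:ℂ) q * (star (v i) * v i) =
          ∑ j, star (v i) * (if i = j then star (ev2 t q) * ev2 t q else 0) * v j := by
        rw [Finset.sum_eq_single i]
        · rw [if_pos rfl]
          simp only [ev2, coe_evalEvalRingHom]; ring
        · intro j _ hj
          rw [if_neg (Ne.symm hj), mul_zero, zero_mul]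
        · simp
      rw [e5, ← Finset.sum_sub_distrib]
      refine Finset.sum_congr rfl fun j _ => ?_
      rw [e2]; ring
    rw [e1, Complex.ofReal_re]
    linarith

end Polynomial

theorem rational_schur_class_symmetrized_bidisk_admits_finite_dim_realization (m k : ℕ)
    (g : ℂ × ℂ → Matrix (Fin m) (Fin k) ℂ)
    (P : Matrix (Fin m) (Fin k) (MvPolynomial (Fin 2) ℂ)) (q : MvPolynomial (Fin 2) ℂ)
    (hq : ∀ w ∈ symBidisk, eval ![w.1, w.2] q ≠ 0)
    (hg : ∀ w ∈ symBidisk, g w = (eval ![w.1, w.2] q)⁻¹ • P.map (eval ![w.1, w.2]))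
    (hnorm : ∀ w ∈ symBidisk, ‖matCLM (g w)‖ ≤ 1) :
    ∃ (H : Type) (_ : NormedAddCommGroup H) (_ : InnerProductSpace ℂ H)
      (_ : FiniteDimensional ℂ H) (α₁ α₂ : H →L[ℂ] H)
      (β : EuclideanSpace ℂ (Fin k) →L[ℂ] H) (γ : H →L[ℂ] EuclideanSpace ℂ (Fin m))
      (δ : EuclideanSpace ℂ (Fin k) →L[ℂ] EuclideanSpace ℂ (Fin m)),
      GColligationContractive α₁ α₂ β γ δ ∧
        ∀ w ∈ symBidisk,
          IsUnit ((1 : H →L[ℂ] H) - (w.1 / 2) • (α₁ + α₂) + w.2 • (α₁ * α₂)) ∧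
            matCLM (g w) = gTransfer α₁ α₂ β γ δ w.1 w.2 := by
  have hmem : ∀ z ∈ bidisk, (z.1 + z.2, z.1 * z.2) ∈ symBidisk := fun z hz => ⟨z, hz, rfl⟩
  set f : ℂ × ℂ → Matrix (Fin m) (Fin k) ℂ := fun z => g (z.1 + z.2, z.1 * z.2) with hf
  obtain ⟨Dq, hDq⟩ := Polynomial.homog q
  choose DP hDP using fun i j => Polynomial.homog (P i j)
  obtain ⟨D, hDqle, hDPle⟩ : ∃ D, Dq ≤ D ∧ ∀ i j, DP i j ≤ D := by
    refine ⟨Dq + ∑ i, ∑ j, DP i j, by omega, ?_⟩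
    intro i j
    have h1 := Finset.single_le_sum (f := fun i => ∑ j, DP i j) (fun _ _ => Nat.zero_le _) (Finset.mem_univ i)
    have h2 := Finset.single_le_sum (f := fun j => DP i j) (fun _ _ => Nat.zero_le _) (Finset.mem_univ j)
    omega
  obtain ⟨R, hR⟩ := hDq D hDqle
  choose S hS using fun i j => hDP i j D (hDPle i j)
  have hcm : ∀ x y : ℂ, 0 < x.im → 0 < y.im → (Polynomial.cay x, Polynomial.cay y) ∈ bidisk :=
    fun x y hx hy => ⟨Polynomial.cay_lt hx, Polynomial.cay_lt hy⟩
  have hw0 : ∀ x y : ℂ, 0 < x.im → 0 < y.im → ((x + Complex.I) * (y + Complex.I)) ^ D ≠ 0 :=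
    fun x y hx hy => pow_ne_zero _ (mul_ne_zero (Polynomial.im_add_I_ne hx) (Polynomial.im_add_I_ne hy))
  have hR0 : ∀ x y : ℂ, 0 < x.im → 0 < y.im → R.evalEval x y ≠ 0 := by
    intro x y hx hy
    rw [hR x y (Polynomial.im_add_I_ne hx) (Polynomial.im_add_I_ne hy)]
    have h := hq (Polynomial.cay x + Polynomial.cay y, Polynomial.cay x * Polynomial.cay y)
      (hmem (Polynomial.cay x, Polynomial.cay y) (hcm x y hx hy))
    exact mul_ne_zero (hw0 x y hx hy) h
  have hfe : ∀ x y : ℂ, 0 < x.im → 0 < y.im → f (Polynomial.cay x, Polynomial.cay y) = (R.evalEval x y)⁻¹ • Polynomial.eeM (Matrix.of S) x y := by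
    intro x y hx hy
    have h0 := hw0 x y hx hy
    simp only [hf]
    rw [hg (Polynomial.cay x + Polynomial.cay y, Polynomial.cay x * Polynomial.cay y)
      (hmem (Polynomial.cay x, Polynomial.cay y) (hcm x y hx hy))]
    ext i j
    simp only [Matrix.smul_apply, Matrix.map_apply, Polynomial.eeM, Matrix.of_apply, smul_eq_mul]
    rw [hS i j x y (Polynomial.im_add_I_ne hx) (Polynomial.im_add_I_ne hy), hR x y (Polynomial.im_add_I_ne hx) (Polynomial.im_add_I_ne hy),
      mul_inv]
    field_simp
  have hpsd := Polynomial.psd_boundary R (Matrix.of S) (by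
    intro x y hx hy v
    have h1 := Polynomial.norm_matCLM _ (hnorm (Polynomial.cay x + Polynomial.cay y, Polynomial.cay x * Polynomial.cay y)
      (hmem (Polynomial.cay x, Polynomial.cay y) (hcm x y hx hy))) v
    have h2 := hfe x y hx hy
    have h3 : Polynomial.eeM (Matrix.of S) x y = (R.evalEval x y) • f (Polynomial.cay x, Polynomial.cay y) := by
      rw [h2, smul_smul, mul_inv_cancel₀ (hR0 x y hx hy), one_smul]
    rw [h3, Matrix.smul_mulVec]
    simp only [Pi.smul_apply, smul_eq_mul, norm_mul, mul_pow]
    rw [← Finset.mul_sum]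
    exact mul_le_mul_of_nonneg_left h1 (by positivity))
  obtain ⟨κ₁, κ₂, κ₃, _, _, _, A₁, A₂, A₃, hA⟩ := Polynomial.kummert k R (Matrix.of S) hR0 hpsd
  obtain ⟨H, i1, i2, i3, α₁, α₂, β, γ, δ, hcon, hreal⟩ := realize m k f
    (fun z => (((√2 : ℝ) : ℂ) * (1 - z.1)⁻¹) • A₁ (Polynomial.icay z.1) (Polynomial.icay z.2))
    (fun z => (2 * (1 - z.2)⁻¹) • A₂ (Polynomial.icay z.1) (Polynomial.icay z.2))
    (fun z => A₃ (Polynomial.icay z.1) (Polynomial.icay z.2))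
    (fun z _ => by simp only [hf, Prod.fst_swap, Prod.snd_swap, add_comm, mul_comm])
    (by
      intro z hz w hw
      have hfi : ∀ z ∈ bidisk, f z = (R.evalEval (Polynomial.icay z.1) (Polynomial.icay z.2))⁻¹ •
          Polynomial.eeM (Matrix.of S) (Polynomial.icay z.1) (Polynomial.icay z.2) := by
        intro z hz
        rw [← hfe _ _ (Polynomial.icay_im hz.1) (Polynomial.icay_im hz.2), Polynomial.cay_icay hz.1, Polynomial.cay_icay hz.2]
      have h1 := hA _ _ _ _ (Polynomial.icay_im hz.1) (Polynomial.icay_im hz.2) (Polynomial.icay_im hw.1) (Polynomial.icay_im hw.2)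
      rw [hfi z hz, hfi w hw, h1, Polynomial.smul_gram, Polynomial.smul_gram, smul_smul, smul_smul, Polynomial.icay_ker hz.1 hw.1]
      have h2 : -2 * Complex.I * (Polynomial.icay z.2 - star (Polynomial.icay w.2)) =
          (1 - star w.2 * z.2) * (star (2 * (1 - w.2)⁻¹) * (2 * (1 - z.2)⁻¹)) := by
        have h3 := Polynomial.icay_ker hz.2 hw.2
        have h4 : star (2 * (1 - w.2)⁻¹) = 2 * star (1 - w.2)⁻¹ := by
          rw [star_mul']; simp
        rw [h4]
        linear_combination 2 * h3
      have h5 : 2 * (1 - star w.1 * z.1) * (star (1 - w.1)⁻¹ * (1 - z.1)⁻¹) =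
          (1 - star w.1 * z.1) * (star (((√2 : ℝ) : ℂ) * (1 - w.1)⁻¹) * (((√2 : ℝ) : ℂ) * (1 - z.1)⁻¹)) := by
        have h6 : ((√2 : ℝ) : ℂ) * ((√2 : ℝ) : ℂ) = 2 := by
          rw [← Complex.ofReal_mul, Real.mul_self_sqrt (by norm_num)]; simp
        rw [star_mul', Polynomial.star_real]
        linear_combination (-(1 - star w.1 * z.1) * (star (1 - w.1)⁻¹ * (1 - z.1)⁻¹)) * h6
      rw [h2, h5])
  refine ⟨H, i1, i2, i3, α₁, α₂, β, γ, δ, hcon, ?_⟩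
  rintro _ ⟨z, hz, rfl⟩
  exact hreal z hz
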